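/- Let t1 = inf{ t ∈ ℝ : dim_H((−∞, t] ∩ M) = 1 }, where M is the Markov spectrum. Then 3.334369 ≤ t1 ≤ 3.334402 (a rigorous confirmation of Bumby's heuristic localization of the first phase transition point of the classical spectra). -/

import Mathlib

open Filter

/-- Numerators of the convergents of the continued fraction `[a 0; a 1, a 2, …]`. -/
def cfNum (a : ℕ → ℕ) : ℕ → ℕ
  | 0 => a 0
  | 1 => a 1 * a 0 + 1
  | n + 2 => a (n + 2) * cfNum a (n + 1) + cfNum a n

/-- Denominators of the convergents of the continued fraction `[a 0; a 1, a 2, …]`. -/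
def cfDen (a : ℕ → ℕ) : ℕ → ℕ
  | 0 => 1
  | 1 => a 1
  | n + 2 => a (n + 2) * cfDen a (n + 1) + cfDen a n

/-- Value of the infinite continued fraction `[a 0; a 1, a 2, …]` (the limit of its
convergents). -/
noncomputable def cfVal (a : ℕ → ℕ) : ℝ :=
  limUnder atTop fun n => (cfNum a n : ℝ) / (cfDen a n)

/-- Value of the infinite continued fraction `[0; a 0, a 1, …]`. -/
noncomputable def cf01 (a : ℕ → ℕ) : ℝ := 1 / cfVal a

/-- `λ₀(α) = [α 0; α 1, α 2, …] + [0; α (-1), α (-2), …]`. -/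
noncomputable def lambda0 (α : ℤ → ℕ) : ℝ :=
  cfVal (fun n : ℕ => α (n : ℤ)) + cf01 (fun n : ℕ => α (-((n : ℤ) + 1)))

/-- The shift `σ^N` on bi-infinite sequences. -/
def shiftZ (N : ℤ) (α : ℤ → ℕ) : ℤ → ℕ := fun i => α (i + N)

/-- The Markov value `m(α) = sup_{n ∈ ℤ} λ₀(σⁿ α)`. -/
noncomputable def markovValue (α : ℤ → ℕ) : ℝ := ⨆ n : ℤ, lambda0 (shiftZ n α)

/-- The Lagrange value `ℓ(α) = limsup_{n → +∞} λ₀(σⁿ α)`. -/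
noncomputable def lagrangeValue (α : ℤ → ℕ) : ℝ :=
  limsup (fun n : ℕ => lambda0 (shiftZ (n : ℤ) α)) atTop

/-- The Markov spectrum `M`. -/
def MarkovSpectrum : Set ℝ :=
  { x | ∃ α : ℤ → ℕ, (∀ i, 1 ≤ α i) ∧ markovValue α = x }

/-- The Lagrange spectrum `L`. -/
def LagrangeSpectrum : Set ℝ :=
  { x | ∃ α : ℤ → ℕ, (∀ i, 1 ≤ α i) ∧ lagrangeValue α = x }

namespace Bumby

open Topology

/-- The sequence with its first term dropped. -/
def shift (a : ℕ → ℕ) : ℕ → ℕ := fun n => a (n + 1)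

lemma cfNum_cfDen_succ (a : ℕ → ℕ) (n : ℕ) :
    cfNum a (n + 1) = a 0 * cfNum (shift a) n + cfDen (shift a) n ∧
      cfDen a (n + 1) = cfNum (shift a) n := by
  induction n using Nat.strong_induction_on with
  | _ n ih =>
    match n with
    | 0 => simp [cfNum, cfDen, shift, mul_comm]
    | 1 =>
      simp only [cfNum, cfDen, shift]
      constructor
      · ring
      · trivial
    | n + 2 =>
      obtain ⟨h1, h2⟩ := ih (n + 1) (by omega)
      obtain ⟨h3, h4⟩ := ih n (by omega)
      constructor
      · rw [cfNum, h1, h3, cfNum, cfDen]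
        simp only [shift]
        ring
      · rw [cfDen, h2, h4, cfNum]
        simp only [shift]

lemma cfNum_pos {a : ℕ → ℕ} (ha : ∀ n, 1 ≤ a n) (n : ℕ) : 1 ≤ cfNum a n ∧ 1 ≤ cfDen a n := by
  induction n generalizing a with
  | zero => simp [cfNum, cfDen, ha]
  | succ n ih =>
    obtain ⟨h1, h2⟩ := cfNum_cfDen_succ a n
    have := @ih (shift a) (fun n => ha _)
    rw [h1, h2]
    exact ⟨by omega, this.1⟩

/-- Convergents of the continued fraction. -/
noncomputable def conv (a : ℕ → ℕ) (n : ℕ) : ℝ := (cfNum a n : ℝ) / (cfDen a n)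

lemma conv_succ {a : ℕ → ℕ} (ha : ∀ n, 1 ≤ a n) (n : ℕ) :
    conv a (n + 1) = a 0 + 1 / conv (shift a) n := by
  obtain ⟨h1, h2⟩ := cfNum_cfDen_succ a n
  have h := @cfNum_pos (shift a) (fun n => ha _) n
  have h3 : (0 : ℝ) < cfNum (shift a) n := by exact_mod_cast h.1
  have h4 : (0 : ℝ) < cfDen (shift a) n := by exact_mod_cast h.2
  rw [conv, conv, h1, h2]
  push_cast
  field_simp

lemma conv_bounds {a : ℕ → ℕ} (ha : ∀ n, 1 ≤ a n) (n : ℕ) :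
    (a 0 : ℝ) ≤ conv a n ∧ conv a n ≤ a 0 + 1 := by
  induction n generalizing a with
  | zero => simp [conv, cfNum, cfDen]
  | succ n ih =>
    have h := (@ih (shift a) (fun n => ha _)).1
    have h0 : (1 : ℝ) ≤ (shift a 0 : ℕ) := by exact_mod_cast ha _
    have h1 : (1 : ℝ) ≤ conv (shift a) n := h0.trans h
    rw [conv_succ ha]
    have h2 : 0 < 1 / conv (shift a) n := by positivity
    have h3 : 1 / conv (shift a) n ≤ 1 := by
      rw [div_le_one (by positivity)]; exact h1
    constructor <;> linarith

lemma conv_cauchy (k : ℕ) : ∀ {a : ℕ → ℕ}, (∀ n, 1 ≤ a n) → ∀ n m, 2 * k ≤ n → 2 * k ≤ m →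
    |conv a n - conv a m| ≤ (1 / 4) ^ k := by
  induction k with
  | zero =>
    intro a ha n m _ _
    have h1 := conv_bounds ha n
    have h2 := conv_bounds ha m
    rw [abs_le]
    constructor <;> simp <;> linarith
  | succ k ih =>
    intro a ha n m hn hm
    obtain ⟨n, rfl⟩ : ∃ n', n = n' + 1 + 1 := ⟨n - 2, by omega⟩
    obtain ⟨m, rfl⟩ : ∃ n', m = n' + 1 + 1 := ⟨m - 2, by omega⟩
    have hs : ∀ n, 1 ≤ shift a n := fun n => ha _
    have hss : ∀ n, 1 ≤ shift (shift a) n := fun n => ha _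
    rw [conv_succ ha, conv_succ hs, conv_succ ha, conv_succ hs]
    have h1 := (conv_bounds hss n).1
    have h2 := (conv_bounds hss m).1
    have h0 : (1 : ℝ) ≤ (shift (shift a) 0 : ℕ) := by exact_mod_cast hss _
    have hb : (1 : ℝ) ≤ (shift a 0 : ℕ) := by exact_mod_cast hs _
    have hi := ih hss n m (by omega) (by omega)
    set x := conv (shift (shift a)) n
    set y := conv (shift (shift a)) m
    set b : ℝ := ((shift a 0 : ℕ) : ℝ)
    have hx : 1 ≤ x := h0.trans h1
    have hy : 1 ≤ y := h0.trans h2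
    have e : (a 0 + 1 / (b + 1 / x)) - (a 0 + 1 / (b + 1 / y))
        = (x - y) / ((b * x + 1) * (b * y + 1)) := by
      field_simp
      ring
    rw [e, abs_div, abs_of_pos (by positivity : 0 < (b * x + 1) * (b * y + 1)),
      div_le_iff₀ (by positivity), pow_succ]
    have : 4 ≤ (b * x + 1) * (b * y + 1) := by
      have : 2 ≤ b * x + 1 := by nlinarith
      have : 2 ≤ b * y + 1 := by nlinarith
      nlinarith
    have h4 : (0 : ℝ) ≤ (1 / 4) ^ k := by positivity
    nlinarith

lemma conv_tendsto {a : ℕ → ℕ} (ha : ∀ n, 1 ≤ a n) : Tendsto (conv a) atTop (𝓝 (cfVal a)) := by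
  have : CauchySeq (conv a) := by
    rw [Metric.cauchySeq_iff']
    intro ε hε
    obtain ⟨k, hk⟩ := exists_pow_lt_of_lt_one hε (by norm_num : (1 / 4 : ℝ) < 1)
    refine ⟨2 * k, fun n hn => ?_⟩
    rw [Real.dist_eq]
    exact (conv_cauchy k ha n (2 * k) hn le_rfl).trans_lt hk
  exact this.tendsto_limUnder

lemma one_le_cfVal {a : ℕ → ℕ} (ha : ∀ n, 1 ≤ a n) : 1 ≤ cfVal a := by
  have h1 : (1 : ℝ) ≤ a 0 := by exact_mod_cast ha 0
  exact ge_of_tendsto' (conv_tendsto ha) fun n => h1.trans (conv_bounds ha n).1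

lemma cfVal_eq {a : ℕ → ℕ} (ha : ∀ n, 1 ≤ a n) : cfVal a = a 0 + cf01 (shift a) := by
  have hs : ∀ n, 1 ≤ shift a n := fun n => ha _
  have h1 := (conv_tendsto ha).comp (tendsto_add_atTop_nat 1)
  have h2 : Tendsto (fun n => (a 0 : ℝ) + 1 / conv (shift a) n) atTop
      (𝓝 (a 0 + 1 / cfVal (shift a))) :=
    (tendsto_const_nhds.div (conv_tendsto hs) (by linarith [one_le_cfVal hs])).const_add _
  refine tendsto_nhds_unique h1 (h2.congr fun n => ?_)
  simp [conv_succ ha]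

lemma cf01_mem {a : ℕ → ℕ} (ha : ∀ n, 1 ≤ a n) : 0 < cf01 a ∧ cf01 a ≤ 1 := by
  have := one_le_cfVal ha
  rw [cf01]
  constructor
  · positivity
  · rw [div_le_one (by linarith)]; exact this

lemma cf01_eq {a : ℕ → ℕ} (ha : ∀ n, 1 ≤ a n) : cf01 a = 1 / (a 0 + cf01 (shift a)) := by
  rw [cf01, cfVal_eq ha]

/-- `[0; w, 1/y]`: the branch of the inverse Gauss map along the word `w`. -/
noncomputable def app (w : List ℕ) (y : ℝ) : ℝ := w.foldr (fun a x => 1 / (a + x)) y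

@[simp] lemma app_nil (y : ℝ) : app [] y = y := rfl
@[simp] lemma app_cons (a : ℕ) (w : List ℕ) (y : ℝ) : app (a :: w) y = 1 / (a + app w y) := rfl
lemma app_append (v w : List ℕ) (y : ℝ) : app (v ++ w) y = app v (app w y) := by
  simp [app, List.foldr_append]

lemma app_mem {w : List ℕ} (hw : ∀ a ∈ w, 1 ≤ a) {y : ℝ} (h0 : 0 ≤ y) (h1 : y ≤ 1) :
    0 ≤ app w y ∧ app w y ≤ 1 := by
  induction w with
  | nil => exact ⟨h0, h1⟩
  | cons a w ih =>
    have h := ih fun b hb => hw b (by simp [hb])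
    have ha : (1 : ℝ) ≤ a := by exact_mod_cast hw a (by simp)
    have := h.1
    rw [app_cons]
    refine ⟨by positivity, ?_⟩
    rw [div_le_one (by positivity)]
    linarith

/-- Prefix of length `n` of a sequence. -/
def pre (a : ℕ → ℕ) : ℕ → List ℕ
  | 0 => []
  | n + 1 => a 0 :: pre (shift a) n

lemma pre_eq_ofFn (a : ℕ → ℕ) (n : ℕ) : pre a n = List.ofFn fun i : Fin n => a i := by
  induction n generalizing a with
  | zero => simp [pre]
  | succ n ih => simp [pre, ih, List.ofFn_succ, shift]

@[simp] lemma length_pre (a : ℕ → ℕ) (n : ℕ) : (pre a n).length = n := by simp [pre_eq_ofFn]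

lemma getElem_pre (a : ℕ → ℕ) (n i : ℕ) (h : i < (pre a n).length) : (pre a n)[i] = a i := by
  simp [pre_eq_ofFn]

lemma pre_add (a : ℕ → ℕ) (m n : ℕ) :
    pre a (m + n) = pre a m ++ pre (fun i => a (i + m)) n := by
  induction m generalizing a with
  | zero => simp [pre]
  | succ m ih =>
    rw [show m + 1 + n = (m + n) + 1 by ring, pre, pre, ih]
    simp only [List.cons_append, shift]
    rfl

lemma cf01_eq_app {a : ℕ → ℕ} (ha : ∀ n, 1 ≤ a n) (n : ℕ) :
    cf01 a = app (pre a n) (cf01 fun i => a (i + n)) := by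
  induction n generalizing a with
  | zero => simp [pre]
  | succ n ih =>
    rw [cf01_eq ha, pre, app_cons, @ih (shift a) fun n => ha _]
    simp only [shift]
    congr 5

/-- Ratio `q_{n-1}/q_n` of consecutive denominators, started at `t`. -/
noncomputable def rat : ℝ → List ℕ → ℝ
  | t, [] => t
  | t, a :: w => rat (1 / (a + t)) w

/-- Growth of the denominators along `w`, started at ratio `t`. -/
noncomputable def den : ℝ → List ℕ → ℝ
  | _, [] => 1
  | t, a :: w => (a + t) * den (1 / (a + t)) w

lemma rat_append (t : ℝ) (v w : List ℕ) : rat t (v ++ w) = rat (rat t v) w := by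
  induction v generalizing t with
  | nil => rfl
  | cons a v ih => simp [rat, ih]

lemma den_append (t : ℝ) (v w : List ℕ) : den t (v ++ w) = den t v * den (rat t v) w := by
  induction v generalizing t with
  | nil => simp [den, rat]
  | cons a v ih => simp [den, rat, ih, mul_assoc]

lemma rat_mem {w : List ℕ} (hw : ∀ a ∈ w, 1 ≤ a) {t : ℝ} (h0 : 0 ≤ t) (h1 : t ≤ 1) :
    0 ≤ rat t w ∧ rat t w ≤ 1 := by
  induction w generalizing t with
  | nil => exact ⟨h0, h1⟩
  | cons a w ih =>
    have ha : (1 : ℝ) ≤ a := by exact_mod_cast hw a (by simp)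
    refine ih (fun b hb => hw b (by simp [hb])) (by positivity) ?_
    rw [div_le_one (by positivity)]
    linarith

lemma one_le_den {w : List ℕ} (hw : ∀ a ∈ w, 1 ≤ a) {t : ℝ} (h0 : 0 ≤ t) : 1 ≤ den t w := by
  induction w generalizing t with
  | nil => simp [den]
  | cons a w ih =>
    have ha : (1 : ℝ) ≤ a := by exact_mod_cast hw a (by simp)
    have := ih (t := 1 / (a + t)) (fun b hb => hw b (by simp [hb])) (by positivity)
    rw [den]
    nlinarith

lemma den_mul_eq {w : List ℕ} (hw : ∀ a ∈ w, 1 ≤ a) {t y : ℝ} (ht : 0 ≤ t) (hy : 0 ≤ y)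
    (hy1 : y ≤ 1) :
    den t w * (1 + rat t w * y) = (1 + t * app w y) * (den 0 w * (1 + rat 0 w * y)) := by
  induction w generalizing t with
  | nil => simp [den, rat]
  | cons a w ih =>
    have ha : (1 : ℝ) ≤ a := by exact_mod_cast hw a (by simp)
    have hw' : ∀ b ∈ w, 1 ≤ b := fun b hb => hw b (by simp [hb])
    have hx := (app_mem hw' hy hy1).1
    have h1 := @ih hw' (1 / (a + t)) (by positivity)
    have h2 := @ih hw' (1 / (a + 0)) (by positivity)
    simp only [den, rat, app_cons]
    rw [mul_assoc, h1, mul_assoc, h2]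
    have : (a : ℝ) ≠ 0 := by positivity
    have : (a : ℝ) + t ≠ 0 := by positivity
    have : (a : ℝ) + app w y ≠ 0 := by positivity
    field_simp
    ring

lemma den_eq {w : List ℕ} (hw : ∀ a ∈ w, 1 ≤ a) {t : ℝ} (ht : 0 ≤ t) :
    den t w = (1 + t * app w 0) * den 0 w := by
  have := den_mul_eq hw ht le_rfl zero_le_one
  simpa using this

lemma den_le {w : List ℕ} (hw : ∀ a ∈ w, 1 ≤ a) {t : ℝ} (h0 : 0 ≤ t) (h1 : t ≤ 1) :
    den 0 w ≤ den t w ∧ den t w ≤ 2 * den 0 w := by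
  have h := app_mem hw le_rfl zero_le_one
  have hd := one_le_den hw le_rfl
  rw [den_eq hw h0]
  constructor
  · nlinarith [mul_nonneg h0 h.1]
  · nlinarith [mul_le_one₀ h1 h.1 h.2]

lemma den_append_bounds {v w : List ℕ} (hv : ∀ a ∈ v, 1 ≤ a) (hw : ∀ a ∈ w, 1 ≤ a) :
    den 0 v * den 0 w ≤ den 0 (v ++ w) ∧ den 0 (v ++ w) ≤ 2 * (den 0 v * den 0 w) := by
  have h := rat_mem hv le_rfl zero_le_one
  have h2 := den_le hw h.1 h.2
  have hd := one_le_den hv le_rfl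
  rw [den_append]
  constructor <;> nlinarith

/-- Difference formula for inverse branches. -/
lemma app_sub {w : List ℕ} (hw : ∀ a ∈ w, 1 ≤ a) {y y' : ℝ} (hy : 0 ≤ y) (hy1 : y ≤ 1)
    (hy' : 0 ≤ y') (hy1' : y' ≤ 1) :
    app w y - app w y' = (-1) ^ w.length * (y - y') /
      (den 0 w ^ 2 * ((1 + rat 0 w * y) * (1 + rat 0 w * y'))) := by
  induction w with
  | nil => simp [den, rat]
  | cons a w ih =>
    have ha : (1 : ℝ) ≤ a := by exact_mod_cast hw a (by simp)
    have hw' : ∀ b ∈ w, 1 ≤ b := fun b hb => hw b (by simp [hb])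
    have hx := (app_mem hw' hy hy1).1
    have hx' := (app_mem hw' hy' hy1').1
    have key : ∀ z : ℝ, 0 ≤ z → z ≤ 1 → den 0 (a :: w) * (1 + rat 0 (a :: w) * z) =
        (a + app w z) * (den 0 w * (1 + rat 0 w * z)) := by
      intro z h0 h1
      have := @den_mul_eq w hw' (1 / (a + 0)) z (by positivity) h0 h1
      simp only [den, rat]
      rw [mul_assoc, this]
      have : (a : ℝ) ≠ 0 := by positivity
      field_simp
      ring
    have h1 := key y hy hy1
    have h2 := key y' hy' hy1'
    have e : den 0 (a :: w) ^ 2 * ((1 + rat 0 (a :: w) * y) * (1 + rat 0 (a :: w) * y')) =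
        (a + app w y) * (a + app w y') *
          (den 0 w ^ 2 * ((1 + rat 0 w * y) * (1 + rat 0 w * y'))) := by
      linear_combination (den 0 (a :: w) * (1 + rat 0 (a :: w) * y')) * h1
        + ((a + app w y) * (den 0 w * (1 + rat 0 w * y))) * h2
    have hr := (rat_mem hw' le_rfl zero_le_one).1
    have hd := one_le_den hw' le_rfl
    have hp : 0 < den 0 w ^ 2 * ((1 + rat 0 w * y) * (1 + rat 0 w * y')) := by positivity
    rw [e, app_cons, app_cons, List.length_cons, pow_succ]
    have i1 := ih hw'
    have : (a : ℝ) + app w y ≠ 0 := by positivity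
    have : (a : ℝ) + app w y' ≠ 0 := by positivity
    rw [eq_div_iff hp.ne'] at i1
    rw [eq_div_iff (by positivity)]
    field_simp
    linear_combination (-1) * i1

lemma abs_app_sub {w : List ℕ} (hw : ∀ a ∈ w, 1 ≤ a) {y y' : ℝ} (hy : 0 ≤ y) (hy1 : y ≤ 1)
    (hy' : 0 ≤ y') (hy1' : y' ≤ 1) :
    |y - y'| / (4 * den 0 w ^ 2) ≤ |app w y - app w y'| ∧
      |app w y - app w y'| ≤ |y - y'| / den 0 w ^ 2 := by
  have hr := rat_mem hw le_rfl zero_le_one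
  have hd := one_le_den hw le_rfl
  have hr0 := hr.1
  have hd0 : 0 < den 0 w := by linarith
  rw [app_sub hw hy hy1 hy' hy1', abs_div, abs_mul, abs_pow]
  rw [abs_of_pos (by positivity :
    0 < den 0 w ^ 2 * ((1 + rat 0 w * y) * (1 + rat 0 w * y')))]
  simp only [abs_neg, abs_one, one_pow, one_mul]
  have a1 : rat 0 w * y ≤ 1 := mul_le_one₀ hr.2 hy hy1
  have a2 : rat 0 w * y' ≤ 1 := mul_le_one₀ hr.2 hy' hy1'
  have b1 : 0 ≤ rat 0 w * y := by positivity
  have b2 : 0 ≤ rat 0 w * y' := by positivity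
  constructor
  · rw [mul_comm (4 : ℝ)]
    gcongr
    nlinarith
  · gcongr
    have : 1 ≤ (1 + rat 0 w * y) * (1 + rat 0 w * y') := by nlinarith
    nlinarith [sq_nonneg (den 0 w)]

lemma rat_contract {t t' : ℝ} (ht : 0 ≤ t) (ht' : 0 ≤ t') {a b : ℕ} (ha : 1 ≤ a) (hb : 1 ≤ b) :
    |rat t [a, b] - rat t' [a, b]| ≤ (1 / 4) * |t - t'| := by
  have ha' : (1 : ℝ) ≤ a := by exact_mod_cast ha
  have hb' : (1 : ℝ) ≤ b := by exact_mod_cast hb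
  simp only [rat]
  have e : 1 / ((b : ℝ) + 1 / (a + t)) - 1 / (b + 1 / (a + t')) =
      (t - t') / ((b * (a + t) + 1) * (b * (a + t') + 1)) := by
    have : (a : ℝ) + t ≠ 0 := by positivity
    have : (a : ℝ) + t' ≠ 0 := by positivity
    field_simp
    ring
  rw [e, abs_div, abs_of_pos (a := (b * (a + t) + 1) * (b * (a + t') + 1)) (by positivity),
    div_le_iff₀ (by positivity)]
  have : 4 ≤ (b * (a + t) + 1) * (b * (a + t') + 1) := by
    have : 2 ≤ b * (a + t) + 1 := by nlinarith
    have : 2 ≤ b * (a + t') + 1 := by nlinarith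
    nlinarith
  have := abs_nonneg (t - t')
  nlinarith

/-- Sequences in `{1, 2}` all of whose prefixes are accepted from state `s` by the automaton `δ`
with live states `< N`. -/
def Alive (δ : ℕ → ℕ → ℕ) (N s : ℕ) (x : ℕ → ℕ) : Prop :=
  (∀ n, x n = 1 ∨ x n = 2) ∧ ∀ n, (pre x n).foldl δ s < N

lemma Alive.one_le {δ : ℕ → ℕ → ℕ} {N s : ℕ} {x : ℕ → ℕ} (h : Alive δ N s x) :
    ∀ n, 1 ≤ x n := by
  intro n
  rcases h.1 n with h | h <;> omega

lemma Alive.shift {δ : ℕ → ℕ → ℕ} {N s : ℕ} {x : ℕ → ℕ} (h : Alive δ N s x) :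
    Alive δ N (δ s (x 0)) (shift x) :=
  ⟨fun _ => h.1 _, fun n => h.2 (n + 1)⟩

/-- One term of the transfer operator of the automaton. -/
noncomputable def term (δ : ℕ → ℕ → ℕ) (N : ℕ) (f : ℕ → ℝ → ℝ) (s a : ℕ) (x : ℝ) : ℝ :=
  if δ s a < N then f (δ s a) (1 / (a + x)) / (a + x) else 0

/-- A family `f` of positive functions on intervals `[lo s, hi s]`, invariant under the branches of
the automaton. -/
structure Weights (δ : ℕ → ℕ → ℕ) (N : ℕ) (lo hi : ℕ → ℝ) (f : ℕ → ℝ → ℝ) (m M : ℝ) : Prop where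
  m_pos : 0 < m
  le_f : ∀ s < N, ∀ x, lo s ≤ x → x ≤ hi s → m ≤ f s x
  f_le : ∀ s < N, ∀ x, lo s ≤ x → x ≤ hi s → f s x ≤ M
  maps : ∀ s < N, ∀ x, lo s ≤ x → x ≤ hi s → ∀ a, a = 1 ∨ a = 2 → δ s a < N →
    lo (δ s a) ≤ 1 / (a + x) ∧ 1 / (a + x) ≤ hi (δ s a)
  lo_nonneg : ∀ s < N, 0 ≤ lo s
  hi_le : ∀ s < N, hi s ≤ 1

lemma cover_aux {δ : ℕ → ℕ → ℕ} {N : ℕ} {lo hi : ℕ → ℝ} {f : ℕ → ℝ → ℝ} {m M c κ Q : ℝ}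
    (W : Weights δ N lo hi f m M)
    (hsub : ∀ s < N, ∀ x, lo s ≤ x → x ≤ hi s →
      term δ N f s 1 x + term δ N f s 2 x ≤ (1 - c) * f s x)
    (hκ : 0 < κ) (hκ1 : κ ≤ 1) (hc : (3 : ℝ) ^ κ * (1 - c) ≤ 1) (hQ : 1 ≤ Q) (n : ℕ) :
    ∀ s < N, ∀ w : List ℕ, (∀ a ∈ w, 1 ≤ a) → lo s ≤ rat 0 w → rat 0 w ≤ hi s →
      den 0 w ≤ 3 * Q → 2 * Q ≤ den 0 w * (1 + rat 0 w) * (3 / 2) ^ n →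
      ∃ C : Finset ℝ, (C.card : ℝ) ≤ (3 * Q) ^ (1 - κ) / m * (f s (rat 0 w) * den 0 w ^ (κ - 1)) ∧
        ∀ y, Alive δ N s y → ∃ z ∈ C, |app w (cf01 y) - z| ≤ 1 / Q ^ 2 := by
  have hQ0 : 0 < Q := by linarith
  have leaf : ∀ s < N, ∀ w : List ℕ, (∀ a ∈ w, 1 ≤ a) → lo s ≤ rat 0 w → rat 0 w ≤ hi s →
      den 0 w ≤ 3 * Q → Q ≤ den 0 w →
      ∃ C : Finset ℝ, (C.card : ℝ) ≤ (3 * Q) ^ (1 - κ) / m * (f s (rat 0 w) * den 0 w ^ (κ - 1)) ∧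
        ∀ y, Alive δ N s y → ∃ z ∈ C, |app w (cf01 y) - z| ≤ 1 / Q ^ 2 := by
    intro s hs w hw h1 h2 h3 h4
    have hd : 0 < den 0 w := by linarith
    have hm := W.m_pos
    refine ⟨{app w 0}, ?_, fun y hy => ⟨app w 0, by simp, ?_⟩⟩
    · have hf := W.le_f s hs _ h1 h2
      have e : (3 * Q) ^ (1 - κ) / m * (f s (rat 0 w) * den 0 w ^ (κ - 1)) =
          ((3 * Q) ^ (1 - κ) * den 0 w ^ (κ - 1)) * (f s (rat 0 w) / m) := by ring
      have h5 : 1 ≤ (3 * Q) ^ (1 - κ) * den 0 w ^ (κ - 1) := by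
        rw [show κ - 1 = -(1 - κ) by ring, Real.rpow_neg hd.le, ← div_eq_mul_inv,
          one_le_div (by positivity)]
        exact Real.rpow_le_rpow hd.le h3 (by linarith)
      have h6 : 1 ≤ f s (rat 0 w) / m := by rwa [one_le_div hm]
      rw [e]
      simp only [Finset.card_singleton, Nat.cast_one]
      nlinarith
    · have hy' := cf01_mem hy.one_le
      refine ((abs_app_sub hw hy'.1.le hy'.2 le_rfl zero_le_one).2).trans ?_
      rw [sub_zero, abs_of_pos hy'.1]
      have : Q ^ 2 ≤ den 0 w ^ 2 := by gcongr
      exact div_le_div₀ zero_le_one hy'.2 (by positivity) this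
  induction n with
  | zero =>
    intro s hs w hw h1 h2 h3 h4
    refine leaf s hs w hw h1 h2 h3 ?_
    have := W.hi_le s hs
    have := one_le_den hw le_rfl
    simp only [pow_zero, mul_one] at h4
    nlinarith
  | succ n ih =>
    intro s hs w hw h1 h2 h3 h4
    by_cases hq : Q ≤ den 0 w
    · exact leaf s hs w hw h1 h2 h3 hq
    push Not at hq
    have hd1 := one_le_den hw le_rfl
    have hd : 0 < den 0 w := by linarith
    have hx0 : 0 ≤ rat 0 w := (W.lo_nonneg s hs).trans h1
    have hx1 : rat 0 w ≤ 1 := h2.trans (W.hi_le s hs)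
    set x := rat 0 w with hx
    set q := den 0 w with hqd
    have hK : 0 ≤ (3 * Q) ^ (1 - κ) / m := by have := W.m_pos; positivity
    have branch : ∀ a, a = 1 ∨ a = 2 → ∃ C : Finset ℝ,
        (C.card : ℝ) ≤ (3 * Q) ^ (1 - κ) / m * (term δ N f s a x * (3 ^ κ * q ^ (κ - 1))) ∧
        ∀ y, Alive δ N (δ s a) y → ∃ z ∈ C, |app (w ++ [a]) (cf01 y) - z| ≤ 1 / Q ^ 2 := by
      intro a ha
      by_cases hδ : δ s a < N
      · have ha1 : (1 : ℝ) ≤ a := by rcases ha with rfl | rfl <;> norm_num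
        have ha2 : (a : ℝ) ≤ 2 := by rcases ha with rfl | rfl <;> norm_num
        have hm := W.maps s hs x h1 h2 a ha hδ
        have er : rat 0 (w ++ [a]) = 1 / (a + x) := by rw [rat_append]; simp [rat, hx]
        have ed : den 0 (w ++ [a]) = q * (a + x) := by
          rw [den_append]; simp [den, hx, hqd]
        have hax : 0 < a + x := by linarith
        obtain ⟨C, hC, hC'⟩ := ih (δ s a) hδ (w ++ [a])
          (by
            intro b hb
            rcases List.mem_append.1 hb with hb | hb
            · exact hw b hb
            · rcases ha with rfl | rfl <;> simp_all)
          (by rw [er]; exact hm.1) (by rw [er]; exact hm.2) (by rw [ed]; nlinarith)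
          (by
            rw [ed, er]
            refine h4.trans ?_
            rw [pow_succ]
            have e : q * (a + x) * (1 + 1 / (a + x)) = q * (a + x + 1) := by field_simp
            rw [e]
            have : 0 < (3 / 2 : ℝ) ^ n := by positivity
            have : (1 + x) * (3 / 2) ≤ a + x + 1 := by linarith
            calc q * (1 + x) * ((3 / 2) ^ n * (3 / 2))
                = q * ((1 + x) * (3 / 2)) * (3 / 2) ^ n := by ring
              _ ≤ _ := by gcongr)
        refine ⟨C, hC.trans ?_, hC'⟩
        have hf : 0 ≤ f (δ s a) (1 / (a + x)) :=
          W.m_pos.le.trans (W.le_f _ hδ _ hm.1 hm.2)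
        rw [er, ed, term, if_pos hδ]
        refine mul_le_mul_of_nonneg_left ?_ hK
        have e : (q * (a + x)) ^ (κ - 1) = q ^ (κ - 1) * ((a + x) ^ κ / (a + x)) := by
          rw [Real.mul_rpow hd.le hax.le, Real.rpow_sub_one hax.ne']
        have h5 : (a + x) ^ κ ≤ 3 ^ κ := Real.rpow_le_rpow hax.le (by linarith) hκ.le
        rw [e]
        have : 0 ≤ q ^ (κ - 1) := by positivity
        calc f (δ s a) (1 / (a + x)) * (q ^ (κ - 1) * ((a + x) ^ κ / (a + x)))
            = (f (δ s a) (1 / (a + x)) / (a + x)) * (((a + x) ^ κ) * q ^ (κ - 1)) := by ring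
          _ ≤ _ := by gcongr
      · refine ⟨∅, ?_, fun y hy => absurd (hy.2 0) (by simpa [pre] using hδ)⟩
        simp [term, hδ]
    obtain ⟨C₁, hC₁, hC₁'⟩ := branch 1 (Or.inl rfl)
    obtain ⟨C₂, hC₂, hC₂'⟩ := branch 2 (Or.inr rfl)
    refine ⟨C₁ ∪ C₂, ?_, fun y hy => ?_⟩
    · have h5 : ((C₁ ∪ C₂).card : ℝ) ≤ C₁.card + C₂.card := by
        exact_mod_cast Finset.card_union_le _ _
      refine (h5.trans (add_le_add hC₁ hC₂)).trans ?_
      rw [← mul_add, ← add_mul]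
      refine mul_le_mul_of_nonneg_left ?_ hK
      have h6 := hsub s hs x h1 h2
      have hf : 0 ≤ f s x := W.m_pos.le.trans (W.le_f _ hs _ h1 h2)
      have h7 : 0 ≤ q ^ (κ - 1) := by positivity
      calc (term δ N f s 1 x + term δ N f s 2 x) * (3 ^ κ * q ^ (κ - 1))
          ≤ ((1 - c) * f s x) * (3 ^ κ * q ^ (κ - 1)) := by gcongr
        _ = (3 ^ κ * (1 - c)) * (f s x * q ^ (κ - 1)) := by ring
        _ ≤ 1 * (f s x * q ^ (κ - 1)) := by gcongr
        _ = _ := one_mul _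
    · have e : ∀ a, y 0 = a → app w (cf01 y) = app (w ++ [a]) (cf01 (shift y)) := by
        rintro a rfl
        rw [app_append, cf01_eq hy.one_le]
        rfl
      rcases hy.1 0 with h | h
      · obtain ⟨z, hz, hz'⟩ := hC₁' (shift y) (h ▸ hy.shift)
        exact ⟨z, Finset.mem_union_left _ hz, by rwa [e 1 h]⟩
      · obtain ⟨z, hz, hz'⟩ := hC₂' (shift y) (h ▸ hy.shift)
        exact ⟨z, Finset.mem_union_right _ hz, by rwa [e 2 h]⟩

lemma exists_cover {δ : ℕ → ℕ → ℕ} {N : ℕ} {lo hi : ℕ → ℝ} {f : ℕ → ℝ → ℝ} {m M c : ℝ}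
    (W : Weights δ N lo hi f m M) (hN : 0 < N) (hlo : lo 0 ≤ 0) (hhi : 0 ≤ hi 0)
    (hsub : ∀ s < N, ∀ x, lo s ≤ x → x ≤ hi s →
      term δ N f s 1 x + term δ N f s 2 x ≤ (1 - c) * f s x)
    (hc : 0 < c) :
    ∃ d K : ℝ, 0 < d ∧ d < 1 ∧ 0 ≤ K ∧ ∀ Q : ℝ, 1 ≤ Q → ∃ C : Finset ℝ, (C.card : ℝ) ≤ K * Q ^ d ∧
      ∀ y, Alive δ N 0 y → ∃ z ∈ C, |cf01 y - z| ≤ 1 / Q ^ 2 := by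
  obtain ⟨κ, hκ, hκ1, hκc⟩ : ∃ κ : ℝ, 0 < κ ∧ κ < 1 ∧ (3 : ℝ) ^ κ * (1 - c) ≤ 1 := by
    have h1 : Tendsto (fun κ : ℝ => (3 : ℝ) ^ κ * (1 - c)) (𝓝[>] 0)
        (𝓝 ((3 : ℝ) ^ (0 : ℝ) * (1 - c))) := by
      refine Tendsto.mono_left ?_ nhdsWithin_le_nhds
      exact ((Real.continuous_const_rpow (by norm_num)).tendsto 0).mul_const _
    have h2 : ∀ᶠ κ : ℝ in 𝓝[>] 0, (3 : ℝ) ^ κ * (1 - c) < 1 :=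
      h1.eventually_lt_const (by simp [hc])
    have h3 : ∀ᶠ κ : ℝ in 𝓝[>] 0, κ < 1 :=
      (eventually_lt_nhds one_pos).filter_mono nhdsWithin_le_nhds
    obtain ⟨κ, h4, h5, h6⟩ := (h2.and (h3.and self_mem_nhdsWithin)).exists
    exact ⟨κ, h6, h5, h4.le⟩
  refine ⟨1 - κ, 3 ^ (1 - κ) / m * f 0 0, by linarith, by linarith, ?_, fun Q hQ => ?_⟩
  · have := W.m_pos
    have := W.m_pos.le.trans (W.le_f 0 hN 0 hlo hhi)
    positivity
  obtain ⟨n, hn⟩ := pow_unbounded_of_one_lt (2 * Q) (by norm_num : (1 : ℝ) < 3 / 2)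
  obtain ⟨C, hC, hC'⟩ := cover_aux W hsub hκ hκ1.le hκc hQ n 0 hN [] (by simp) hlo hhi
    (by simp [den]; linarith) (by simp [den, rat]; exact hn.le)
  refine ⟨C, hC.trans (le_of_eq ?_), hC'⟩
  simp only [rat, den, Real.one_rpow, mul_one]
  rw [Real.mul_rpow (by norm_num) (by linarith)]
  ring

open MeasureTheory in
/-- A set covered, at every scale `2 / Q²`, by `K * Q ^ (2 * d)` intervals has dimension at most
`d`. -/
lemma dimH_le_of_cover {S : Set ℝ} {d K : ℝ} (hd : 0 < d)
    (h : ∀ Q : ℝ, 1 ≤ Q → ∃ C : Finset ℝ, (C.card : ℝ) ≤ K * Q ^ (2 * d) ∧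
      ∀ y ∈ S, ∃ z ∈ C, |y - z| ≤ 2 / Q ^ 2) : dimH S ≤ ENNReal.ofReal d := by
  choose! C hC hC' using h
  have hQ : ∀ n : ℕ, (1 : ℝ) ≤ 2 ^ n := fun n => one_le_pow₀ (by norm_num)
  have key : μH[(d.toNNReal : ℝ)] S ≠ ⊤ := by
    rw [Real.coe_toNNReal _ hd.le]
    refine ne_top_of_le_ne_top (b := ENNReal.ofReal (K * 4 ^ d)) ENNReal.ofReal_ne_top ?_
    refine (Measure.hausdorffMeasure_le_liminf_sum (β := ℕ) (ι := fun n => C (2 ^ n)) d S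
      (l := atTop) (r := fun n => ENNReal.ofReal (4 * (1 / 4) ^ n)) ?_
      (t := fun n z => Metric.closedBall (z : ℝ) (2 / (2 ^ n) ^ 2)) ?_ ?_).trans ?_
    · rw [← ENNReal.ofReal_zero]
      refine ENNReal.tendsto_ofReal ?_
      simpa using (tendsto_pow_atTop_nhds_zero_of_lt_one (by norm_num)
        (by norm_num : (1 / 4 : ℝ) < 1)).const_mul 4
    · refine Eventually.of_forall fun n z => ?_
      rw [Real.closedBall_eq_Icc, Real.ediam_Icc]
      refine ENNReal.ofReal_le_ofReal (le_of_eq ?_)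
      rw [← pow_mul, mul_comm n, pow_mul]
      norm_num
      rw [div_eq_mul_inv, ← inv_pow]
      ring
    · refine Eventually.of_forall fun n y hy => ?_
      obtain ⟨z, hz, hz'⟩ := hC' _ (hQ n) y hy
      exact Set.mem_iUnion.2 ⟨⟨z, hz⟩, by simpa [Real.dist_eq] using hz'⟩
    · refine liminf_le_of_frequently_le' (Frequently.of_forall fun n => ?_)
      have e : ∀ z : C (2 ^ n), Metric.ediam (Metric.closedBall (z : ℝ) (2 / (2 ^ n) ^ 2)) ^ d =
          ENNReal.ofReal ((4 / (2 ^ n) ^ 2) ^ d) := by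
        intro z
        rw [Real.closedBall_eq_Icc, Real.ediam_Icc, ENNReal.ofReal_rpow_of_nonneg _ hd.le]
        · congr 2; ring
        · ring_nf; positivity
      rw [Finset.sum_congr rfl fun z _ => e z, Finset.sum_const, nsmul_eq_mul,
        ← ENNReal.ofReal_natCast, ← ENNReal.ofReal_mul (by positivity)]
      refine ENNReal.ofReal_le_ofReal ?_
      have h1 := hC _ (hQ n)
      simp only [Finset.card_univ, Fintype.card_coe]
      have hp : (0 : ℝ) < 2 ^ n := by positivity
      rw [Real.div_rpow (by norm_num) (by positivity), ← Real.rpow_natCast (2 ^ n) 2,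
        ← Real.rpow_mul hp.le]
      have h2 : (0 : ℝ) < (2 ^ n) ^ (2 * d) := by positivity
      push_cast
      rw [mul_div_assoc', div_le_iff₀ h2]
      calc ((C (2 ^ n)).card : ℝ) * 4 ^ d ≤ (K * (2 ^ n) ^ (2 * d)) * 4 ^ d := by gcongr
        _ = _ := by ring
  have := dimH_le_of_hausdorffMeasure_ne_top key
  exact this

/-- `λ₀(σⁿ α)`. -/
noncomputable def val (α : ℤ → ℕ) (n : ℤ) : ℝ := lambda0 (shiftZ n α)

/-- The sequence read to the right of position `n`. -/
def right (α : ℤ → ℕ) (n : ℤ) : ℕ → ℕ := fun k => α (n + 1 + k)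

/-- The sequence read to the left of position `n`. -/
def left (α : ℤ → ℕ) (n : ℤ) : ℕ → ℕ := fun k => α (n - 1 - k)

lemma val_eq {α : ℤ → ℕ} (hα : ∀ i, 1 ≤ α i) (n : ℤ) :
    val α n = α n + cf01 (right α n) + cf01 (left α n) := by
  rw [val, lambda0, cfVal_eq (a := fun k : ℕ => shiftZ n α k) fun k => hα _]
  congr 3
  · simp [shiftZ]
  · ext k; simp only [shift, right, shiftZ]; congr 1; push_cast; ring
  · ext k; simp only [left, shiftZ]; congr 1; ring

lemma val_neg {α : ℤ → ℕ} (hα : ∀ i, 1 ≤ α i) (n : ℤ) :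
    val (fun i => α (-i)) n = val α (-n) := by
  rw [val_eq (fun i => hα _), val_eq hα, add_right_comm]
  congr 3
  · ext k; simp only [right, left]; congr 1; ring
  · ext k; simp only [right, left]; congr 1; ring

/-- Successive enclosures of the continued fractions with partial quotients in `{1, 2}`. -/
def enc : ℕ → ℚ × ℚ
  | 0 => (0, 1)
  | n + 1 => (1 / (2 + (enc n).2), 1 / (1 + (enc n).1))

lemma cf01_enc (n : ℕ) {x : ℕ → ℕ} (hx : ∀ n, x n = 1 ∨ x n = 2) :
    (0 : ℚ) ≤ (enc n).1 ∧ ((enc n).1 : ℝ) ≤ cf01 x ∧ cf01 x ≤ (enc n).2 := by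
  have h1 : ∀ n, 1 ≤ x n := fun n => by rcases hx n with h | h <;> omega
  induction n generalizing x with
  | zero => simpa [enc] using ⟨(cf01_mem h1).1.le, (cf01_mem h1).2⟩
  | succ n ih =>
    obtain ⟨h3, h4, h5⟩ := @ih (shift x) (fun n => hx _) (fun n => h1 _)
    have h0 := cf01_mem (a := shift x) fun n => h1 _
    have h6 : (1 : ℝ) ≤ x 0 := by exact_mod_cast h1 0
    have h7 : (x 0 : ℝ) ≤ 2 := by rcases hx 0 with h | h <;> rw [h] <;> norm_num
    have h3' : (0 : ℝ) ≤ (enc n).1 := by exact_mod_cast h3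
    rw [cf01_eq h1, enc]
    push_cast
    refine ⟨?_, ?_, ?_⟩
    · have : (0 : ℚ) ≤ (enc n).2 := by
        have : (0 : ℝ) ≤ (enc n).2 := h0.1.le.trans h5
        exact_mod_cast this
      positivity
    · exact one_div_le_one_div_of_le (by linarith [h0.1]) (by linarith)
    · exact one_div_le_one_div_of_le (by linarith [h0.1]) (by linarith)

lemma cf01_bounds {x : ℕ → ℕ} (hx : ∀ n, x n = 1 ∨ x n = 2) :
    (0.366 : ℝ) ≤ cf01 x ∧ cf01 x ≤ 0.7321 := by
  obtain ⟨_, h1, h2⟩ := cf01_enc 10 hx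
  norm_num [enc] at h1 h2
  constructor <;> linarith

/-- Rational enclosure of the continued fractions in `{1, 2}` starting with `w`. -/
def ivl : List ℕ → ℚ × ℚ
  | [] => (366 / 1000, 7321 / 10000)
  | a :: w => (1 / (a + (ivl w).2), 1 / (a + (ivl w).1))

lemma cf01_ivl (n : ℕ) {x : ℕ → ℕ} (hx : ∀ n, x n = 1 ∨ x n = 2) :
    0 ≤ (ivl (pre x n)).1 ∧ ((ivl (pre x n)).1 : ℝ) ≤ cf01 x ∧ cf01 x ≤ (ivl (pre x n)).2 := by
  have h1 : ∀ n, 1 ≤ x n := fun n => by rcases hx n with h | h <;> omega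
  induction n generalizing x with
  | zero =>
    have := cf01_bounds hx
    simp only [pre, ivl]
    push_cast
    norm_num at this ⊢
    exact this
  | succ n ih =>
    obtain ⟨h3, h4, h5⟩ := @ih (shift x) (fun n => hx _) (fun n => h1 _)
    have h0 := cf01_mem (a := shift x) fun n => h1 _
    have h6 : (1 : ℝ) ≤ x 0 := by exact_mod_cast h1 0
    have h3' : (0 : ℝ) ≤ (ivl (pre (shift x) n)).1 := by exact_mod_cast h3
    rw [cf01_eq h1, pre, ivl]
    push_cast
    refine ⟨?_, ?_, ?_⟩
    · have : (0 : ℚ) ≤ (ivl (pre (shift x) n)).2 := by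
        have : (0 : ℝ) ≤ (ivl (pre (shift x) n)).2 := h0.1.le.trans h5
        exact_mod_cast this
      positivity
    · exact one_div_le_one_div_of_le (by linarith [h0.1]) (by linarith)
    · exact one_div_le_one_div_of_le (by linarith [h0.1]) (by linarith)

/-- The window of length `L` starting at position `q`. -/
def win (α : ℤ → ℕ) (q : ℤ) (L : ℕ) : List ℕ := List.ofFn fun i : Fin L => α (q + (i : ℕ))

/-- Lower bound for `λ₀` at a position with given neighbours. -/
def lowVal (l : List ℕ) (c : ℕ) (r : List ℕ) : ℚ := c + (ivl r).1 + (ivl l).1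

/-- Upper bound for `λ₀` at a position with given neighbours. -/
def upVal (l : List ℕ) (c : ℕ) (r : List ℕ) : ℚ := c + (ivl r).2 + (ivl l).2

lemma val_window {α : ℤ → ℕ} (hα : ∀ i, α i = 1 ∨ α i = 2) {q : ℤ} {f : List ℕ}
    (hf : win α q f.length = f) {i : ℕ} (hi : i < f.length) :
    (lowVal (f.take i).reverse (f.getD i 0) (f.drop (i + 1)) : ℝ) ≤ val α (q + i) ∧
      val α (q + i) ≤ (upVal (f.take i).reverse (f.getD i 0) (f.drop (i + 1)) : ℝ) := by
  have h1 : ∀ i, 1 ≤ α i := fun n => by rcases hα n with h | h <;> omega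
  have hget : ∀ j (hj : j < f.length), f[j] = α (q + j) := by
    intro j hj
    have : f[j] = (win α q f.length)[j]'(by simpa [win] using hj) := by
      simp only [hf]
    rw [this]
    simp [win]
  have hr : pre (right α (q + i)) (f.length - (i + 1)) = f.drop (i + 1) := by
    refine List.ext_getElem (by simp) fun k hk hk' => ?_
    rw [getElem_pre, List.getElem_drop, hget]
    simp only [right]
    congr 1
    push_cast
    ring
  have hl : pre (left α (q + i)) i = (f.take i).reverse := by
    refine List.ext_getElem (by simp; omega) fun k hk hk' => ?_
    rw [getElem_pre, List.getElem_reverse, List.getElem_take, hget]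
    simp only [left]
    simp only [length_pre] at hk
    congr 1
    simp only [List.length_take]
    rw [min_eq_left hi.le]
    omega
  have hc : f.getD i 0 = α (q + i) := by
    rw [List.getD_eq_getElem _ _ hi, hget]
  have e1 := cf01_ivl (f.length - (i + 1)) (x := right α (q + i)) fun n => hα _
  have e2 := cf01_ivl i (x := left α (q + i)) fun n => hα _
  rw [hr] at e1
  rw [hl] at e2
  rw [val_eq h1, hc, lowVal, upVal]
  push_cast
  constructor <;> linarith [e1.2.1, e1.2.2, e2.2.1, e2.2.2]

lemma letters_of_val_le {α : ℤ → ℕ} (hα : ∀ i, 1 ≤ α i) (h : ∀ n, val α n ≤ 3.4) (i : ℤ) :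
    α i = 1 ∨ α i = 2 := by
  have hr : ∀ n, ∀ k, 1 ≤ right α n k := fun n k => hα _
  have hl : ∀ n, ∀ k, 1 ≤ left α n k := fun n k => hα _
  have h3 : ∀ i, α i ≤ 3 := by
    intro i
    by_contra! hc
    have hc' : (4 : ℝ) ≤ α i := by exact_mod_cast hc
    have := h i
    rw [val_eq hα] at this
    linarith [(cf01_mem (hr i)).1, (cf01_mem (hl i)).1]
  have quarter : ∀ x : ℕ → ℕ, (∀ k, 1 ≤ x k) → (x 0 ≤ 3) → 1 / 4 ≤ cf01 x := by
    intro x hx h0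
    have h0' : (x 0 : ℝ) ≤ 3 := by exact_mod_cast h0
    have h1 : (1 : ℝ) ≤ x 0 := by exact_mod_cast hx 0
    have := cf01_mem (a := shift x) fun n => hx _
    rw [cf01_eq hx]
    exact one_div_le_one_div_of_le (by linarith) (by linarith)
  by_contra hc
  have h2 : α i = 3 := by have := hα i; have := h3 i; omega
  have := h i
  rw [val_eq hα, h2] at this
  have a1 := quarter _ (hr i) (h3 _)
  have a2 := quarter _ (hl i) (h3 _)
  norm_num at this
  linarith

lemma dimH_closure_sum_lt_one {E : Set ℝ} {d K : ℝ} (hd : 0 < d) (hd1 : d < 1) (hK : 0 ≤ K)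
    (h : ∀ Q : ℝ, 1 ≤ Q → ∃ C : Finset ℝ, (C.card : ℝ) ≤ K * Q ^ d ∧
      ∀ y ∈ E, ∃ z ∈ C, |y - z| ≤ 1 / Q ^ 2) :
    dimH (closure {x : ℝ | ∃ a : ℝ, (a = 1 ∨ a = 2) ∧ ∃ u ∈ E, ∃ v ∈ E, x = a + u + v}) < 1 := by
  refine (dimH_le_of_cover hd (K := 2 * K ^ 2) fun Q hQ => ?_).trans_lt
    (by rw [← ENNReal.ofReal_one]; exact (ENNReal.ofReal_lt_ofReal_iff one_pos).2 hd1)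
  obtain ⟨C, hC, hC'⟩ := h Q hQ
  classical
  refine ⟨(({1, 2} : Finset ℝ) ×ˢ (C ×ˢ C)).image fun p => p.1 + p.2.1 + p.2.2, ?_, ?_⟩
  · have h1 : ((({1, 2} : Finset ℝ) ×ˢ (C ×ˢ C)).image fun p => p.1 + p.2.1 + p.2.2).card ≤
        2 * (C.card * C.card) := by
      refine Finset.card_image_le.trans ?_
      rw [Finset.card_product, Finset.card_product]
      gcongr
      exact Finset.card_le_two
    have h2 : ((({1, 2} : Finset ℝ) ×ˢ (C ×ˢ C)).image fun p => p.1 + p.2.1 + p.2.2).card ≤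
        (2 * (C.card * C.card) : ℝ) := by exact_mod_cast h1
    refine h2.trans ?_
    have e : Q ^ (2 * d) = Q ^ d * Q ^ d := by
      rw [← Real.rpow_add (by linarith)]; ring_nf
    have : 0 ≤ K * Q ^ d := by positivity
    rw [e]
    nlinarith [mul_le_mul hC hC (by positivity) this]
  · set D := ((({1, 2} : Finset ℝ) ×ˢ (C ×ˢ C)).image fun p => p.1 + p.2.1 + p.2.2)
    have hcl : IsClosed (⋃ z ∈ D, Metric.closedBall z (2 / Q ^ 2)) :=
      Set.Finite.isClosed_biUnion D.finite_toSet fun z _ => Metric.isClosed_closedBall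
    intro y hy
    have : y ∈ ⋃ z ∈ D, Metric.closedBall z (2 / Q ^ 2) := by
      refine closure_minimal ?_ hcl hy
      rintro x ⟨a, ha, u, hu, v, hv, rfl⟩
      obtain ⟨z, hz, hz'⟩ := hC' u hu
      obtain ⟨w, hw, hw'⟩ := hC' v hv
      simp only [Set.mem_iUnion]
      refine ⟨a + z + w, ?_, ?_⟩
      · refine Finset.mem_image.2 ⟨(a, z, w), ?_, rfl⟩
        simp [ha, hz, hw]
      · rw [Metric.mem_closedBall, Real.dist_eq,
          show a + u + v - (a + z + w) = (u - z) + (v - w) by ring]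
        refine (abs_add_le _ _).trans ?_
        rw [show 2 / Q ^ 2 = 1 / Q ^ 2 + 1 / Q ^ 2 by ring]
        exact add_le_add hz' hw'
    simp only [Set.mem_iUnion, Metric.mem_closedBall, Real.dist_eq] at this
    obtain ⟨z, hz, hz'⟩ := this
    exact ⟨z, hz, hz'⟩

/-- If every sequence with all values at most `t` reads, to the right of every position, in a set of
sequences whose continued fractions are thinly covered, then the Markov spectrum below `t` has
dimension less than one. -/
lemma dimH_markov_lt_one {t : ℝ} (ht : t ≤ 3.4) {P : (ℕ → ℕ) → Prop} {d K : ℝ} (hd : 0 < d)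
    (hd1 : d < 1) (hK : 0 ≤ K)
    (h : ∀ Q : ℝ, 1 ≤ Q → ∃ C : Finset ℝ, (C.card : ℝ) ≤ K * Q ^ d ∧
      ∀ y, P y → ∃ z ∈ C, |cf01 y - z| ≤ 1 / Q ^ 2)
    (hP : ∀ α : ℤ → ℕ, (∀ i, α i = 1 ∨ α i = 2) → (∀ n, val α n ≤ t) → ∀ n, P (right α n)) :
    dimH (Set.Iic t ∩ MarkovSpectrum) < 1 := by
  have h1 := dimH_closure_sum_lt_one (E := {y | ∃ x, P x ∧ y = cf01 x}) hd hd1 hK fun Q hQ => by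
    obtain ⟨C, hC, hC'⟩ := h Q hQ
    refine ⟨C, hC, ?_⟩
    rintro _ ⟨x, hx, rfl⟩
    exact hC' x hx
  refine (dimH_mono (t := {0} ∪ closure _) ?_).trans_lt
    (by rw [dimH_union]; exact max_lt (by simp) h1)
  rintro x ⟨hx, α, hα, rfl⟩
  by_cases hb : BddAbove (Set.range (val α))
  · right
    have hle : ∀ n, val α n ≤ t := fun n => (le_ciSup hb n).trans hx
    have hl := letters_of_val_le hα fun n => (hle n).trans ht
    have hle' : ∀ n, val (fun i => α (-i)) n ≤ t := fun n => by rw [val_neg hα]; exact hle _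
    have hmem : markovValue α ∈ closure (Set.range (val α)) :=
      csSup_mem_closure (Set.range_nonempty _) hb
    refine closure_mono ?_ hmem
    rintro _ ⟨n, rfl⟩
    refine ⟨α n, ?_, _, ⟨_, hP α hl hle n, rfl⟩, _, ⟨_, hP _ (fun i => hl _) hle' (-n), rfl⟩, ?_⟩
    · rcases hl n with h | h <;> simp [h]
    · rw [val_eq hα]
      congr 2
      ext k
      simp only [right, left]
      congr 1
      ring
  · left
    have : markovValue α = 0 := Real.sSup_of_not_bddAbove hb
    simp [this]

/-- If `f` occurs in a `{1, 2}`-sequence with all values at most `t`, then no position of `f` has a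
value certified to exceed `t`. -/
lemma not_infix_of_lowVal {α : ℤ → ℕ} (hα : ∀ i, α i = 1 ∨ α i = 2) {t : ℚ}
    (ht : ∀ n, val α n ≤ t) {f : List ℕ} {i : ℕ} (hi : i < f.length)
    (hf : t < lowVal (f.take i).reverse (f.getD i 0) (f.drop (i + 1))) (n : ℤ) (L : ℕ) :
    ¬ f <:+: pre (right α n) L := by
  rintro ⟨u, v, huv⟩
  have hw : win α (n + 1 + u.length) f.length = f := by
    refine List.ext_getElem (by simp [win]) fun k hk hk' => ?_
    have h1 : u.length + k < (pre (right α n) L).length := by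
      rw [← huv]; simp; omega
    have h2 := getElem_pre (right α n) L (u.length + k) h1
    have h3 : (pre (right α n) L)[u.length + k] = f[k] := by
      simp only [← huv, List.append_assoc]
      rw [List.getElem_append_right (by omega), List.getElem_append_left (by simpa using hk')]
      simp
    rw [← h3, h2]
    simp only [win, right, List.getElem_ofFn]
    congr 1
    push_cast
    ring
  have h1 := (val_window hα hw hi).1
  have h2 : (t : ℝ) < (lowVal (f.take i).reverse (f.getD i 0) (f.drop (i + 1)) : ℝ) := by
    exact_mod_cast hf
  linarith [ht (n + 1 + u.length + i)]

/-- Evaluation of the polynomial with the given list of coefficients. -/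
noncomputable def ev : List ℤ → ℝ → ℝ
  | [], _ => 0
  | c :: p, u => c + u * ev p u

/-- Sum of coefficient lists. -/
def padd : List ℤ → List ℤ → List ℤ
  | [], q => q
  | p, [] => p
  | a :: p, b :: q => (a + b) :: padd p q

/-- Scalar multiple of a coefficient list. -/
def psmul (c : ℤ) (p : List ℤ) : List ℤ := p.map (c * ·)

/-- Product of coefficient lists. -/
def pmul : List ℤ → List ℤ → List ℤ
  | [], _ => []
  | a :: p, q => padd (psmul a q) (0 :: pmul p q)

lemma ev_padd (p q : List ℤ) (u : ℝ) : ev (padd p q) u = ev p u + ev q u := by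
  induction p generalizing q with
  | nil => simp [padd, ev]
  | cons a p ih =>
    cases q with
    | nil => simp [padd, ev]
    | cons b q => simp only [padd, ev, ih]; push_cast; ring

lemma ev_psmul (c : ℤ) (p : List ℤ) (u : ℝ) : ev (psmul c p) u = c * ev p u := by
  induction p with
  | nil => simp [psmul, ev]
  | cons a p ih =>
    rw [psmul] at ih ⊢
    simp only [List.map_cons, ev, ih]
    push_cast
    ring

lemma ev_pmul (p q : List ℤ) (u : ℝ) : ev (pmul p q) u = ev p u * ev q u := by
  induction p with
  | nil => simp [pmul, ev]
  | cons a p ih => simp only [pmul, ev_padd, ev_psmul, ev, ih]; push_cast; ring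

/-- Bound for the absolute value of a polynomial on `[-h, h]`. -/
def absEv (h : ℤ) : List ℤ → ℤ
  | [] => 0
  | c :: p => |c| + h * absEv h p

lemma abs_ev_le (p : List ℤ) {u : ℝ} {h : ℤ} (hu : |u| ≤ h) : |ev p u| ≤ absEv h p := by
  induction p with
  | nil => simp [ev, absEv]
  | cons c p ih =>
    have : |u * ev p u| ≤ h * absEv h p := by
      rw [abs_mul]
      exact mul_le_mul hu ih (abs_nonneg _) ((abs_nonneg _).trans hu)
    simp only [ev, absEv]
    push_cast
    exact (abs_add_le _ _).trans (by linarith)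

/-- Sufficient condition for nonnegativity on `[-h, h]`. -/
def nonnegOn (h : ℤ) : List ℤ → Bool
  | [] => true
  | c :: p => decide (h * absEv h p ≤ c)

lemma ev_nonneg {p : List ℤ} {u : ℝ} {h : ℤ} (hu : |u| ≤ h) (hp : nonnegOn h p = true) :
    0 ≤ ev p u := by
  cases p with
  | nil => simp [ev]
  | cons c p =>
    simp only [nonnegOn, decide_eq_true_eq] at hp
    have hp' : (h : ℝ) * absEv h p ≤ c := by exact_mod_cast hp
    have : |u * ev p u| ≤ h * absEv h p := by
      rw [abs_mul]
      exact mul_le_mul hu (abs_ev_le p hu) (abs_nonneg _) ((abs_nonneg _).trans hu)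
    simp only [ev]
    linarith [(abs_le.1 this).1]

/-- The entry of a list at a given position, or the default value `d`. Defined by plain recursors
for fast evaluation in the kernel. -/
noncomputable def nth {α : Type} (l : List α) (d : α) : ℕ → α :=
  List.rec (fun _ => d) (fun a _ ih i => Nat.rec a (fun j _ => ih j) i) l

/-- An automaton over the letters `1, 2` (transitions `D1`, `D2`) together with an interval
`[LO, HI] / 10 ^ 5` and an affine weight `A + B x` for every state. -/
structure Table where
  N : ℕ
  D1 : List ℕ
  D2 : List ℕ
  LO : List ℕ
  HI : List ℕ
  A : List ℤ
  B : List ℤ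

namespace Table

variable (T : Table)

/-- Transition function. -/
noncomputable def step (s a : ℕ) : ℕ :=
  if s < T.N then (if a = 1 then nth T.D1 T.N s else nth T.D2 T.N s) else T.N

/-- Left end of the interval of a state. -/
noncomputable def lo (s : ℕ) : ℝ := ((nth T.LO 0 s : ℕ) : ℝ) / 10 ^ 5

/-- Right end of the interval of a state. -/
noncomputable def hi (s : ℕ) : ℝ := ((nth T.HI 0 s : ℕ) : ℝ) / 10 ^ 5

/-- Weight of a state. -/
noncomputable def wt (s : ℕ) (x : ℝ) : ℝ := ((nth T.A 0 s : ℤ) : ℝ) + ((nth T.B 0 s : ℤ) : ℝ) * x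

/-- The intervals are invariant and the weights positive. -/
noncomputable def checkBasic (s : ℕ) : Bool :=
  let l := nth T.LO 0 s
  let h := nth T.HI 0 s
  let a := nth T.A 0 s
  let b := nth T.B 0 s
  decide (h ≤ 10 ^ 5) &&
  decide (10 ^ 5 ≤ a * 10 ^ 5 + b * l) && decide (10 ^ 5 ≤ a * 10 ^ 5 + b * h) &&
  decide (a * 10 ^ 5 + b * l ≤ 10 ^ 15) && decide (a * 10 ^ 5 + b * h ≤ 10 ^ 15) &&
  [1, 2].all fun c =>
    let t := T.step s c
    decide (T.N ≤ t) ||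
      (decide (nth T.LO 0 t * (c * 10 ^ 5 + h) ≤ 10 ^ 10) &&
        decide (10 ^ 10 ≤ nth T.HI 0 t * (c * 10 ^ 5 + l)))

/-- The sub- (`σ = 1`) or super- (`σ = -1`) invariance of the weights. -/
noncomputable def checkIneq (σ : ℤ) (s : ℕ) : Bool :=
  let l : ℤ := (nth T.LO 0 s : ℕ)
  let h : ℤ := (nth T.HI 0 s : ℕ)
  let m := (l + h) / 2
  let y1 : List ℤ := [10 ^ 5 + m, 1]
  let y2 : List ℤ := [2 * 10 ^ 5 + m, 1]
  let q1 := pmul y1 y1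
  let q2 := pmul y2 y2
  let w (t : ℕ) (y : List ℤ) : List ℤ :=
    if t < T.N then padd (psmul (nth T.A 0 t) y) [nth T.B 0 t * 10 ^ 5] else []
  let F := padd [nth T.A 0 s * 10 ^ 5] (psmul (nth T.B 0 s) [m, 1])
  nonnegOn (h - m) (psmul σ (padd (psmul (10 ^ 6 - σ) (pmul F (pmul q1 q2)))
    (psmul (-(10 ^ 6 * 10 ^ 10))
      (padd (pmul (w (T.step s 1) y1) q2) (pmul (w (T.step s 2) y2) q1)))))
    && decide (l ≤ h)

variable {T}

lemma weights (h : (List.range T.N).all T.checkBasic = true) :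
    Weights T.step T.N T.lo T.hi T.wt 1 (10 ^ 10) := by
  have h' : ∀ s < T.N, T.checkBasic s = true := fun s hs =>
    List.all_eq_true.1 h s (List.mem_range.2 hs)
  have affine : ∀ (a b p l h x : ℝ), l / 10 ^ 5 ≤ x → x ≤ h / 10 ^ 5 →
      p ≤ a * 10 ^ 5 + b * l → p ≤ a * 10 ^ 5 + b * h → p ≤ (a + b * x) * 10 ^ 5 := by
    intro a b p l h x h1 h2 h3 h4
    rw [div_le_iff₀ (by norm_num)] at h1
    rw [le_div_iff₀ (by norm_num)] at h2
    rcases le_total 0 b with hb | hb <;> nlinarith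
  refine ⟨one_pos, ?_, ?_, ?_, ?_, ?_⟩
  · intro s hs x hx hx'
    have := h' s hs
    simp only [checkBasic, Bool.and_eq_true, decide_eq_true_eq] at this
    have h1 := this.1.1.1.1.2
    have h2 := this.1.1.1.2
    rify at h1 h2
    have := affine _ _ _ _ _ x hx hx' h1 h2
    rw [wt]
    linarith
  · intro s hs x hx hx'
    have := h' s hs
    simp only [checkBasic, Bool.and_eq_true, decide_eq_true_eq] at this
    have h1 := this.1.1.2
    have h2 := this.1.2
    rify at h1 h2
    have := affine (-(nth T.A 0 s : ℤ)) (-(nth T.B 0 s : ℤ)) (-10 ^ 15) _ _ x hx hx' (by linarith)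
      (by linarith)
    rw [wt]
    linarith
  · intro s hs x hx hx' a ha hδ
    have := h' s hs
    simp only [checkBasic, Bool.and_eq_true, decide_eq_true_eq] at this
    have h1 := List.all_eq_true.1 this.2 a (by rcases ha with rfl | rfl <;> simp)
    simp only [Bool.or_eq_true, Bool.and_eq_true, decide_eq_true_eq] at h1
    obtain ⟨h2, h3⟩ := h1.resolve_left (by omega)
    rify at h2 h3
    rw [lo] at hx
    rw [hi] at hx'
    rw [div_le_iff₀ (by norm_num)] at hx
    rw [le_div_iff₀ (by norm_num)] at hx'
    have ha1 : (1 : ℝ) ≤ a := by rcases ha with rfl | rfl <;> norm_num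
    have hl : (0 : ℝ) ≤ ((nth T.LO 0 s : ℕ) : ℝ) := by positivity
    have hx0 : 0 ≤ x := by linarith
    have hp : 0 < a + x := by linarith
    rw [lo, hi, le_div_iff₀ hp, div_le_iff₀ hp]
    have hlt : (0 : ℝ) ≤ ((nth T.LO 0 (T.step s a) : ℕ) : ℝ) := by positivity
    have hht : (0 : ℝ) ≤ ((nth T.HI 0 (T.step s a) : ℕ) : ℝ) := by positivity
    constructor <;> nlinarith
  · intro s _
    rw [lo]; positivity
  · intro s hs
    have := h' s hs
    simp only [checkBasic, Bool.and_eq_true, decide_eq_true_eq] at this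
    have h1 := this.1.1.1.1.1
    rify at h1
    rw [hi, div_le_one (by norm_num)]
    exact h1

lemma ineq {σ : ℤ} (h : (List.range T.N).all (T.checkIneq σ) = true) :
    ∀ s < T.N, ∀ x, T.lo s ≤ x → x ≤ T.hi s →
      0 ≤ (σ : ℝ) * ((1 - σ * (1 / 10 ^ 6)) * T.wt s x -
        (term T.step T.N T.wt s 1 x + term T.step T.N T.wt s 2 x)) := by
  intro s hs x hx hx'
  have hc := List.all_eq_true.1 h s (List.mem_range.2 hs)
  simp only [checkIneq, Bool.and_eq_true, decide_eq_true_eq] at hc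
  obtain ⟨hc, hlh⟩ := hc
  rw [lo, div_le_iff₀ (by norm_num)] at hx
  rw [hi, le_div_iff₀ (by norm_num)] at hx'
  set l : ℤ := ((nth T.LO 0 s : ℕ) : ℤ) with hl
  set h : ℤ := ((nth T.HI 0 s : ℕ) : ℤ) with hh
  set m := (l + h) / 2 with hm
  have hl' : ((nth T.LO 0 s : ℕ) : ℝ) = (l : ℝ) := by rw [hl]; push_cast; rfl
  have hh' : ((nth T.HI 0 s : ℕ) : ℝ) = (h : ℝ) := by rw [hh]; push_cast; rfl
  rw [hl'] at hx
  rw [hh'] at hx'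
  have hl0 : (0 : ℝ) ≤ l := by rw [← hl']; positivity
  have hu : |x * 10 ^ 5 - m| ≤ ((h - m : ℤ) : ℝ) := by
    have : 2 * m ≤ l + h := by omega
    have : (2 : ℝ) * m ≤ l + h := by exact_mod_cast this
    push_cast
    rw [abs_le]
    constructor <;> linarith
  have hx0 : 0 ≤ x := by linarith
  have key := ev_nonneg hu hc
  simp only [ev_psmul, ev_padd, ev_pmul, ev] at key
  have term_eq : ∀ a : ℕ, 1 ≤ a → ∀ y : List ℤ, ev y (x * 10 ^ 5 - m) = (a + x) * 10 ^ 5 →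
      ev (if T.step s a < T.N then padd (psmul (nth T.A 0 (T.step s a)) y)
        [nth T.B 0 (T.step s a) * 10 ^ 5] else []) (x * 10 ^ 5 - m) =
      10 ^ 5 * ((a + x) ^ 2 * term T.step T.N T.wt s a x) := by
    intro a ha y hy
    rw [term]
    have : (1 : ℝ) ≤ a := by exact_mod_cast ha
    have : (a : ℝ) + x ≠ 0 := by positivity
    split_ifs
    · simp only [ev_psmul, ev_padd, hy, ev, wt]
      push_cast
      field_simp
      ring
    · simp [ev]
  have e1 := term_eq 1 le_rfl [10 ^ 5 + m, 1] (by simp only [ev]; push_cast; ring)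
  have e2 := term_eq 2 (by norm_num) [2 * 10 ^ 5 + m, 1] (by simp only [ev]; push_cast; ring)
  rw [e1, e2] at key
  rw [wt]
  set t1 := term T.step T.N T.wt s 1 x
  set t2 := term T.step T.N T.wt s 2 x
  push_cast at key
  have hp : 0 < (10 : ℝ) ^ 31 * ((1 + x) ^ 2 * (2 + x) ^ 2) := by positivity
  refine nonneg_of_mul_nonneg_right (a := (10 : ℝ) ^ 31 * ((1 + x) ^ 2 * (2 + x) ^ 2)) ?_ hp
  refine key.trans (le_of_eq ?_)
  ring

end Table

/-- Decimal digits of a natural number with at most `k` digits, in front of `acc`. -/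
def digitsAux : ℕ → ℕ → List ℕ → List ℕ
  | 0, _, acc => acc
  | k + 1, n, acc => if n = 0 then acc else digitsAux k (n / 10) (n % 10 :: acc)

/-- The word written in decimal notation. -/
def word (n : ℕ) : List ℕ := digitsAux 30 n []

/-- An automaton whose language contains all one-sided words of small Markov value. -/
noncomputable def outerTable : Table where
  N := 264
  D1 := [1, 3, 5, 7, 9, 11, 13, 15, 17, 19, 21, 22, 24, 26, 28, 30, 32, 19, 35, 36, 37, 38, 40,
    17, 19, 43, 44, 24, 47, 49, 50, 32, 19, 54, 55, 56, 40, 58, 59, 61, 30, 63, 65, 66, 40, 68,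
    69, 70, 72, 73, 50, 75, 76, 77, 56, 79, 80, 81, 82, 83, 84, 85, 86, 19, 89, 90, 92, 93, 19,
    96, 97, 99, 100, 101, 75, 19, 104, 106, 107, 108, 83, 19, 40, 30, 19, 113, 19, 115, 264, 56,
    118, 119, 83, 19, 122, 123, 124, 30, 126, 19, 128, 129, 130, 131, 132, 133, 134, 135, 136,
    137, 264, 139, 140, 40, 142, 104, 43, 144, 83, 146, 147, 264, 56, 150, 83, 152, 19, 154, 40,
    30, 104, 264, 83, 158, 159, 160, 264, 19, 264, 19, 163, 264, 164, 165, 166, 167, 168, 19, 170,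
    171, 172, 173, 19, 264, 176, 177, 178, 179, 180, 264, 40, 264, 183, 184, 264, 185, 186, 19,
    40, 264, 190, 191, 192, 19, 194, 195, 196, 19, 198, 19, 40, 264, 202, 203, 204, 205, 40, 264,
    264, 208, 92, 209, 264, 264, 212, 213, 214, 215, 216, 264, 264, 89, 219, 264, 264, 40, 264,
    224, 225, 40, 86, 228, 264, 264, 264, 231, 40, 233, 234, 235, 17, 86, 264, 238, 239, 240, 264,
    264, 242, 17, 86, 264, 264, 247, 264, 264, 264, 248, 249, 250, 251, 252, 253, 264, 264, 17,
    256, 257, 264, 80, 264, 30, 258, 259, 28, 264, 264, 264, 262, 263, 144, 147, 264, 264]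
  D2 := [2, 4, 6, 8, 10, 12, 14, 16, 18, 20, 14, 23, 25, 27, 29, 31, 33, 34, 14, 23, 25, 39, 41,
    42, 264, 14, 45, 46, 48, 29, 51, 52, 53, 14, 25, 39, 57, 264, 60, 46, 62, 64, 14, 39, 67, 42,
    14, 71, 46, 48, 74, 52, 14, 25, 78, 264, 60, 64, 23, 67, 42, 264, 87, 88, 14, 91, 60, 94, 95,
    39, 98, 42, 264, 71, 102, 103, 105, 264, 46, 23, 109, 110, 264, 111, 112, 23, 114, 14, 116,
    117, 60, 46, 120, 121, 14, 25, 60, 125, 94, 127, 23, 98, 14, 25, 60, 46, 23, 264, 264, 94,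
    138, 87, 25, 141, 25, 143, 264, 46, 145, 264, 94, 148, 149, 264, 151, 87, 153, 25, 264, 155,
    156, 264, 157, 264, 264, 23, 62, 161, 264, 162, 264, 64, 264, 46, 264, 94, 23, 169, 264, 46,
    23, 94, 174, 175, 264, 87, 46, 94, 23, 264, 181, 182, 25, 23, 23, 264, 23, 187, 188, 189, 39,
    264, 264, 193, 25, 264, 23, 197, 264, 199, 200, 201, 264, 264, 264, 23, 206, 207, 264, 264,
    264, 23, 210, 211, 264, 39, 264, 25, 23, 217, 218, 264, 39, 220, 221, 222, 223, 264, 39, 226,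
    227, 264, 229, 264, 230, 264, 232, 264, 264, 264, 264, 236, 237, 264, 39, 264, 241, 14, 39,
    243, 244, 245, 246, 39, 117, 120, 264, 264, 117, 264, 120, 264, 264, 14, 254, 255, 264, 264,
    264, 264, 264, 264, 117, 120, 264, 264, 260, 261, 264, 264, 264, 264, 109, 51]
  LO := [0, 100000, 50000, 50000, 33333, 66666, 40000, 66666, 40000, 74999, 42857, 59999, 37499,
    71428, 41176, 59999, 37499, 71428, 41666, 57142, 36363, 69999, 62499, 38461, 72726, 42105,
    58333, 36842, 70588, 41379, 61904, 38461, 72221, 42105, 36734, 70588, 63157, 73333, 58823,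
    36956, 61110, 38095, 41860, 70270, 63157, 38709, 42187, 58536, 36922, 70689, 61538, 38095,
    41935, 36666, 70370, 73076, 58620, 37930, 57692, 62962, 38636, 72972, 38235, 72413, 41999,
    70454, 58695, 37999, 72092, 70312, 63043, 38666, 73015, 58571, 38181, 72340, 70422, 73134,
    36986, 57758, 63013, 72463, 63414, 61333, 72115, 57797, 72307, 41964, 36708, 70407, 58653,
    36969, 62999, 72448, 42011, 36752, 58709, 61320, 38011, 72108, 57791, 63056, 41975, 36708,
    58666, 36974, 57746, 72999, 63379, 38016, 36697, 38260, 36746, 63366, 36718, 70434, 42245,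
    36978, 63025, 73006, 38020, 36701, 70414, 73124, 63005, 38265, 72454, 36749, 63371, 61325,
    70429, 73142, 63020, 73003, 63387, 57803, 61203, 72452, 42247, 72324, 73126, 37968, 73140,
    36976, 73002, 38018, 57800, 72451, 42246, 36979, 57761, 38021, 72323, 36702, 73125, 38265,
    36977, 38019, 57801, 61201, 63369, 36703, 36720, 57760, 57755, 73004, 57801, 72453, 63370,
    36703, 70299, 73002, 63386, 72451, 36720, 42246, 57761, 72323, 73003, 72453, 63370, 37969,
    42246, 73141, 63386, 57801, 63370, 36703, 37969, 42246, 58719, 57802, 61204, 36703, 73141,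
    70299, 63386, 36720, 57801, 36703, 37969, 42022, 70299, 57755, 61204, 63370, 37969, 42246,
    70299, 63370, 38284, 42246, 57755, 58719, 61204, 73141, 63370, 42246, 42022, 58719, 38796,
    38284, 37969, 42022, 70299, 58719, 37969, 41966, 70299, 38796, 38284, 57755, 37969, 70299,
    70411, 63003, 41966, 42022, 70411, 58719, 63003, 42022, 58719, 41876, 41966, 38796, 42022,
    58719, 70411, 58681, 63003, 61347, 70411, 63003, 41327, 41876, 70411, 63003, 58681, 61347,
    36980, 38022, 63019, 61977]
  HI := [0, 100000, 50000, 50000, 33334, 66667, 40000, 66667, 40000, 75001, 42858, 60001, 37501,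
    71429, 41667, 60001, 37501, 72223, 41667, 58334, 36364, 70001, 62501, 38890, 73077, 42308,
    58334, 36843, 70834, 41464, 62501, 38462, 72728, 42106, 36843, 70589, 63637, 73334, 58824,
    37038, 61539, 38096, 41936, 70371, 63159, 38710, 42223, 58621, 36957, 70732, 61905, 38182,
    42001, 36735, 70371, 73135, 58696, 38001, 57693, 62964, 38667, 73017, 38299, 72414, 42030,
    70493, 58731, 38029, 72094, 70330, 63078, 38680, 73035, 58587, 38236, 72414, 70455, 73172,
    36987, 57779, 63044, 72501, 63415, 61364, 72132, 57813, 72341, 41976, 36709, 70424, 58667,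
    36975, 63014, 72465, 42017, 36753, 58716, 61334, 38017, 72116, 57799, 63064, 41985, 36719,
    58678, 36980, 57759, 73001, 63389, 38021, 36703, 38266, 36750, 63373, 36724, 70441, 42247,
    36982, 63031, 73010, 38023, 36705, 70418, 73126, 63009, 38268, 72458, 36751, 63375, 61329,
    70435, 73149, 63026, 73007, 63394, 57804, 61208, 72456, 42249, 72328, 73129, 37970, 73144,
    36978, 73005, 38020, 57802, 72454, 42248, 36981, 57763, 38023, 72325, 36704, 73127, 38267,
    36979, 38020, 57803, 61205, 63371, 36704, 36721, 57762, 57757, 73006, 57803, 72455, 63372,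
    36704, 70301, 73004, 63388, 72453, 36722, 42248, 57762, 72325, 73005, 72454, 63371, 37970,
    42248, 73143, 63388, 57803, 63371, 36704, 37970, 42248, 58721, 57803, 61205, 36704, 73143,
    70301, 63388, 36722, 57803, 36704, 37970, 42023, 70301, 57757, 61205, 63371, 37970, 42248,
    70301, 63371, 38285, 42248, 57757, 58721, 61205, 73143, 63371, 42248, 42023, 58721, 38797,
    38285, 37970, 42023, 70301, 58721, 37970, 41967, 70301, 38797, 38285, 57757, 37970, 70301,
    70412, 63005, 41967, 42023, 70412, 58721, 63005, 42023, 58721, 41877, 41967, 38797, 42023,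
    58721, 70412, 58682, 63005, 61349, 70412, 63005, 41329, 41877, 70412, 63005, 58682, 61349,
    36981, 38023, 63020, 61979]
  A := [14031750, 11948347, 12521164, 12800815, 12392709, 11577805, 12549767, 12280923, 11962667,
    10897735, 12345970, 12279964, 9842662, 11431288, 12202918, 12272347, 11775969, 10525273,
    12345870, 12109766, 8832138, 11243209, 11944751, 11924963, 7484648, 12349272, 12235695,
    9847054, 10995433, 12197169, 12024759, 11737803, 10230887, 12279708, 7670908, 11199635,
    11613662, 5949373, 12177480, 9348578, 12240807, 10637723, 12187970, 11224428, 11845853,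
    11873095, 12341397, 12119634, 8823492, 10986596, 12032095, 11203262, 12220901, 6925425,
    11122411, 4202392, 12126467, 9801461, 9477976, 11791819, 11837672, 6740939, 11730067, 8670305,
    12259119, 10986040, 12158622, 10410822, 10448961, 11212459, 11690357, 11858627, 5953465,
    12105177, 11196263, 9485503, 11035043, 3067760, 9131942, 6554550, 11711655, 7491417, 7747789,
    12155181, 10398077, 10827426, 10233796, 12192806, 2918549, 11090598, 12095622, 8823178,
    11760359, 8360774, 12237832, 7483020, 12138090, 12190920, 10079830, 10427770, 9476581,
    11666311, 12204998, 4961370, 12111147, 8926992, 4686934, 6416400, 3088880, 10199553, 9,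
    11501585, 7349859, 9747451, 6925288, 10995936, 7470541, 9049969, 11666958, 5953691, 10328808,
    2151290, 11060890, 3916311, 11730532, 11596294, 7895650, 7427896, 7748458, 12155621, 11013284,
    3, 11689936, 6109284, 9, 10270168, 4595486, 8064023, 3, 9917189, 3713892, 4920629, 3067841,
    8823129, 6293506, 10079770, 9476499, 8245734, 5536434, 8971135, 6083111, 10248916, 10048493,
    997583, 3832510, 11501540, 8868878, 10141053, 9743302, 3, 8924324, 1414945, 6092490, 5749465,
    4686918, 5953730, 10059369, 7895683, 7748491, 1865659, 8157886, 6175460, 2312170, 8133486,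
    6437749, 2598311, 5944978, 9917227, 6022277, 7981832, 8144075, 2879997, 3663841, 1771443,
    1761952, 9476486, 8612206, 997583, 3, 4810718, 7508891, 9856794, 3427306, 1587169, 2309231,
    3662507, 2084397, 6092487, 9594034, 1211137, 965839, 7380017, 5278479, 2686948, 2602192,
    7748499, 2113464, 2598311, 7038359, 8312199, 8876166, 4102232, 3515182, 3, 3085633, 1771443,
    7922791, 3143682, 2518806, 2762096, 7033713, 6836095, 27, 5445254, 3662507, 5679155, 1377812,
    4879194, 5950349, 9072868, 8032412, 2686948, 425379, 4488720, 3549495, 4064026, 3, 9, 8024538,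
    9, 8726802, 3571959, 3879421, 4879565, 2846796, 7033713, 1111832, 1416146, 3, 7476226, 3,
    7645518, 5145779, 5834566, 7324936, 3, 1553642, 2067594, 2729091, 2969061, 4092715, 5416518,
    4015702, 4395378]
  B := [-7811109, -3087609, -4359832, -4513369, -4883054, -3695256, -4720430, -3864872, -4443221,
    -3320151, -4531130, -4018703, -3543491, -3537069, -4515598, -4029308, -4443648, -3299658,
    -4571702, -4010859, -3135518, -3521868, -3893479, -4480222, -2499589, -4554599, -4047612,
    -3562708, -3441485, -4513263, -3904093, -4398135, -3212652, -4527153, -2632386, -3494780,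
    -3785449, -2009519, -4015393, -3343897, -3983349, -3898962, -4493149, -3508668, -3850346,
    -4455032, -4551399, -3997247, -3119448, -3438543, -3919231, -4160159, -4505452, -2318873,
    -3480836, -1446272, -3999661, -3519010, -2981954, -3834593, -4440536, -2264320, -4402857,
    -2818202, -4520911, -3443366, -4010870, -3798559, -3274832, -3504841, -3809442, -4449540,
    -2015110, -3992253, -4155824, -3029833, -3456972, -1073250, -3250989, -1922244, -3812594,
    -2508903, -2757338, -3960982, -3261605, -3504218, -3216674, -4492728, -864477, -3471892,
    -3987480, -3118597, -3825474, -2736672, -4511341, -2553597, -4002812, -3970640, -3646741,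
    -3269182, -2979538, -3800306, -4497890, -1517328, -3993273, -3163105, -1272022, -2161772,
    -1159723, -3701529, 0, -4296812, -2497384, -3304348, -2318501, -3447313, -3109153, -3215900,
    -3801334, -2015419, -3760733, -633167, -3464524, -1352257, -3817937, -4340708, -2615256,
    -2530338, -2758394, -3961699, -3451738, 0, -3807264, -2064649, 0, -3287395, -1225221,
    -2659265, 0, -3138124, -1285828, -1493929, -1073361, -3118466, -2122889, -3646583, -2979397,
    -2706726, -2354064, -3182013, -1757434, -3724076, -3170731, -289387, -1324757, -4296695,
    -3138106, -3674674, -3082862, 0, -3080963, -413391, -1977175, -1640891, -1271993, -2015473,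
    -3205561, -2615302, -2758445, -547823, -2414512, -2085592, -870756, -2677436, -2118563,
    -1156284, -1709180, -3138176, -2037158, -2637811, -2867252, -846943, -1595103, -623290,
    -665556, -2979374, -2995548, -289386, 0, -2061055, -2754909, -3126906, -900987, -464738,
    -810251, -940929, -785831, -1977167, -3024962, -352814, -278163, -3074579, -1458774, -708596,
    -674412, -2758458, -617575, -1156284, -2039925, -2913346, -3564355, -1773472, -940418, 0,
    -807062, -623290, -2806410, -1381161, -1122790, -1073142, -2997855, -2918840, 0, -2317934,
    -940929, -2121905, -399654, -1446553, -1679946, -3640996, -3299297, -708596, -122177,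
    -1204948, -912404, -1079827, 0, 0, -2378421, 0, -2683560, -1557304, -1478376, -1447437,
    -818111, -2997855, -499709, -553872, 0, -2742832, 0, -2758453, -1423605, -1674800, -3067247,
    0, -387543, -533563, -1060486, -1131463, -1702269, -2269657, -1067549, -1169721]

/-- Words read by the states of `outerTable`, in decimal notation. -/
noncomputable def outerLabels : List ℕ :=
  [0, 1, 2, 11, 12, 21, 22, 111, 112, 121, 122, 211, 212, 221, 222, 1111, 1112, 1121, 1122, 1211,
    1212, 1221, 2111, 2112, 2121, 2122, 2211, 2212, 2221, 2222, 11111, 11112, 11121, 11122, 11212,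
    11221, 12111, 12121, 12211, 12212, 21111, 21112, 21122, 21221, 22111, 22112, 22122, 22211,
    22212, 22221, 111111, 111112, 111122, 111212, 111221, 112121, 112211, 121112, 121211, 122111,
    122112, 122121, 211112, 211121, 211122, 211221, 212211, 221112, 221121, 221221, 222111,
    222112, 222121, 222211, 1111112, 1111121, 1111221, 1112121, 1112212, 1121211, 1122111,
    1211121, 1212111, 1221111, 1221121, 1221211, 2111121, 2111122, 2111212, 2111221, 2112211,
    2112212, 2122111, 2211121, 2211122, 2211212, 2212211, 2221111, 2221112, 2221121, 2221211,
    2222111, 11111122, 11111212, 11112211, 11112212, 11121211, 11122121, 11212111, 11221112,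
    12111212, 12211112, 12211212, 12212111, 21111212, 21111221, 21112122, 21112212, 21122111,
    21122121, 21221112, 22111212, 22111221, 22112121, 22122111, 22211112, 22211121, 22211212,
    22212111, 22221111, 111111221, 111112121, 111122111, 111122121, 111212111, 111221211,
    112121111, 112211121, 121112122, 122111121, 122112121, 122121112, 211112121, 211112212,
    211122121, 211221112, 211221211, 212211121, 221112122, 221112212, 221121211, 221221112,
    222111121, 222111212, 222112121, 222211112, 1111112212, 1111221112, 1111221211, 1112121111,
    1112212111, 1122111212, 1221111212, 1221121211, 2111121211, 2111122121, 2111221211,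
    2112211121, 2112212111, 2122111212, 2211121221, 2211122121, 2211212111, 2212211121,
    2221111212, 2221112122, 2221121211, 2222111121, 11111122121, 11112211121, 11112212111,
    11122121112, 11221112122, 12211112121, 12211212111, 21111221211, 21112212111, 21122111212,
    21122121112, 21221112122, 22111212211, 22111221211, 22112121111, 22122111212, 22211112121,
    22211121221, 22211212111, 22221111212, 111111221211, 111122111212, 111122121112, 111221211122,
    112211121221, 122111121211, 122112121111, 211112212111, 211122121112, 211221112122,
    212211121221, 221112212111, 221121211112, 221221112122, 222111121211, 222111212211,
    222112121111, 222211112121, 1111112212111, 1111221112122, 1111221211122, 1122111212211,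
    1221111212112, 1221121211112, 2111122121112, 2111221211122, 2112211121221, 2122111212211,
    2211122121112, 2211212111122, 2212211121221, 2221111212112, 2221121211112, 2222111121211,
    11111122121112, 11112211121221, 11112212111221, 11221112122111, 12211212111122,
    21111221211122, 21112212111221, 21122111212211, 21221112122111, 22111221211122,
    22122111212211, 22211112121122, 22211212111122, 22221111212112, 111111221211122,
    111122111212211, 211112212111221, 211122121112211, 211221112122111, 212211121221111,
    221112212111221, 221221112122111, 222112121111222, 222211112121122, 1111112212111221,
    1111221112122111, 2211122121112211, 2212211121221111, 11111122121112212, 11112211121221112,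
    22111221211122111, 22122111212211111]

/-- Words that force a large value, in decimal notation. -/
noncomputable def outerForbidden : List ℕ :=
  [21212, 12121112, 21112121, 211121222, 222121112, 1111121211, 1121211111, 1211121221,
    1221211121, 11121211112, 21111212111, 211221211122, 221112122112, 1112212111222,
    2221112122111, 12211112121122, 22112121111221, 111122121112211, 112211121221111,
    122112121111222, 222111121211221, 2111122121112212, 2111221211122112, 2112211121221112,
    2122111212211112, 2221121211112222, 2222111121211222, 111111221211122122, 111122111212211122,
    221112212111221111, 221221112122111111]

/-- The word read by a state. -/
noncomputable def outerWord (s : ℕ) : List ℕ := word (nth outerLabels 0 s)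

/-- The transition of `outerTable` at state `s` with letter `a` drops letters only, and is undefined
only if a forbidden word appears. -/
noncomputable def checkOuter (s a : ℕ) : Bool :=
  if outerTable.step s a < outerTable.N then
    (outerWord (outerTable.step s a)).isSuffixOf (outerWord s ++ [a])
  else outerForbidden.any fun f => (word f).isSuffixOf (outerWord s ++ [a])

/-- The word forces a value larger than `t`. -/
def isForcing (t : ℚ) (f : List ℕ) : Bool :=
  (List.range f.length).any fun i =>
    decide (t < lowVal (f.take i).reverse (f.getD i 0) (f.drop (i + 1)))

lemma outer_basic : (List.range outerTable.N).all outerTable.checkBasic = true := by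
  decide +kernel

lemma outer_ineq : (List.range outerTable.N).all (outerTable.checkIneq 1) = true := by
  decide +kernel

lemma outer_lo : nth outerTable.LO 0 0 = 0 := by decide +kernel

lemma outer_hi : nth outerTable.HI 0 0 = 0 := by decide +kernel

lemma outer_check : ((List.range outerTable.N).all fun s => checkOuter s 1 && checkOuter s 2) =
    true := by
  decide +kernel

lemma outer_forcing : (outerForbidden.all fun f => isForcing (3334369 / 1000000) (word f)) =
    true := by
  decide +kernel

lemma outer_alive {α : ℤ → ℕ} (hα : ∀ i, α i = 1 ∨ α i = 2)
    (ht : ∀ n, val α n ≤ ((3334369 / 1000000 : ℚ) : ℝ)) (n : ℤ) :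
    Alive outerTable.step outerTable.N 0 (right α n) := by
  refine ⟨fun k => hα _, fun k => ?_⟩
  suffices (pre (right α n) k).foldl outerTable.step 0 < outerTable.N ∧
      outerWord ((pre (right α n) k).foldl outerTable.step 0) <:+ pre (right α n) k from this.1
  induction k with
  | zero =>
    have h1 : 0 < outerTable.N := by decide +kernel
    have h2 : outerWord 0 = [] := by decide +kernel
    exact ⟨h1, by rw [pre, List.foldl_nil, h2]⟩
  | succ k ih =>
    have hp : pre (right α n) (k + 1) = pre (right α n) k ++ [right α n k] := by
      rw [pre_add]; simp [pre]
    obtain ⟨h1, h2⟩ := ih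
    rw [hp, List.foldl_append]
    simp only [List.foldl_cons, List.foldl_nil]
    set s := (pre (right α n) k).foldl outerTable.step 0
    set a := right α n k with ha
    have ha' : a = 1 ∨ a = 2 := hα _
    have hc : checkOuter s a = true := by
      have := List.all_eq_true.1 outer_check s (List.mem_range.2 h1)
      simp only [Bool.and_eq_true] at this
      rcases ha' with h | h <;> rw [h]
      exacts [this.1, this.2]
    have hsuf : outerWord s ++ [a] <:+ pre (right α n) k ++ [a] := by
      obtain ⟨u, hu⟩ := h2
      exact ⟨u, by rw [← hu, List.append_assoc]⟩
    rw [checkOuter] at hc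
    split_ifs at hc with hlt
    · exact ⟨hlt, (List.isSuffixOf_iff_suffix.1 hc).trans hsuf⟩
    · exfalso
      obtain ⟨f, hf, hf'⟩ := List.any_eq_true.1 hc
      have hfs := ((List.isSuffixOf_iff_suffix.1 hf').trans hsuf).isInfix
      rw [← hp] at hfs
      have hforce := List.all_eq_true.1 outer_forcing f hf
      obtain ⟨i, hi, hi'⟩ := List.any_eq_true.1 hforce
      exact not_infix_of_lowVal hα ht (List.mem_range.1 hi) (of_decide_eq_true hi') n (k + 1) hfs

lemma dimH_outer : dimH (Set.Iic 3.334369 ∩ MarkovSpectrum) < 1 := by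
  obtain ⟨d, K, hd, hd1, hK, h⟩ := exists_cover (Table.weights outer_basic) (by decide +kernel)
    (by rw [Table.lo, outer_lo]; simp) (by rw [Table.hi, outer_hi]; simp) (c := 1 / 10 ^ 6)
    (fun s hs x h1 h2 => by
      have := Table.ineq outer_ineq s hs x h1 h2
      push_cast at this
      linarith) (by norm_num)
  refine dimH_markov_lt_one (by norm_num) hd hd1 hK h fun α hα ht n =>
    outer_alive hα (fun n => ?_) n
  refine (ht n).trans (le_of_eq ?_)
  push_cast
  norm_num

/-- An automaton whose language consists of words of small value. -/
@[irreducible] noncomputable def innerTable : Table where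
  N := 130
  D1 := [0, 4, 6, 8, 9, 10, 11, 1, 16, 13, 22, 23, 25, 0, 28, 29, 30, 31, 32, 33, 34, 35, 36, 37,
    39, 40, 41, 43, 44, 4, 47, 49, 4, 20, 37, 4, 53, 0, 55, 4, 57, 4, 59, 20, 61, 62, 63, 0, 65,
    66, 130, 67, 68, 130, 69, 4, 71, 13, 73, 20, 75, 37, 77, 78, 79, 4, 13, 81, 4, 4, 130, 85,
    130, 86, 87, 88, 89, 90, 91, 4, 130, 94, 130, 96, 97, 98, 130, 99, 100, 4, 13, 102, 103, 104,
    13, 106, 107, 108, 109, 110, 13, 130, 130, 114, 130, 130, 116, 130, 118, 130, 13, 130, 121,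
    41, 130, 124, 125, 1, 126, 41, 127, 130, 130, 1, 130, 130, 0, 129, 130, 34]
  D2 := [18, 5, 3, 3, 7, 2, 12, 14, 17, 21, 130, 24, 2, 26, 3, 14, 15, 2, 19, 3, 24, 27, 7, 38,
    14, 130, 42, 3, 45, 46, 48, 130, 50, 51, 52, 130, 130, 54, 27, 56, 7, 58, 3, 60, 24, 2, 2, 64,
    27, 7, 2, 2, 27, 26, 42, 70, 2, 72, 2, 74, 2, 76, 130, 130, 42, 80, 130, 130, 82, 83, 84, 130,
    27, 130, 2, 130, 27, 7, 7, 92, 93, 7, 95, 2, 130, 7, 7, 130, 7, 101, 130, 130, 2, 130, 105,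
    130, 130, 12, 130, 7, 111, 112, 113, 130, 12, 115, 12, 117, 130, 119, 130, 120, 130, 122, 123,
    130, 130, 130, 38, 130, 130, 12, 3, 128, 60, 38, 130, 60, 3, 130]
  LO := [61716, 72047, 42194, 41280, 57979, 36754, 70300, 38741, 70698, 63241, 73121, 58710,
    36992, 61208, 41876, 38672, 58554, 36930, 38163, 41979, 58671, 37979, 57761, 63004, 38651,
    72994, 38276, 42012, 70470, 72110, 63058, 73023, 72353, 70427, 63019, 72469, 63385, 61338,
    38021, 72117, 57804, 72314, 41966, 70411, 58656, 36970, 36749, 61323, 38012, 57793, 36713,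
    36977, 38019, 61204, 38263, 72451, 36747, 63368, 36721, 70436, 36979, 63027, 73007, 73126,
    38266, 72455, 63372, 73003, 72452, 72324, 36703, 73126, 37969, 73140, 36976, 73002, 38018,
    57800, 57761, 72323, 36702, 57801, 36703, 36720, 42246, 57760, 57756, 73004, 57802, 72453,
    63370, 63386, 36720, 42246, 63370, 42246, 73141, 70299, 63386, 57801, 63370, 36703, 61204,
    73141, 70299, 37969, 70299, 57755, 58719, 61204, 63370, 37969, 42246, 38284, 57755, 42022,
    58719, 38796, 63003, 38284, 42022, 70299, 41966, 38796, 70411, 63003, 61347, 70411, 41876,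
    58681]
  HI := [62032, 72077, 42246, 41446, 58124, 36759, 70327, 38797, 70782, 63300, 73125, 58720,
    36997, 61260, 41903, 38677, 58583, 36942, 38210, 41989, 58682, 37989, 57764, 63009, 38662,
    72997, 38285, 42023, 70485, 72113, 63070, 73031, 72379, 70433, 63024, 72475, 63388, 61349,
    38023, 72124, 57806, 72320, 41971, 70417, 58662, 36973, 36750, 61328, 38015, 57796, 36718,
    36979, 38021, 61206, 38265, 72453, 36749, 63370, 36723, 70440, 36981, 63030, 73009, 73127,
    38267, 72458, 63375, 73005, 72454, 72326, 36704, 73128, 37970, 73142, 36978, 73004, 38019,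
    57802, 57762, 72325, 36704, 57803, 36704, 36721, 42248, 57762, 57757, 73006, 57803, 72455,
    63372, 63388, 36722, 42248, 63371, 42248, 73143, 70301, 63388, 57803, 63371, 36704, 61205,
    73143, 70301, 37970, 70301, 57757, 58721, 61205, 63371, 37970, 42248, 38285, 57757, 42023,
    58721, 38797, 63005, 38285, 42023, 70301, 41967, 38797, 70412, 63005, 61349, 70412, 41877,
    58682]
  A := [12894965, 11270490, 13234050, 13083547, 12966954, 8219093, 12027344, 12774344, 11785289,
    12446227, 4501473, 13028284, 10019486, 13119393, 13061693, 12720942, 12992796, 9456991,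
    12004714, 13102715, 12993498, 10500867, 7021929, 12604227, 12682319, 7221447, 12569406,
    13137684, 11771752, 11193312, 12529159, 6377780, 10162056, 11833891, 12552217, 8025336,
    3309462, 13025802, 11074794, 11139244, 11600203, 10963429, 13072946, 11883865, 12960862,
    9456623, 8017471, 13064016, 10808058, 10152879, 5316549, 9567813, 10936336, 4924087, 12324866,
    8833385, 7874764, 10444627, 7420133, 11791809, 9699545, 12504157, 6378050, 4194996, 12426364,
    8458267, 8302667, 6544750, 8638749, 10624134, 1999115, 3978106, 5272916, 3286274, 9456566,
    6742078, 10807994, 10152784, 6516514, 10764819, 1068936, 10438629, 1516281, 6527924, 5155241,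
    6158951, 5021013, 6378092, 10777214, 8458311, 8302711, 2476810, 6897929, 2784371, 8726562,
    3926538, 1897266, 7543018, 1887110, 10152770, 9228094, 1068936, 3671643, 2473644, 3925092,
    1034935, 5657428, 2878021, 6086877, 2787253, 8302719, 2264538, 2784371, 9509633, 3765756,
    2699208, 2961210, 7534482, 9353998, 7322834, 5834947, 3925092, 5230540, 9720299, 3804028,
    4357375, 8193532, 8599478, 5230937, 8012172]
  B := [-4195980, -3527907, -4880259, -4843359, -4285579, -2821070, -3759754, -4795707, -3688131,
    -4060318, -1549013, -4297843, -3583653, -4271892, -4815416, -4774338, -4285233, -3343232,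
    -4455831, -4830085, -4285243, -3769496, -2059398, -4099848, -4757066, -2425700, -4717087,
    -4844645, -3689465, -3507689, -4082552, -2158694, -3246134, -3707410, -4086294, -2687892,
    -1242513, -4244866, -4031554, -3494142, -3754370, -3446146, -4817224, -3720189, -4272897,
    -3342235, -2735959, -4255090, -3909461, -3192226, -1625944, -3389871, -3968107, -1312852,
    -4604032, -2899623, -2675661, -3540693, -2484096, -3696789, -3446448, -4073969, -2159064,
    -1448470, -4651109, -2801592, -2955670, -2211823, -2848797, -3361825, -587011, -1377312,
    -1600893, -1149793, -3342081, -2274199, -3909292, -3192062, -1882646, -3396739, -310086,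
    -3302911, -442998, -2118437, -2208654, -1757744, -1362668, -2159122, -3434341, -2801653,
    -2955738, -932758, -2269959, -1239078, -3072319, -1709458, -667561, -2186203, -712833,
    -3192037, -3209770, -310085, -965226, -867938, -1008404, -298063, -1563540, -758985, -2274256,
    -722374, -2955752, -661720, -1239078, -3818614, -1007461, -1203202, -1150494, -3211295,
    -2876376, -3126674, -2483821, -1008404, -1550739, -3900692, -977845, -1157812, -2956146,
    -2548821, -1551686, -2939488]

/-- Words that are not in the language of `innerTable`, in decimal notation. -/
noncomputable def innerForbidden : List ℕ :=
  [21212, 12121112, 21112121, 111112121, 121211111, 211121222, 222121112, 1211121221, 1221211121,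
    11121211112, 21111212111, 21112122112, 21122121112, 112212111222, 222111212211,
    12211112121122, 22112121111221, 111122121112211, 112211121221111, 122111212211112,
    122112121111222, 211112212111221, 222111121211221, 2111221211122112, 2112211121221112]

lemma inner_basic : (List.range innerTable.N).all innerTable.checkBasic = true := by
  decide +kernel

lemma inner_ineq : (List.range innerTable.N).all (innerTable.checkIneq (-1)) = true := by
  decide +kernel

lemma inner_forbidden : ((List.range innerTable.N).all fun s => innerForbidden.all fun f =>
    decide (innerTable.N ≤ (word f).foldl innerTable.step s)) = true := by
  decide +kernel

/-- Check by exhaustion that every sequence containing `l.reverse ++ [c] ++ r` has value at most `t`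
at `c`, or contains an element of `W` not far to the left of `c`. -/
def chk (t : ℚ) (W : List (List ℕ)) : ℕ → List ℕ → ℕ → List ℕ → Bool
  | 0, l, c, r => decide (upVal l c r ≤ t) ||
      (decide (l.length ≤ 13) && W.any fun f => decide (f <:+: l.reverse ++ c :: r))
  | k + 1, l, c, r => chk t W 0 l c r ||
      if (ivl r).2 - (ivl r).1 ≤ (ivl l).2 - (ivl l).1 then
        chk t W k (l ++ [1]) c r && chk t W k (l ++ [2]) c r
      else chk t W k l c (r ++ [1]) && chk t W k l c (r ++ [2])

lemma inner_chk : (chk (33344015 / 10000000) (innerForbidden.map word) 30 [] 1 [] &&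
    chk (33344015 / 10000000) (innerForbidden.map word) 30 [] 2 []) = true := by
  decide +kernel

lemma pre_snoc {x : ℕ → ℕ} {w : List ℕ} (h : pre x w.length = w) :
    pre x (w ++ [x w.length]).length = w ++ [x w.length] := by
  rw [List.length_append, pre_add, h]
  simp [pre]

lemma of_chk {α : ℤ → ℕ} (hα : ∀ i, α i = 1 ∨ α i = 2) {t : ℚ} {W : List (List ℕ)} {n : ℤ}
    {k : ℕ} {l r : List ℕ} (h : chk t W k l (α n) r = true) (hl : pre (left α n) l.length = l)
    (hr : pre (right α n) r.length = r) :
    val α n ≤ t ∨ ∃ f ∈ W, ∃ q : ℤ, n - 13 ≤ q ∧ win α q f.length = f := by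
  have h1 : ∀ i, 1 ≤ α i := fun n => by rcases hα n with h | h <;> omega
  have base : ∀ l r : List ℕ, chk t W 0 l (α n) r = true → pre (left α n) l.length = l →
      pre (right α n) r.length = r →
      val α n ≤ t ∨ ∃ f ∈ W, ∃ q : ℤ, n - 13 ≤ q ∧ win α q f.length = f := by
    intro l r h hl hr
    simp only [chk, Bool.or_eq_true, Bool.and_eq_true, decide_eq_true_eq, List.any_eq_true] at h
    rcases h with h | ⟨h13, f, hf, u, v, huv⟩
    · left
      have e1 := (cf01_ivl r.length (x := right α n) fun n => hα _).2.2
      have e2 := (cf01_ivl l.length (x := left α n) fun n => hα _).2.2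
      rw [hr] at e1
      rw [hl] at e2
      have h' : ((upVal l (α n) r : ℚ) : ℝ) ≤ t := by exact_mod_cast h
      rw [upVal] at h'
      push_cast at h'
      rw [val_eq h1]
      linarith
    · right
      refine ⟨f, hf, n - l.length + u.length, by omega, ?_⟩
      refine List.ext_getElem (by simp [win]) fun k hk hk' => ?_
      have hlen : u.length + k < (l.reverse ++ α n :: r).length := by rw [← huv]; simp; omega
      have e1 : (l.reverse ++ α n :: r)[u.length + k] = f[k] := by
        simp only [← huv, List.append_assoc]
        rw [List.getElem_append_right (by omega), List.getElem_append_left (by simpa using hk')]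
        simp
      rw [← e1]
      simp only [win, List.getElem_ofFn]
      simp only [List.length_append, List.length_reverse, List.length_cons] at hlen
      rcases lt_trichotomy (u.length + k) l.length with hlt | heq | hgt
      · rw [List.getElem_append_left (by simpa using hlt), List.getElem_reverse]
        have := getElem_pre (left α n) l.length (l.length - 1 - (u.length + k)) (by simp; omega)
        simp only [hl] at this
        rw [this, left]
        congr 1
        push_cast [show u.length + k ≤ l.length - 1 by omega, show 1 ≤ l.length by omega]
        ring
      · rw [List.getElem_append_right (by simp; omega)]
        simp only [List.length_reverse, heq, Nat.sub_self, List.getElem_cons_zero]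
        congr 1
        omega
      · rw [List.getElem_append_right (by simp; omega)]
        obtain ⟨j, hj⟩ := Nat.exists_eq_add_of_lt hgt
        have hj' : u.length + k - l.reverse.length = j + 1 := by simp; omega
        simp only [hj', List.getElem_cons_succ]
        have := getElem_pre (right α n) r.length j (by simp; omega)
        simp only [hr] at this
        rw [this, right]
        congr 1
        omega
  induction k generalizing l r with
  | zero => exact base l r h hl hr
  | succ k ih =>
    rw [chk, Bool.or_eq_true] at h
    rcases h with h | h
    · exact base l r h hl hr
    split_ifs at h
    · rw [Bool.and_eq_true] at h
      have : chk t W k (l ++ [left α n l.length]) (α n) r = true := by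
        rcases hα (n - 1 - l.length) with h' | h' <;> rw [left, h']
        exacts [h.1, h.2]
      exact ih this (pre_snoc hl) hr
    · rw [Bool.and_eq_true] at h
      have : chk t W k l (α n) (r ++ [right α n r.length]) = true := by
        rcases hα (n + 1 + r.length) with h' | h' <;> rw [right, h']
        exacts [h.1, h.2]
      exact ih this hl (pre_snoc hr)

/-- The bi-infinite sequence with `2` at the origin, `x` to the right and `y` to the left. -/
def bi (x y : ℕ → ℕ) (n : ℤ) : ℕ :=
  if 0 < n then x (n - 1).toNat else if n = 0 then 2 else y (-n - 1).toNat

lemma bi_pos (x y : ℕ → ℕ) (k : ℕ) : bi x y (k + 1) = x k := by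
  rw [bi, if_pos (by omega)]; congr 1; omega

lemma bi_neg (x y : ℕ → ℕ) (k : ℕ) : bi x y (-(k + 1)) = y k := by
  rw [bi, if_neg (by omega), if_neg (by omega)]; congr 1; omega

lemma bi_reflect (x y : ℕ → ℕ) : (fun i => bi x y (-i)) = bi y x := by
  ext i
  simp only [bi]
  split_ifs <;> first | omega | rfl | skip
  simp

lemma win_bi (x y : ℕ → ℕ) (k : ℕ) :
    win (bi x y) (-k) (2 * k + 1) = (pre y k).reverse ++ 2 :: pre x k := by
  refine List.ext_getElem (by simp [win]; omega) fun i hi hi' => ?_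
  simp only [win, List.length_ofFn] at hi
  simp only [win, List.getElem_ofFn]
  rcases lt_trichotomy i k with h | h | h
  · rw [List.getElem_append_left (by simpa using h), List.getElem_reverse, getElem_pre,
      ← bi_neg x y]
    congr 1
    simp only [length_pre]
    omega
  · rw [List.getElem_append_right (by simp; omega)]
    simp [h, bi]
  · obtain ⟨j, rfl⟩ := Nat.exists_eq_add_of_lt h
    rw [List.getElem_append_right (by simp; omega)]
    have hj' : k + j + 1 - (pre y k).reverse.length = j + 1 := by simp; omega
    simp only [hj', List.getElem_cons_succ]
    rw [getElem_pre, ← bi_pos x y]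
    congr 1
    push_cast
    ring

lemma step_foldl_dead (T : Table) {s : ℕ} (hs : T.N ≤ s) (w : List ℕ) :
    T.N ≤ w.foldl T.step s := by
  induction w generalizing s with
  | nil => exact hs
  | cons a w ih => exact ih (by rw [Table.step, if_neg (by omega)])

lemma not_forbidden {x : ℕ → ℕ} (hx : Alive innerTable.step innerTable.N 0 x) {f : ℕ}
    (hf : f ∈ innerForbidden) (k : ℕ) :
    pre (fun i => x (i + k)) (word f).length ≠ word f := by
  intro h
  have h1 := hx.2 k
  have h2 := hx.2 (k + (word f).length)
  rw [pre_add, h, List.foldl_append] at h2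
  have := List.all_eq_true.1 (List.all_eq_true.1 inner_forbidden _ (List.mem_range.2 h1)) f hf
  have := of_decide_eq_true this
  omega

lemma bi_letters {x y : ℕ → ℕ} (hx : ∀ n, x n = 1 ∨ x n = 2) (hy : ∀ n, y n = 1 ∨ y n = 2)
    (n : ℤ) : bi x y n = 1 ∨ bi x y n = 2 := by
  rw [bi]
  split_ifs
  exacts [hx _, Or.inr rfl, hy _]

lemma val_bi_far {x y : ℕ → ℕ} (hx : Alive innerTable.step innerTable.N 0 x)
    (hy : ∀ n, y n = 1 ∨ y n = 2) {n : ℤ} (hn : 14 ≤ n) :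
    val (bi x y) n ≤ ((33344015 / 10000000 : ℚ) : ℝ) := by
  have hl := bi_letters hx.1 hy
  have hc : chk (33344015 / 10000000) (innerForbidden.map word) 30 [] (bi x y n) [] = true := by
    have := inner_chk
    rw [Bool.and_eq_true] at this
    rcases hl n with h | h <;> rw [h]
    exacts [this.1, this.2]
  refine (of_chk hl hc rfl rfl).resolve_right ?_
  rintro ⟨_, hf, q, hq, hw⟩
  obtain ⟨f, hf', rfl⟩ := List.mem_map.1 hf
  refine not_forbidden hx hf' (q - 1).toNat (Eq.trans ?_ hw)
  rw [pre_eq_ofFn, win]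
  congr 1
  ext i
  rw [← bi_pos x y]
  congr 1
  omega

/-- The fixed part of the sequences to the right of the origin. -/
def coreRight : List ℕ := [1, 2, 2, 1, 1, 1, 2, 1, 1, 1, 1, 1, 1] ++ List.replicate 23 1

/-- The fixed part of the sequences to the left of the origin. -/
def coreLeft : List ℕ := [1, 1, 1, 2, 2, 1, 1, 2, 2, 1, 1, 2, 1, 1] ++ List.replicate 22 1

lemma core_run : coreRight.foldl innerTable.step 0 = 0 ∧ coreLeft.foldl innerTable.step 0 = 0 := by
  decide +kernel

lemma core_val : 33344015 / 10000000 ≤ lowVal coreLeft 2 coreRight ∧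
    upVal coreLeft 2 coreRight ≤ 3334402 / 1000000 := by
  decide +kernel

/-- The fixed part of the bi-infinite sequences. -/
def core : List ℕ := coreLeft.reverse ++ 2 :: coreRight

lemma core_val_near : ∀ i < 73, 23 ≤ i → i ≤ 49 → i ≠ 36 →
    upVal (core.take i).reverse (core.getD i 0) (core.drop (i + 1)) ≤ 33344015 / 10000000 := by
  decide +kernel

lemma val_bi_near {x y : ℕ → ℕ} (hx : ∀ n, x n = 1 ∨ x n = 2) (hy : ∀ n, y n = 1 ∨ y n = 2)
    (hx' : pre x 36 = coreRight) (hy' : pre y 36 = coreLeft) {n : ℤ} (h1 : -13 ≤ n) (h2 : n ≤ 13)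
    (h0 : n ≠ 0) : val (bi x y) n ≤ ((33344015 / 10000000 : ℚ) : ℝ) := by
  have hw : win (bi x y) (-(36 : ℕ)) core.length = core := by
    have := win_bi x y 36
    rwa [hx', hy'] at this
  obtain ⟨i, hi⟩ := Int.eq_ofNat_of_zero_le (show 0 ≤ n + 36 by omega)
  have h := (val_window (bi_letters hx hy) hw (i := i) (by
    have : core.length = 73 := rfl
    omega)).2
  have h3 : ((upVal (core.take i).reverse (core.getD i 0) (core.drop (i + 1)) : ℚ) : ℝ) ≤
      ((33344015 / 10000000 : ℚ) : ℝ) := by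
    exact_mod_cast core_val_near i (by omega) (by omega) (by omega) (by omega)
  rw [show n = -(36 : ℕ) + i by push_cast; omega]
  exact h.trans h3

/-- Concatenation of a word and a sequence. -/
def cat (w : List ℕ) (x : ℕ → ℕ) (n : ℕ) : ℕ :=
  if n < w.length then w.getD n 0 else x (n - w.length)

lemma pre_cat (w : List ℕ) (x : ℕ → ℕ) : pre (cat w x) w.length = w := by
  refine List.ext_getElem (by simp) fun i hi hi' => ?_
  rw [getElem_pre, cat, if_pos hi', List.getD_eq_getElem _ _ hi']

lemma cat_add (w : List ℕ) (x : ℕ → ℕ) : (fun i => cat w x (i + w.length)) = x := by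
  ext i
  rw [cat, if_neg (by omega)]
  congr 1
  omega

lemma cf01_cat {w : List ℕ} {x : ℕ → ℕ} (h : ∀ n, 1 ≤ cat w x n) :
    cf01 (cat w x) = app w (cf01 x) := by
  rw [cf01_eq_app h w.length, pre_cat, cat_add]

lemma alive_of_frequently {T : Table} {s : ℕ} {x : ℕ → ℕ} (hx : ∀ n, x n = 1 ∨ x n = 2)
    (h : ∀ n, ∃ m, n ≤ m ∧ (pre x m).foldl T.step s < T.N) : Alive T.step T.N s x := by
  refine ⟨hx, fun n => ?_⟩
  obtain ⟨m, hm, hlt⟩ := h n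
  obtain ⟨k, rfl⟩ := Nat.exists_eq_add_of_le hm
  rw [pre_add, List.foldl_append] at hlt
  by_contra! hc
  have := step_foldl_dead T hc (pre (fun i => x (i + n)) k)
  omega

lemma alive_cat {T : Table} {w : List ℕ} {x : ℕ → ℕ} {s s' : ℕ} (hw : ∀ a ∈ w, a = 1 ∨ a = 2)
    (hs : w.foldl T.step s = s') (hx : Alive T.step T.N s' x) :
    Alive T.step T.N s (cat w x) := by
  refine alive_of_frequently (fun n => ?_) fun n => ⟨w.length + n, by omega, ?_⟩
  · rw [cat]
    split_ifs with h
    · rw [List.getD_eq_getElem _ _ h]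
      exact hw _ (List.getElem_mem h)
    · exact hx.1 _
  · rw [pre_add, pre_cat, cat_add, List.foldl_append, hs]
    exact hx.2 n

lemma core_letters : (∀ a ∈ coreRight, a = 1 ∨ a = 2) ∧ ∀ a ∈ coreLeft, a = 1 ∨ a = 2 := by
  decide +kernel

lemma mem_markovSpectrum {x y : ℕ → ℕ} (hx : Alive innerTable.step innerTable.N 0 x)
    (hy : Alive innerTable.step innerTable.N 0 y) :
    2 + app coreRight (cf01 x) + app coreLeft (cf01 y) ∈ Set.Iic 3.334402 ∩ MarkovSpectrum := by
  have hX := alive_cat core_letters.1 core_run.1 hx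
  have hY := alive_cat core_letters.2 core_run.2 hy
  have hX' : pre (cat coreRight x) 36 = coreRight := pre_cat coreRight x
  have hY' : pre (cat coreLeft y) 36 = coreLeft := pre_cat coreLeft y
  rw [← cf01_cat hX.one_le, ← cf01_cat hY.one_le]
  set X := cat coreRight x
  set Y := cat coreLeft y
  have hl := bi_letters hX.1 hY.1
  have hl1 : ∀ i, 1 ≤ bi X Y i := fun n => by rcases hl n with h | h <;> omega
  have hr0 : right (bi X Y) 0 = X := by
    ext k; rw [right, ← bi_pos X Y]; congr 1; ring
  have hl0 : left (bi X Y) 0 = Y := by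
    ext k; rw [left, ← bi_neg X Y]; congr 1; ring
  have h0 : val (bi X Y) 0 = 2 + cf01 X + cf01 Y := by
    rw [val_eq hl1, hr0, hl0]
    simp [bi]
  have hlow : ((33344015 / 10000000 : ℚ) : ℝ) ≤ val (bi X Y) 0 ∧ val (bi X Y) 0 ≤ 3.334402 := by
    have e1 := (cf01_ivl 36 hX.1).2
    have e2 := (cf01_ivl 36 hY.1).2
    rw [hX'] at e1
    rw [hY'] at e2
    obtain ⟨c1, c2⟩ := core_val
    rw [lowVal] at c1
    rw [upVal] at c2
    rify at c1 c2
    rw [h0]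
    push_cast
    norm_num at c1 c2 ⊢
    constructor <;> linarith [e1.1, e1.2, e2.1, e2.2]
  have hle : ∀ n, val (bi X Y) n ≤ val (bi X Y) 0 := by
    intro n
    rcases eq_or_ne n 0 with rfl | hn
    · exact le_rfl
    refine le_trans ?_ hlow.1
    rcases lt_or_ge n (-13) with h1 | h1
    · rw [← neg_neg n, ← val_neg hl1, bi_reflect]
      exact val_bi_far hY hX.1 (by omega)
    rcases le_or_gt n 13 with h2 | h2
    · exact val_bi_near hX.1 hY.1 hX' hY' h1 h2 hn
    · exact val_bi_far hX hY.1 (by omega)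
  have hm : markovValue (bi X Y) = val (bi X Y) 0 :=
    le_antisymm (ciSup_le hle) (le_ciSup (f := val (bi X Y)) ⟨_, Set.forall_mem_range.2 hle⟩ 0)
  rw [← h0]
  exact ⟨hlow.2, bi X Y, hl1, hm⟩

/-- The words of length `n` over the letters `1, 2`. -/
def words : ℕ → Finset (List ℕ)
  | 0 => {[]}
  | n + 1 => (words n).image (List.cons 1) ∪ (words n).image (List.cons 2)

lemma mem_words {n : ℕ} {w : List ℕ} (h : w ∈ words n) :
    w.length = n ∧ ∀ a ∈ w, a = 1 ∨ a = 2 := by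
  induction n generalizing w with
  | zero => simp [words] at h; simp [h]
  | succ n ih =>
    simp only [words, Finset.mem_union, Finset.mem_image] at h
    rcases h with ⟨v, hv, rfl⟩ | ⟨v, hv, rfl⟩ <;> simpa using ih hv

lemma sum_words_succ (n : ℕ) (F : List ℕ → ℝ) :
    ∑ w ∈ words (n + 1), F w = ∑ w ∈ words n, F (1 :: w) + ∑ w ∈ words n, F (2 :: w) := by
  rw [words, Finset.sum_union, Finset.sum_image, Finset.sum_image]
  · intro a _ b _ h; simpa using h
  · intro a _ b _ h; simpa using h
  · rw [Finset.disjoint_left]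
    intro w h1 h2
    obtain ⟨v, _, rfl⟩ := Finset.mem_image.1 h1
    obtain ⟨u, _, h⟩ := Finset.mem_image.1 h2
    simp at h

lemma sum_words_ge {T : Table} {lo hi : ℕ → ℝ} {f : ℕ → ℝ → ℝ} {m M c : ℝ}
    (W : Weights T.step T.N lo hi f m M) (hc : 0 ≤ 1 + c)
    (hsup : ∀ s < T.N, ∀ x, lo s ≤ x → x ≤ hi s →
      (1 + c) * f s x ≤ term T.step T.N f s 1 x + term T.step T.N f s 2 x) (n : ℕ) :
    ∀ s < T.N, ∀ x, lo s ≤ x → x ≤ hi s → (1 + c) ^ n * f s x ≤ ∑ w ∈ words n,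
      if w.foldl T.step s < T.N then f (w.foldl T.step s) (rat x w) / den x w else 0 := by
  induction n with
  | zero => intro s hs x _ _; simp [words, hs, rat, den]
  | succ n ih =>
    intro s hs x h1 h2
    have hx : 0 ≤ x := (W.lo_nonneg s hs).trans h1
    have key : ∀ a : ℕ, a = 1 ∨ a = 2 →
        (1 + c) ^ n * term T.step T.N f s a x ≤ ∑ w ∈ words n,
          if (a :: w).foldl T.step s < T.N then
            f ((a :: w).foldl T.step s) (rat x (a :: w)) / den x (a :: w) else 0 := by
      intro a ha
      have ha1 : (1 : ℝ) ≤ a := by rcases ha with rfl | rfl <;> norm_num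
      have hp : 0 < a + x := by linarith
      rw [term]
      split_ifs with hd
      · obtain ⟨m1, m2⟩ := W.maps s hs x h1 h2 a ha hd
        have := div_le_div_of_nonneg_right (ih _ hd _ m1 m2) hp.le
        rw [Finset.sum_div] at this
        rw [← mul_div_assoc]
        refine this.trans (Finset.sum_le_sum fun w _ => ?_)
        by_cases hl : w.foldl T.step (T.step s a) < T.N
        · rw [if_pos hl, if_pos (by exact hl), rat, den, div_div, mul_comm (den _ _)]
          rfl
        · rw [if_neg hl, if_neg (by exact hl), zero_div]
      · rw [mul_zero]
        refine Finset.sum_nonneg fun w _ => ?_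
        rw [List.foldl_cons, if_neg]
        exact not_lt.2 (step_foldl_dead T (not_lt.1 hd) w)
    rw [sum_words_succ]
    have := mul_le_mul_of_nonneg_left (hsup s hs x h1 h2) (pow_nonneg hc n)
    have k1 := key 1 (Or.inl rfl)
    have k2 := key 2 (Or.inr rfl)
    calc (1 + c) ^ (n + 1) * f s x = (1 + c) ^ n * ((1 + c) * f s x) := by ring
      _ ≤ _ := by linarith

/-- Words over `1, 2` of even length that are loops at the initial state. -/
def Good (w : List ℕ) : Prop :=
  (∀ a ∈ w, a = 1 ∨ a = 2) ∧ Even w.length ∧ w.foldl innerTable.step 0 = 0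

lemma Good.one_le {w : List ℕ} (h : Good w) : ∀ a ∈ w, 1 ≤ a := fun a ha => by
  rcases h.1 a ha with h | h <;> omega

lemma good_nil : Good [] := by simp [Good]

lemma Good.append {v w : List ℕ} (hv : Good v) (hw : Good w) : Good (v ++ w) := by
  refine ⟨fun a ha => ?_, ?_, ?_⟩
  · rcases List.mem_append.1 ha with h | h
    exacts [hv.1 a h, hw.1 a h]
  · rw [List.length_append]
    exact hv.2.1.add hw.2.1
  · rw [List.foldl_append, hv.2.2, hw.2.2]

lemma return_words : ((List.range innerTable.N).all fun s =>
    [221211111, 1211111, 212211111, 11111].any fun f =>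
      decide ((word f).foldl innerTable.step s = 0)) = true := by
  decide +kernel

lemma step_one : innerTable.step 0 1 = 0 := by decide +kernel

lemma good_one_one : Good [1, 1] := by
  refine ⟨by simp, by decide, ?_⟩
  decide +kernel

lemma good_two_ones : Good [2, 1, 1, 1, 1, 1] := by
  refine ⟨by simp, by decide, ?_⟩
  decide +kernel

lemma exists_return {s : ℕ} (hs : s < innerTable.N) (n : ℕ) :
    ∃ v : List ℕ, (∀ a ∈ v, a = 1 ∨ a = 2) ∧ v.length ≤ 10 ∧ Even (n + v.length) ∧
      v.foldl innerTable.step s = 0 := by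
  obtain ⟨f, hf, h⟩ := List.any_eq_true.1 (List.all_eq_true.1 return_words s (List.mem_range.2 hs))
  have hf' : (∀ a ∈ word f, a = 1 ∨ a = 2) ∧ (word f).length ≤ 9 := by
    have : ∀ f ∈ [221211111, 1211111, 212211111, 11111],
        (∀ a ∈ word f, a = 1 ∨ a = 2) ∧ (word f).length ≤ 9 := by decide +kernel
    exact this f hf
  have h' := of_decide_eq_true h
  rcases Nat.even_or_odd (n + (word f).length) with he | ho
  · exact ⟨word f, hf'.1, by omega, he, h'⟩
  · refine ⟨word f ++ [1], ?_, by simp; omega, ?_, ?_⟩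
    · intro a ha
      rcases List.mem_append.1 ha with h | h
      · exact hf'.1 a h
      · simp at h; simp [h]
    · rw [List.length_append, ← add_assoc]
      exact ho.add_odd (by simp)
    · rw [List.foldl_append, h']
      exact step_one

lemma den_le_pow {w : List ℕ} (hw : ∀ a ∈ w, a = 1 ∨ a = 2) {t : ℝ} (h0 : 0 ≤ t) (h1 : t ≤ 1) :
    den t w ≤ 3 ^ w.length := by
  induction w generalizing t with
  | nil => simp [den]
  | cons a w ih =>
    have ha : (a : ℝ) ≤ 2 := by
      rcases hw a (by simp) with h | h <;> rw [h] <;> norm_num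
    have ha1 : (1 : ℝ) ≤ a := by
      rcases hw a (by simp) with h | h <;> rw [h] <;> norm_num
    have := ih (t := 1 / (a + t)) (fun b hb => hw b (by simp [hb])) (by positivity)
      (by rw [div_le_one (by linarith)]; linarith)
    have h3 : 1 ≤ den (1 / (a + t)) w := one_le_den (fun b hb => by
      rcases hw b (by simp [hb]) with h | h <;> omega) (by positivity)
    rw [den, List.length_cons, pow_succ']
    exact mul_le_mul (by linarith) this (by linarith) (by norm_num)

lemma exists_rich (A₀ : ℝ) : ∃ R : ℝ, 1 ≤ R ∧ ∃ (B : Finset (List ℕ)) (L : ℕ),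
    (∀ w ∈ B, Good w ∧ w.length = L ∧ R ≤ den 0 w ∧ den 0 w ≤ 4 * R) ∧ A₀ * R ≤ B.card := by
  classical
  set N := innerTable.N
  set t : ℝ := 0.618
  have hW := Table.weights inner_basic
  have hN : 0 < N := by decide +kernel
  have ht : innerTable.lo 0 ≤ t ∧ t ≤ innerTable.hi 0 := by
    have h1 : nth innerTable.LO 0 0 ≤ 61800 := by decide +kernel
    have h2 : 61800 ≤ nth innerTable.HI 0 0 := by decide +kernel
    rify at h1 h2
    rw [Table.lo, Table.hi]
    constructor <;> simp only [t] <;> linarith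
  have ht0 : (0 : ℝ) ≤ t := by norm_num [t]
  have ht1 : t ≤ 1 := by norm_num [t]
  -- growth
  have grow : ∀ n : ℕ, (1 + 1 / 10 ^ 6 : ℝ) ^ n * (1 / 10 ^ 10) ≤
      ∑ w ∈ words n with w.foldl innerTable.step 0 < N, 1 / den 0 w := by
    intro n
    have h1 := sum_words_ge hW (c := 1 / 10 ^ 6) (by norm_num) (fun s hs x h1 h2 => by
      have := Table.ineq inner_ineq s hs x h1 h2
      push_cast at this
      linarith) n 0 hN t ht.1 ht.2
    have h2 := hW.le_f 0 hN t ht.1 ht.2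
    rw [← Finset.sum_filter] at h1
    have hle : ∀ w ∈ words n, ∀ s < N, innerTable.lo s ≤ t → t ≤ innerTable.hi s →
        ∀ hl : w.foldl innerTable.step s < N,
        innerTable.wt (w.foldl innerTable.step s) (rat t w) ≤ 10 ^ 10 := by
      intro w hw s hs l1 l2 hl
      have hletters := (mem_words hw).2
      clear hw
      suffices ∀ x, innerTable.lo s ≤ x → x ≤ innerTable.hi s →
          innerTable.wt (w.foldl innerTable.step s) (rat x w) ≤ 10 ^ 10 from this t l1 l2
      clear l1 l2
      induction w generalizing s with
      | nil => exact fun x => hW.f_le s hs x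
      | cons a w ih =>
        intro x l1 l2
        have hd : innerTable.step s a < N := by
          by_contra! hc
          have := step_foldl_dead innerTable hc w
          rw [List.foldl_cons] at hl
          omega
        obtain ⟨m1, m2⟩ := hW.maps s hs x l1 l2 a (hletters a (by simp)) hd
        exact ih _ hd hl (fun b hb => hletters b (by simp [hb])) _ m1 m2
    have h3 : ∑ w ∈ words n with w.foldl innerTable.step 0 < N,
        innerTable.wt (w.foldl innerTable.step 0) (rat t w) / den t w ≤
        ∑ w ∈ words n with w.foldl innerTable.step 0 < N, 10 ^ 10 * (1 / den 0 w) := by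
      refine Finset.sum_le_sum fun w hw => ?_
      rw [Finset.mem_filter] at hw
      have hone : ∀ a ∈ w, 1 ≤ a := fun a ha => by
        rcases (mem_words hw.1).2 a ha with h | h <;> omega
      have hd0 := one_le_den hone le_rfl
      have hd1 := (den_le hone ht0 ht1).1
      rw [mul_one_div]
      have := hle w hw.1 0 hN ht.1 ht.2 hw.2
      gcongr
    rw [← Finset.mul_sum] at h3
    have h4 : (0 : ℝ) ≤ (1 + 1 / 10 ^ 6) ^ n := by positivity
    nlinarith [mul_le_mul_of_nonneg_left h2 h4]
  -- choice of the parameters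
  set V : ℝ := 2 * 3 ^ 10
  set A : ℝ := max A₀ 0 * V
  obtain ⟨n, hn⟩ : ∃ n : ℕ, (N * (2 * n + 1) : ℝ) * A <
      (1 + 1 / 10 ^ 6 : ℝ) ^ n * (1 / 10 ^ 10) := by
    have h1 := tendsto_pow_const_div_const_pow_of_one_lt 1 (r := (1 + 1 / 10 ^ 6 : ℝ)) (by norm_num)
    have h2 := tendsto_pow_const_div_const_pow_of_one_lt 0 (r := (1 + 1 / 10 ^ 6 : ℝ)) (by norm_num)
    have h3 := ((h1.const_mul (2 * N * A)).add (h2.const_mul (N * A)))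
    rw [mul_zero, mul_zero, add_zero] at h3
    obtain ⟨n, hn⟩ := (h3.eventually (gt_mem_nhds (show (0 : ℝ) < 1 / 10 ^ 10 by norm_num))).exists
    refine ⟨n, ?_⟩
    have hp : (0 : ℝ) < (1 + 1 / 10 ^ 6 : ℝ) ^ n := by positivity
    have := mul_lt_mul_of_pos_left hn hp
    refine lt_of_eq_of_lt ?_ this
    field_simp
  set G := (words n).filter fun w => w.foldl innerTable.step 0 < N
  have hG : ∀ w ∈ G, w.length = n ∧ (∀ a ∈ w, a = 1 ∨ a = 2) ∧ w.foldl innerTable.step 0 < N ∧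
      (∀ a ∈ w, 1 ≤ a) ∧ 1 ≤ den 0 w := by
    intro w hw
    rw [Finset.mem_filter] at hw
    have h1 := mem_words hw.1
    have h2 : ∀ a ∈ w, 1 ≤ a := fun a ha => by rcases h1.2 a ha with h | h <;> omega
    exact ⟨h1.1, h1.2, hw.2, h2, one_le_den h2 le_rfl⟩
  -- pigeonhole
  set idx : List ℕ → ℕ × ℕ := fun w => (w.foldl innerTable.step 0, Nat.log 2 ⌊den 0 w⌋₊)
  have hidx : ∀ w ∈ G, idx w ∈ Finset.range N ×ˢ Finset.range (2 * n + 1) := by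
    intro w hw
    obtain ⟨h1, h2, h3, h4, h5⟩ := hG w hw
    simp only [idx, Finset.mem_product, Finset.mem_range]
    refine ⟨h3, ?_⟩
    refine Nat.log_lt_of_lt_pow (Nat.floor_pos.2 h5).ne' ?_
    rw [Nat.floor_lt (by linarith)]
    have := den_le_pow h2 le_rfl zero_le_one
    rw [h1] at this
    push_cast
    calc den 0 w ≤ 3 ^ n := this
      _ ≤ 4 ^ n := by gcongr; norm_num
      _ < 2 ^ (2 * n + 1) := by
        rw [pow_succ, pow_mul]
        norm_num
  have hscale : ∀ w ∈ G, (2 : ℝ) ^ (idx w).2 ≤ den 0 w ∧ den 0 w ≤ 2 * 2 ^ (idx w).2 := by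
    intro w hw
    obtain ⟨h1, h2, h3, h4, h5⟩ := hG w hw
    have hf : ⌊den 0 w⌋₊ ≠ 0 := (Nat.floor_pos.2 h5).ne'
    constructor
    · have : (2 : ℝ) ^ (idx w).2 ≤ ⌊den 0 w⌋₊ := by
        exact_mod_cast Nat.pow_log_le_self 2 hf
      exact this.trans (Nat.floor_le (by linarith))
    · have h6 : ⌊den 0 w⌋₊ + 1 ≤ 2 ^ ((idx w).2 + 1) :=
        Nat.lt_pow_succ_log_self (by norm_num) _
      have h7 : ((⌊den 0 w⌋₊ : ℝ) + 1) ≤ 2 ^ ((idx w).2 + 1) := by exact_mod_cast h6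
      have h8 := Nat.lt_floor_add_one (den 0 w)
      rw [pow_succ'] at h7
      linarith
  obtain ⟨p, hp, hcard⟩ : ∃ p ∈ Finset.range N ×ˢ Finset.range (2 * n + 1),
      A * 2 ^ p.2 ≤ ((G.filter fun w => idx w = p).card : ℝ) := by
    by_contra! hcon
    have h1 := grow n
    rw [← Finset.sum_fiberwise_of_maps_to hidx] at h1
    have h2 : ∀ p ∈ Finset.range N ×ˢ Finset.range (2 * n + 1),
        ∑ w ∈ G with idx w = p, 1 / den 0 w ≤ A := by
      intro p hp
      have h3 : ∑ w ∈ G with idx w = p, 1 / den 0 w ≤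
          ∑ w ∈ G with idx w = p, 1 / (2 : ℝ) ^ p.2 := by
        refine Finset.sum_le_sum fun w hw => ?_
        rw [Finset.mem_filter] at hw
        have := (hscale w hw.1).1
        rw [hw.2] at this
        exact one_div_le_one_div_of_le (by positivity) this
      rw [Finset.sum_const, nsmul_eq_mul] at h3
      refine h3.trans ?_
      rw [mul_one_div, div_le_iff₀ (by positivity)]
      exact (hcon p hp).le
    have h4 := Finset.sum_le_card_nsmul _ _ _ h2
    rw [Finset.card_product, Finset.card_range, Finset.card_range, nsmul_eq_mul] at h4
    push_cast at h4
    linarith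
  obtain ⟨v, hv1, hv2, hv3, hv4⟩ := exists_return (s := p.1) (by
    rw [Finset.mem_product, Finset.mem_range] at hp; exact hp.1) n
  have hv5 : ∀ a ∈ v, 1 ≤ a := fun a ha => by rcases hv1 a ha with h | h <;> omega
  have hv6 := one_le_den hv5 le_rfl
  have hvle : den 0 v ≤ 3 ^ 10 := (den_le_pow hv1 le_rfl zero_le_one).trans
    (pow_le_pow_right₀ (by norm_num) hv2)
  refine ⟨2 ^ p.2 * den 0 v, one_le_mul_of_one_le_of_one_le (one_le_pow₀ (by norm_num)) hv6,
    (G.filter fun w => idx w = p).image (· ++ v), n + v.length, ?_, ?_⟩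
  · intro w hw
    obtain ⟨u, hu, rfl⟩ := Finset.mem_image.1 hw
    rw [Finset.mem_filter] at hu
    obtain ⟨h1, h2, h3, h4, h5⟩ := hG u hu.1
    obtain ⟨s1, s2⟩ := hscale u hu.1
    obtain ⟨b1, b2⟩ := den_append_bounds h4 hv5
    rw [hu.2] at s1 s2
    refine ⟨⟨fun a ha => ?_, ?_, ?_⟩, ?_, ?_, ?_⟩
    · rcases List.mem_append.1 ha with h | h
      exacts [h2 a h, hv1 a h]
    · rwa [List.length_append, h1]
    · rw [List.foldl_append]
      have : u.foldl innerTable.step 0 = p.1 := congrArg Prod.fst hu.2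
      rw [this, hv4]
    · rw [List.length_append, h1]
    · exact (mul_le_mul_of_nonneg_right s1 (by linarith)).trans b1
    · refine b2.trans ?_
      nlinarith
  · rw [Finset.card_image_of_injective _ (List.append_left_injective v)]
    refine le_trans ?_ hcard
    have hA : A₀ * den 0 v ≤ A := by
      have h1 : A₀ ≤ max A₀ 0 := le_max_left _ _
      have h2 : 0 ≤ max A₀ 0 := le_max_right _ _
      have h3 : den 0 v ≤ V := by simp only [V]; linarith
      calc A₀ * den 0 v ≤ max A₀ 0 * den 0 v := by gcongr
        _ ≤ A := mul_le_mul_of_nonneg_left h3 h2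
    have : (0 : ℝ) ≤ 2 ^ p.2 := by positivity
    nlinarith

open scoped NNReal ENNReal in
/-- Lower bound for the dimension of a self-similar-like set given by a separated coding. -/
lemma le_dimH_range {b : ℕ} (hb : 1 < b) {e : (ℕ → Fin b) → ℝ} {c r : ℝ} {d : ℝ≥0}
    (hc : 0 < c) (hr : 0 < r) (hd : 0 < d) (hbr : (b : ℝ)⁻¹ ≤ r ^ (d : ℝ))
    (he : ∀ x y i, (∀ j < i, x j = y j) → x i ≠ y i → c * r ^ i ≤ |e x - e y|) :
    (d : ℝ≥0∞) ≤ dimH (Set.range e) := by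
  have hne : Nonempty (ℕ → Fin b) := ⟨fun _ => ⟨0, by omega⟩⟩
  have first : ∀ x y : ℕ → Fin b, x ≠ y → ∃ i, (∀ j < i, x j = y j) ∧ x i ≠ y i := by
    intro x y hxy
    have h := Function.ne_iff.1 hxy
    classical
    exact ⟨Nat.find h, fun j hj => not_not.1 (Nat.find_min h hj), Nat.find_spec h⟩
  have inj : Function.Injective e := by
    intro x y hxy
    by_contra hne
    obtain ⟨i, h1, h2⟩ := first x y hne
    have := he x y i h1 h2
    rw [hxy, sub_self, abs_zero] at this
    exact absurd this (not_le.2 (by positivity))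
  set φ : ℝ → ℝ := fun t => Real.ofDigits (Function.invFun e t)
  have hφ : ∀ x, φ (e x) = Real.ofDigits x := fun x => by
    simp only [φ, Function.leftInverse_invFun inj x]
  have hold : HolderOnWith (Real.toNNReal ((c⁻¹) ^ (d : ℝ))) d φ (Set.range e) := by
    rintro _ ⟨x, rfl⟩ _ ⟨y, rfl⟩
    rw [hφ, hφ]
    rcases eq_or_ne x y with rfl | hxy
    · simp
    obtain ⟨i, h1, h2⟩ := first x y hxy
    have hb0 : (0 : ℝ) < b := by exact_mod_cast (by omega : 0 < b)
    have key : |Real.ofDigits x - Real.ofDigits y| ≤ (c⁻¹) ^ (d : ℝ) * |e x - e y| ^ (d : ℝ) := by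
      calc _ ≤ ((b : ℝ) ^ i)⁻¹ := Real.abs_ofDigits_sub_ofDigits_le h1
        _ = ((b : ℝ)⁻¹) ^ i := by rw [inv_pow]
        _ ≤ (r ^ (d : ℝ)) ^ i := pow_le_pow_left₀ (by positivity) hbr i
        _ = (r ^ i) ^ (d : ℝ) := by
          rw [← Real.rpow_natCast, ← Real.rpow_natCast, ← Real.rpow_mul hr.le,
            ← Real.rpow_mul hr.le, mul_comm]
        _ ≤ (c⁻¹ * |e x - e y|) ^ (d : ℝ) := by
          refine Real.rpow_le_rpow (by positivity) ?_ d.coe_nonneg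
          rw [inv_mul_eq_div, le_div_iff₀ hc, mul_comm]
          exact he x y i h1 h2
        _ = _ := Real.mul_rpow (by positivity) (abs_nonneg _)
    rw [edist_dist, edist_dist, Real.dist_eq, Real.dist_eq,
      ENNReal.ofReal_rpow_of_nonneg (abs_nonneg _) d.coe_nonneg]
    change _ ≤ ENNReal.ofReal _ * _
    rw [← ENNReal.ofReal_mul (by positivity)]
    exact ENNReal.ofReal_le_ofReal key
  have himg : Set.Icc (0 : ℝ) 1 ⊆ φ '' Set.range e := by
    intro t ht
    obtain ⟨x, _, rfl⟩ := Real.ofDigits_SurjOn hb ht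
    exact ⟨e x, ⟨x, rfl⟩, hφ x⟩
  have h1 : dimH (Set.Icc (0 : ℝ) 1) = 1 := by
    have := Real.dimH_of_nonempty_interior (E := ℝ) (s := Set.Icc 0 1)
      (by rw [interior_Icc]; exact ⟨1 / 2, by norm_num, by norm_num⟩)
    simpa using this
  have h2 : (1 : ℝ≥0∞) ≤ dimH (Set.range e) / d := by
    rw [← h1]; exact (dimH_mono himg).trans (hold.dimH_image_le hd)
  rw [ENNReal.le_div_iff_mul_le (by simp [hd.ne']) (by simp), one_mul] at h2
  exact h2

section Select

variable {α Z : Type*}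

/-- The number of members of `P` whose position is within `ε` of that of `p`. -/
noncomputable def crowd (P : Finset α) (f : α → ℝ) (ε : ℝ) (p : α) : ℕ :=
  (P.filter fun q => |f q - f p| < ε).card

lemma sum_inv_crowd_le (P Q : Finset α) (f : α → ℝ) (ε : ℝ) (hQ : Q ⊆ P)
    (h : ∀ p ∈ Q, ∀ q ∈ Q, |f q - f p| < ε) : ∑ q ∈ Q, (1 : ℝ) / crowd P f ε q ≤ 1 := by
  rcases Q.eq_empty_or_nonempty with rfl | hne
  · simp
  have hc : (0 : ℝ) < Q.card := by exact_mod_cast hne.card_pos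
  calc _ ≤ ∑ _q ∈ Q, (1 : ℝ) / Q.card := by
        refine Finset.sum_le_sum fun q hq => one_div_le_one_div_of_le hc ?_
        exact_mod_cast Finset.card_le_card fun x hx =>
          Finset.mem_filter.2 ⟨hQ hx, h q hq x hx⟩
    _ = 1 := by rw [Finset.sum_const, nsmul_eq_mul]; field_simp

lemma exists_separated (P : Finset α) (f : α → ℝ) (ε : ℝ) (hε : 0 < ε) (V : α → ℝ)
    (hV : ∀ p, 0 ≤ V p) (Q : Finset α) (hQ : Q ⊆ P) :
    ∃ I ⊆ Q, (∀ p ∈ I, ∀ q ∈ I, p ≠ q → ε ≤ |f p - f q|) ∧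
      ∑ p ∈ Q, V p / crowd P f ε p ≤ 2 * ∑ p ∈ I, V p := by
  classical
  induction Q using Finset.strongInduction with
  | H Q ih =>
  rcases Q.eq_empty_or_nonempty with rfl | hne
  · exact ⟨∅, by simp, by simp, by simp⟩
  obtain ⟨p, hp, hmax⟩ := Q.exists_max_image V hne
  set Q' := Q.filter fun q => ¬ |f q - f p| < ε with hQ'
  have hss : Q' ⊂ Q := by
    refine Finset.filter_ssubset.2 ⟨p, hp, ?_⟩
    simpa using hε
  obtain ⟨I, hI, hsep, hsum⟩ := ih Q' hss (hss.1.trans hQ)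
  have hpI : p ∉ I := fun h => by
    have := (Finset.mem_filter.1 (hI h)).2
    simp [hε] at this
  have far : ∀ q ∈ I, ε ≤ |f q - f p| := fun q hq =>
    not_lt.1 (Finset.mem_filter.1 (hI hq)).2
  refine ⟨insert p I, Finset.insert_subset hp (hI.trans hss.1), ?_, ?_⟩
  · intro x hx y hy hxy
    rcases Finset.mem_insert.1 hx with rfl | hx' <;> rcases Finset.mem_insert.1 hy with rfl | hy'
    · exact absurd rfl hxy
    · rw [abs_sub_comm]; exact far y hy'
    · exact far x hx'
    · exact hsep x hx' y hy' hxy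
  · rw [Finset.sum_insert hpI, ← Finset.sum_filter_add_sum_filter_not Q fun q => |f q - f p| < ε]
    have near : ∑ q ∈ Q.filter (fun q => |f q - f p| < ε), V q / crowd P f ε q ≤ 2 * V p := by
      set N := Q.filter fun q => |f q - f p| < ε
      have h1 : ∑ q ∈ N, V q / crowd P f ε q ≤ V p * ∑ q ∈ N, (1 : ℝ) / crowd P f ε q := by
        rw [Finset.mul_sum]
        refine Finset.sum_le_sum fun q hq => ?_
        rw [← mul_div_assoc, mul_one]
        exact div_le_div_of_nonneg_right (hmax q (Finset.mem_filter.1 hq).1) (Nat.cast_nonneg _)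
      have h2 : ∑ q ∈ N, (1 : ℝ) / crowd P f ε q ≤ 2 := by
        rw [← Finset.sum_filter_add_sum_filter_not N fun q => f q < f p, ← one_add_one_eq_two]
        have sub : N ⊆ P := (Finset.filter_subset _ _).trans hQ
        refine add_le_add
          (sum_inv_crowd_le P _ f ε ((Finset.filter_subset _ _).trans sub) ?_)
          (sum_inv_crowd_le P _ f ε ((Finset.filter_subset _ _).trans sub) ?_) <;>
        · intro x hx y hy
          simp only [N, Finset.mem_filter, abs_lt] at hx hy ⊢
          constructor <;> linarith [hx.1.2.1, hx.1.2.2, hx.2, hy.1.2.1, hy.1.2.2, hy.2]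
      nlinarith [hV p]
    linarith

/-- Two lists extending the context `c` have prefixes that part through members of `P`, at
positions which are `ε` apart. -/
def Separated (P : Finset (List Z)) (pos : List Z → ℝ) (ε : ℕ → ℝ)
    (c s s' : List Z) : Prop :=
  ∃ (d p p' r r' : List Z), p ∈ P ∧ p' ∈ P ∧ s = d ++ p ++ r ∧
    s' = d ++ p' ++ r' ∧ |pos (c ++ d ++ p) - pos (c ++ d ++ p')| ≥ ε (c ++ d).length

/-- Weighted count of the leaves of the tree of `n` successive choices from `P`. -/
noncomputable def leaves (P : Finset (List Z)) (pos : List Z → ℝ) (ε : ℕ → ℝ) :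
    ℕ → List Z → ℝ
  | 0, _ => 1
  | n + 1, c => ∑ p ∈ P, leaves P pos ε n (c ++ p) /
      crowd P (fun q => pos (c ++ q)) (ε c.length) p

lemma exists_separated_tree {P : Finset (List Z)} (pos : List Z → ℝ) {ε : ℕ → ℝ} {k : ℕ}
    (hP : ∀ p ∈ P, p.length = k) (hε : ∀ i, 0 < ε i) (n : ℕ) : ∀ c : List Z,
    ∃ T : Finset (List Z), leaves P pos ε n c ≤ 2 ^ n * T.card ∧
      (∀ s ∈ T, s.length = n * k) ∧
      ∀ s ∈ T, ∀ s' ∈ T, s ≠ s' → Separated P pos ε c s s' := by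
  classical
  induction n with
  | zero =>
    intro c
    refine ⟨{[]}, by simp [leaves], by simp, ?_⟩
    intro s hs s' hs' hne
    simp only [Finset.mem_singleton] at hs hs'
    exact absurd (hs.trans hs'.symm) hne
  | succ n ih =>
    intro c
    choose T hT hlen hsep using fun p => ih (c ++ p)
    obtain ⟨I, hI, hIs, hIsum⟩ := exists_separated P (fun q => pos (c ++ q)) (ε c.length)
      (hε _) (fun p => ((T p).card : ℝ)) (fun p => Nat.cast_nonneg _) P subset_rfl
    have hdisj : (I : Set (List Z)).PairwiseDisjoint fun p => (T p).image (p ++ ·) := by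
      intro p hp q hq hpq
      simp only [Function.onFun, Finset.disjoint_left, Finset.mem_image, not_exists, not_and]
      rintro _ ⟨s, _, rfl⟩ s' _ h
      exact hpq (List.append_inj_left h.symm ((hP p (hI hp)).trans (hP q (hI hq)).symm))
    refine ⟨I.biUnion fun p => (T p).image (p ++ ·), ?_, ?_, ?_⟩
    · rw [Finset.card_biUnion hdisj]
      have hcard : ∀ p, ((T p).image (p ++ ·)).card = (T p).card := fun p =>
        Finset.card_image_of_injective _ (List.append_right_injective p)
      simp only [hcard]
      push_cast
      rw [leaves]
      calc _ ≤ ∑ p ∈ P, 2 ^ n * (((T p).card : ℝ) /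
            crowd P (fun q => pos (c ++ q)) (ε c.length) p) := by
            refine Finset.sum_le_sum fun p _ => ?_
            rw [← mul_div_assoc]
            exact div_le_div_of_nonneg_right (hT p) (Nat.cast_nonneg _)
        _ ≤ 2 ^ n * (2 * ∑ p ∈ I, ((T p).card : ℝ)) := by
            rw [← Finset.mul_sum]; gcongr
        _ = _ := by ring
    · intro s hs
      simp only [Finset.mem_biUnion, Finset.mem_image] at hs
      obtain ⟨p, hp, s, hs, rfl⟩ := hs
      rw [List.length_append, hP p (hI hp), hlen p s hs]; ring
    · intro s hs s' hs' hne
      simp only [Finset.mem_biUnion, Finset.mem_image] at hs hs'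
      obtain ⟨p, hp, s, hs, rfl⟩ := hs
      obtain ⟨p', hp', s', hs', rfl⟩ := hs'
      by_cases hpp : p = p'
      · subst hpp
        obtain ⟨d, q, q', r, r', h2, h3, h4, h5, h6⟩ :=
          hsep p s hs s' hs' fun h => hne (by rw [h])
        refine ⟨p ++ d, q, q', r, r', h2, h3, by simp [h4], by simp [h5], ?_⟩
        simpa [← List.append_assoc] using h6
      · refine ⟨[], p, p', s, s', hI hp, hI hp', by simp, by simp, ?_⟩
        simpa using hIs p hp p' hp' hpp

/-- A lower bound, in exponential form, for `leaves`. -/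
noncomputable def entropy (P : Finset (List Z)) (pos : List Z → ℝ) (ε : ℕ → ℝ) (K : ℝ) :
    ℕ → List Z → ℝ
  | 0, _ => 0
  | n + 1, c => ∑ p ∈ P, (P.card : ℝ)⁻¹ * (1 - crowd P (fun q => pos (c ++ q)) (ε c.length) p / K
      + entropy P pos ε K n (c ++ p))

lemma exp_entropy_le {P : Finset (List Z)} (hP : P.Nonempty) (pos : List Z → ℝ) {ε : ℕ → ℝ}
    (hε : ∀ i, 0 < ε i) {K : ℝ} (hK : 0 < K) (n : ℕ) : ∀ c : List Z,
    (P.card / K) ^ n * Real.exp (entropy P pos ε K n c) ≤ leaves P pos ε n c := by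
  induction n with
  | zero => intro c; simp [entropy, leaves]
  | succ n ih =>
    intro c
    have hc : (0 : ℝ) < P.card := by exact_mod_cast hP.card_pos
    have hj := convexOn_exp.map_sum_le (t := P) (w := fun _ => (P.card : ℝ)⁻¹)
      (p := fun p => 1 - crowd P (fun q => pos (c ++ q)) (ε c.length) p / K
        + entropy P pos ε K n (c ++ p)) (fun _ _ => by positivity)
      (by rw [Finset.sum_const, nsmul_eq_mul]; field_simp) (fun _ _ => Set.mem_univ _)
    simp only [smul_eq_mul] at hj
    rw [entropy, leaves]
    refine (mul_le_mul_of_nonneg_left hj (by positivity)).trans ?_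
    rw [Finset.mul_sum]
    refine Finset.sum_le_sum fun p hp => ?_
    set m : ℝ := (crowd P (fun q => pos (c ++ q)) (ε c.length) p : ℝ) with hm
    have hm0 : 0 < m := by
      rw [hm]; unfold crowd
      exact_mod_cast Finset.card_pos.2 ⟨p, Finset.mem_filter.2 ⟨hp, by simpa using hε _⟩⟩
    have he : Real.exp (1 - m / K) ≤ K / m := by
      have h1 := Real.add_one_le_exp (m / K - 1)
      rw [show 1 - m / K = -(m / K - 1) by ring, Real.exp_neg,
        show K / m = (m / K)⁻¹ by rw [inv_div]]
      exact inv_anti₀ (by positivity) (by linarith)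
    rw [Real.exp_add, le_div_iff₀ hm0]
    have h2 : Real.exp (1 - m / K) * m ≤ K := (le_div_iff₀ hm0).1 he
    calc _ = (P.card / K) ^ n * Real.exp (entropy P pos ε K n (c ++ p)) *
          ((Real.exp (1 - m / K) * m) / K) := by
          rw [pow_succ]; field_simp
      _ ≤ (P.card / K) ^ n * Real.exp (entropy P pos ε K n (c ++ p)) * 1 := by
          gcongr
          exact (div_le_one hK).2 h2
      _ ≤ _ := by rw [mul_one]; exact ih _

lemma sum_entropy_nonneg {ι : Type*} (Λ : Finset ι) {P : Finset (List Z)} (hP : P.Nonempty)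
    (pos : ι → List Z → ℝ) {ε : ℕ → ℝ} {K : ℝ} (hK : 0 < K)
    (h : ∀ c, ∑ i ∈ Λ, ∑ p ∈ P, (crowd P (fun q => pos i (c ++ q)) (ε c.length) p : ℝ) ≤
      K * (Λ.card * P.card)) (n : ℕ) :
    ∀ c, 0 ≤ ∑ i ∈ Λ, entropy P (pos i) ε K n c := by
  induction n with
  | zero => intro c; simp [entropy]
  | succ n ih =>
    intro c
    have hc : (0 : ℝ) < P.card := by exact_mod_cast hP.card_pos
    simp only [entropy, ← Finset.mul_sum, Finset.sum_add_distrib, Finset.sum_sub_distrib,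
      ← Finset.sum_div]
    refine mul_nonneg (by positivity) (add_nonneg ?_ ?_)
    · have := (div_le_iff₀ hK).2 ((h c).trans_eq (mul_comm _ _))
      simp only [Finset.sum_const, nsmul_eq_mul, mul_one]
      linarith
    · rw [Finset.sum_comm]
      exact Finset.sum_nonneg fun p _ => ih _

/-- A large tree of well separated branches, for at least one value of the parameter. -/
lemma exists_parameter {ι : Type*} {Λ : Finset ι} (hΛ : Λ.Nonempty) {P : Finset (List Z)}
    (hP : P.Nonempty) {k : ℕ} (hk : ∀ p ∈ P, p.length = k) (pos : ι → List Z → ℝ) {ε : ℕ → ℝ}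
    (hε : ∀ i, 0 < ε i) {K : ℝ} (hK : 0 < K)
    (h : ∀ c, ∑ i ∈ Λ, ∑ p ∈ P, (crowd P (fun q => pos i (c ++ q)) (ε c.length) p : ℝ) ≤
      K * (Λ.card * P.card)) (n : ℕ) :
    ∃ i ∈ Λ, ∃ T : Finset (List Z), (P.card / (2 * K)) ^ n ≤ T.card ∧
      (∀ s ∈ T, s.length = n * k) ∧
      ∀ s ∈ T, ∀ s' ∈ T, s ≠ s' → Separated P (pos i) ε [] s s' := by
  obtain ⟨i, hi, h0⟩ : ∃ i ∈ Λ, 0 ≤ entropy P (pos i) ε K n [] := by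
    by_contra! hneg
    exact absurd (sum_entropy_nonneg Λ hP pos hK h n []) (not_le.2 (Finset.sum_neg hneg hΛ))
  obtain ⟨T, h1, h2, h3⟩ := exists_separated_tree (pos i) hk hε n []
  refine ⟨i, hi, T, ?_, h2, h3⟩
  have h4 := exp_entropy_le hP (pos i) hε hK n []
  have h5 : (P.card / K) ^ n ≤ 2 ^ n * (T.card : ℝ) := by
    refine le_trans ?_ (h4.trans h1)
    exact le_mul_of_one_le_right (by positivity) (Real.one_le_exp h0)
  rw [show (P.card : ℝ) / (2 * K) = P.card / K / 2 by field_simp, div_pow,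
    div_le_iff₀ (by positivity)]
  linarith

end Select

section Micro

lemma card_near_le (J : ℕ) {A B η ε : ℝ} (hη : 0 < η) (hε : 0 < ε)
    (h : η ≤ |A| ∨ η ≤ |B|) :
    (((Finset.range J).filter fun i : ℕ => |A + (1 + (i : ℝ) / J) * B| < ε).card : ℝ) ≤
      8 * ε / η * J + 1 := by
  rcases Nat.eq_zero_or_pos J with rfl | hJ
  · simp
  have hJ' : (0 : ℝ) < J := by exact_mod_cast hJ
  set F := (Finset.range J).filter fun i : ℕ => |A + (1 + (i : ℝ) / J) * B| < ε
  rcases F.eq_empty_or_nonempty with h0 | hne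
  · rw [h0]; simp; positivity
  have hF : ∀ i ∈ F, (i : ℝ) < J ∧ |A + (1 + (i : ℝ) / J) * B| < ε := fun i hi => by
    obtain ⟨h1, h2⟩ := Finset.mem_filter.1 hi
    exact ⟨by exact_mod_cast Finset.mem_range.1 h1, h2⟩
  by_cases hB : η / 4 ≤ |B|
  · have hBp : 0 < |B| := by linarith
    set m := F.min' hne
    set M := F.max' hne
    have hmM : m ≤ M := F.min'_le_max' hne
    have hsub : F ⊆ Finset.Icc m M := fun i hi =>
      Finset.mem_Icc.2 ⟨F.min'_le i hi, F.le_max' i hi⟩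
    have h1 : (F.card : ℝ) ≤ M - m + 1 := by
      have := Finset.card_le_card hsub
      rw [Nat.card_Icc] at this
      have h2 : (F.card : ℝ) ≤ ((M + 1 - m : ℕ) : ℝ) := by exact_mod_cast this
      rw [Nat.cast_sub (by omega)] at h2
      push_cast at h2; linarith
    have h2 : ((M : ℝ) - m) / J * |B| < 2 * ε := by
      have e1 := (hF m (F.min'_mem hne)).2
      have e2 := (hF M (F.max'_mem hne)).2
      have h3 : |((M : ℝ) - m) / J * B| < 2 * ε := by
        have := abs_sub_abs_le_abs_sub (A + (1 + (M : ℝ) / J) * B) (A + (1 + (m : ℝ) / J) * B)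
        have h4 := abs_sub (A + (1 + (M : ℝ) / J) * B) (A + (1 + (m : ℝ) / J) * B)
        rw [show ((M : ℝ) - m) / J * B = A + (1 + (M : ℝ) / J) * B - (A + (1 + (m : ℝ) / J) * B)
          by ring]
        linarith
      rwa [abs_mul, abs_of_nonneg] at h3
      have : (m : ℝ) ≤ M := by exact_mod_cast hmM
      exact div_nonneg (by linarith) hJ'.le
    have h3 : ((M : ℝ) - m) ≤ 2 * ε / |B| * J := by
      have h5 : ((M : ℝ) - m) / J ≤ 2 * ε / |B| := by rw [le_div_iff₀ hBp]; exact h2.le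
      rwa [div_le_iff₀ hJ'] at h5
    have h4 : 2 * ε / |B| ≤ 8 * ε / η := by
      rw [div_le_div_iff₀ hBp hη]; nlinarith
    nlinarith
  · have hA : η ≤ |A| := h.resolve_right fun h => hB (by linarith)
    obtain ⟨i, hi⟩ := hne
    obtain ⟨h1, h2⟩ := hF i hi
    have h3 : |(1 + (i : ℝ) / J) * B| ≤ η / 2 := by
      rw [abs_mul, abs_of_nonneg (by positivity)]
      have : (i : ℝ) / J ≤ 1 := (div_le_one hJ').2 h1.le
      push Not at hB
      nlinarith [abs_nonneg B]
    have h4 : η / 2 < ε := by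
      have := abs_sub_abs_le_abs_sub A (-((1 + (i : ℝ) / J) * B))
      rw [abs_neg, sub_neg_eq_add] at this
      linarith
    have h5 : (F.card : ℝ) ≤ J := by
      exact_mod_cast (Finset.card_filter_le _ _).trans_eq (Finset.card_range J)
    have h6 : 1 ≤ 8 * ε / η := by rw [le_div_iff₀ hη]; linarith
    nlinarith

variable {Z : Type*} [Fintype Z] [DecidableEq Z]

/-- The lists of length `n` over a finite alphabet. -/
def listsOf (Z : Type*) [Fintype Z] [DecidableEq Z] : ℕ → Finset (List Z)
  | 0 => {[]}
  | n + 1 => (Finset.univ ×ˢ listsOf Z n).image fun x : Z × List Z => x.1 :: x.2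

lemma length_of_mem_listsOf {n : ℕ} : ∀ {p : List Z}, p ∈ listsOf Z n → p.length = n := by
  induction n with
  | zero => intro p hp; simp [listsOf] at hp; simp [hp]
  | succ n ih =>
    intro p hp
    simp only [listsOf, Finset.mem_image, Finset.mem_product] at hp
    obtain ⟨x, ⟨_, h⟩, rfl⟩ := hp
    simp [ih h]

lemma sum_listsOf_succ (n : ℕ) (F : List Z → ℝ) :
    ∑ p ∈ listsOf Z (n + 1), F p = ∑ z : Z, ∑ p ∈ listsOf Z n, F (z :: p) := by
  rw [listsOf, Finset.sum_image, Finset.sum_product]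
  rintro ⟨a, b⟩ _ ⟨a', b'⟩ _ h
  simpa using h

lemma card_listsOf (n : ℕ) : ((listsOf Z n).card : ℝ) = (Fintype.card Z : ℝ) ^ n := by
  induction n with
  | zero => simp [listsOf]
  | succ n ih =>
    have := sum_listsOf_succ (Z := Z) n fun _ => 1
    simp only [Finset.sum_const, nsmul_eq_mul, mul_one, Finset.card_univ] at this
    rw [this, ih, pow_succ']

/-- The weight `x ^ j`, where `j` is the length of the longest common prefix. -/
def agree (x : ℝ) : List Z → List Z → ℝ
  | a :: p, b :: q => if a = b then x * agree x p q else 1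
  | _, _ => 1

lemma sum_agree_le {x : ℝ} (h2 : 2 * x ≤ Fintype.card Z) (hx : 0 ≤ x) (n : ℕ) :
    ∀ p : List Z, p.length = n →
      ∑ q ∈ listsOf Z n, agree x p q ≤ 2 * (Fintype.card Z : ℝ) ^ n := by
  induction n with
  | zero => intro p hp; simp [listsOf, List.length_eq_zero_iff.1 hp, agree]
  | succ n ih =>
    intro p hp
    obtain ⟨a, p, rfl⟩ := List.exists_cons_of_length_eq_add_one hp
    rw [sum_listsOf_succ]
    have hp' := ih p (by simpa using hp)
    calc _ ≤ ∑ z : Z, ((if a = z then x * (2 * (Fintype.card Z : ℝ) ^ n) else 0) +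
          (Fintype.card Z : ℝ) ^ n) := by
          refine Finset.sum_le_sum fun z _ => ?_
          simp only [agree]
          split_ifs
          · rw [← Finset.mul_sum]
            have := mul_le_mul_of_nonneg_left hp' hx
            have h0 : (0 : ℝ) ≤ (Fintype.card Z : ℝ) ^ n := by positivity
            linarith
          · simp [card_listsOf]
      _ = x * (2 * (Fintype.card Z : ℝ) ^ n) + (Fintype.card Z : ℝ) ^ (n + 1) := by
          rw [Finset.sum_add_distrib]
          simp [pow_succ']
      _ ≤ _ := by
          have h0 : (0 : ℝ) ≤ (Fintype.card Z : ℝ) ^ n := by positivity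
          rw [pow_succ']; nlinarith

lemma agree_cases {Y : Type*} [DecidableEq Y] (x : ℝ) : ∀ p q : List Y, p.length = q.length →
    (p = q ∧ agree x p q = x ^ p.length) ∨
    ∃ (d : List Y) (a b : Y) (r s : List Y), a ≠ b ∧ p = d ++ a :: r ∧ q = d ++ b :: s ∧
      agree x p q = x ^ d.length
  | [], [], _ => Or.inl ⟨rfl, by simp [agree]⟩
  | a :: p, b :: q, h => by
    by_cases hab : a = b
    · subst hab
      rcases agree_cases x p q (by simpa using h) with ⟨rfl, h2⟩ | ⟨d, a', b', r, s, h1, h2, h3, h4⟩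
      · exact Or.inl ⟨rfl, by simp [agree, h2, pow_succ']⟩
      · exact Or.inr ⟨a :: d, a', b', r, s, h1, by simp [h2], by simp [h3],
          by simp [agree, h4, pow_succ']⟩
    · exact Or.inr ⟨[], a, b, p, q, hab, rfl, rfl, by simp [agree, hab]⟩

/-- Positions on the line of the pairs of coded points, weighted by `t`. -/
def position {β : Type*} (a b : List β → ℝ) (t : ℝ) (z : List (β × β)) : ℝ :=
  a (z.map Prod.fst) + t * b (z.map Prod.snd)

/-- Projections of a product of two rich coded sets: for some value of the weight there is a
large tree of separated branches. -/
lemma exists_projection {β : Type*} [Fintype β] [DecidableEq β] {a b : List β → ℝ}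
    {ρ c S : ℝ} (hρ : 0 < ρ) (hρ1 : ρ < 1) (hc : 0 < c) (hS : 0 < S)
    (hβ : 2 ≤ (Fintype.card β : ℝ) ^ 2 * ρ)
    (ha : ∀ d x y r s, x ≠ y → c * ρ ^ d.length ≤ |a (d ++ x :: r) - a (d ++ y :: s)|)
    (hb : ∀ d x y r s, x ≠ y → c * ρ ^ d.length ≤ |b (d ++ x :: r) - b (d ++ y :: s)|)
    (k n : ℕ) :
    ∃ t : ℝ, 1 ≤ t ∧ t ≤ 2 ∧ ∃ T : Finset (List (β × β)),
      (1 / (4 * (8 * S / c + 1) * ρ ^ k)) ^ n ≤ (T.card : ℝ) ∧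
      (∀ s ∈ T, s.length = n * k) ∧
      ∀ s ∈ T, ∀ s' ∈ T, s ≠ s' → ∃ d p p' r r' : List (β × β),
        p.length = k ∧ p'.length = k ∧ s = d ++ p ++ r ∧ s' = d ++ p' ++ r' ∧
        S * ρ ^ (d.length + k) ≤ |position a b t (d ++ p) - position a b t (d ++ p')| := by
  set C := 8 * S / c + 1 with hC
  have hC1 : 1 ≤ C := by rw [hC]; have : 0 < 8 * S / c := by positivity
                         linarith
  set N : ℝ := (Fintype.card (β × β) : ℝ) with hN
  have hNβ : N = (Fintype.card β : ℝ) ^ 2 := by rw [hN, Fintype.card_prod]; push_cast; ring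
  have hN0 : 0 < N := by
    rw [hNβ]; by_contra! h
    nlinarith
  obtain ⟨J, hJ⟩ := exists_nat_ge ((ρ ^ k)⁻¹)
  have hJ0 : (0 : ℝ) < J := lt_of_lt_of_le (by positivity) hJ
  have hJk : 1 ≤ ρ ^ k * J := by
    have := mul_le_mul_of_nonneg_left hJ (by positivity : (0 : ℝ) ≤ ρ ^ k)
    rwa [mul_inv_cancel₀ (by positivity)] at this
  set P := listsOf (β × β) k with hPdef
  have hPc : (P.card : ℝ) = N ^ k := card_listsOf k
  have hP : P.Nonempty := by
    rw [← Finset.card_pos]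
    have : (0 : ℝ) < P.card := by rw [hPc]; positivity
    exact_mod_cast this
  set pos : ℕ → List (β × β) → ℝ := fun i => position a b (1 + (i : ℝ) / J) with hpos
  have hpair : ∀ e : List (β × β), ∀ p ∈ P, ∀ q ∈ P,
      (((Finset.range J).filter fun i => |pos i (e ++ q) - pos i (e ++ p)| <
        S * ρ ^ (e.length + k)).card : ℝ) ≤ C * J * ρ ^ k * agree ρ⁻¹ p q := by
    intro e p hp q hq
    have hpl := length_of_mem_listsOf hp
    rcases agree_cases ρ⁻¹ p q (hpl.trans (length_of_mem_listsOf hq).symm) with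
      ⟨_, h2⟩ | ⟨d, x, y, r, s, h1, rfl, rfl, h4⟩
    · rw [h2, hpl, inv_pow, mul_assoc, mul_inv_cancel₀ (by positivity), mul_one]
      refine le_trans (b := (J : ℝ)) ?_ (le_mul_of_one_le_left hJ0.le hC1)
      exact_mod_cast (Finset.card_filter_le _ _).trans_eq (Finset.card_range J)
    · rw [h4]
      set A := a ((e ++ (d ++ y :: s)).map Prod.fst) - a ((e ++ (d ++ x :: r)).map Prod.fst) with hA
      set B := b ((e ++ (d ++ y :: s)).map Prod.snd) - b ((e ++ (d ++ x :: r)).map Prod.snd) with hB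
      have hAB : c * ρ ^ (e.length + d.length) ≤ |A| ∨ c * ρ ^ (e.length + d.length) ≤ |B| := by
        by_cases hxy : x.1 = y.1
        · right
          have hne : y.2 ≠ x.2 := fun h => h1 (Prod.ext hxy h.symm)
          have := hb ((e ++ d).map Prod.snd) y.2 x.2 (s.map Prod.snd) (r.map Prod.snd) hne
          simpa [hB] using this
        · left
          have := ha ((e ++ d).map Prod.fst) y.1 x.1 (s.map Prod.fst) (r.map Prod.fst)
            (Ne.symm hxy)
          simpa [hA] using this
      have hcard := card_near_le J (η := c * ρ ^ (e.length + d.length))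
        (ε := S * ρ ^ (e.length + k)) (by positivity) (by positivity) hAB
      have hdiff : ∀ i : ℕ, pos i (e ++ (d ++ y :: s)) - pos i (e ++ (d ++ x :: r)) =
          A + (1 + (i : ℝ) / J) * B := fun i => by
        simp only [hpos, position, hA, hB]; ring
      simp only [hdiff]
      refine hcard.trans ?_
      have hd : (1 : ℝ) ≤ ρ⁻¹ ^ d.length := one_le_pow₀ ((one_le_inv₀ hρ).2 hρ1.le)
      have e1 : 8 * (S * ρ ^ (e.length + k)) / (c * ρ ^ (e.length + d.length)) * J =
          8 * S / c * J * ρ ^ k * ρ⁻¹ ^ d.length := by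
        rw [pow_add, pow_add, inv_pow]; field_simp
      have e2 : 1 ≤ J * ρ ^ k * ρ⁻¹ ^ d.length := by nlinarith
      rw [e1, hC]; nlinarith
  have hmain : ∀ e : List (β × β), ∑ i ∈ Finset.range J, ∑ p ∈ P,
      (crowd P (fun q => pos i (e ++ q)) (S * ρ ^ (e.length + k)) p : ℝ) ≤
      (2 * C * ρ ^ k * N ^ k) * ((Finset.range J).card * P.card) := by
    intro e
    rw [Finset.sum_comm]
    have hp1 : ∀ p ∈ P, ∑ i ∈ Finset.range J,
        (crowd P (fun q => pos i (e ++ q)) (S * ρ ^ (e.length + k)) p : ℝ) ≤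
        C * J * ρ ^ k * (2 * N ^ k) := by
      intro p hp
      calc _ = ∑ q ∈ P, (((Finset.range J).filter fun i => |pos i (e ++ q) - pos i (e ++ p)| <
            S * ρ ^ (e.length + k)).card : ℝ) := by
            simp only [crowd, Finset.card_filter, Nat.cast_sum]
            rw [Finset.sum_comm]
        _ ≤ ∑ q ∈ P, C * J * ρ ^ k * agree ρ⁻¹ p q := Finset.sum_le_sum fun q hq =>
            hpair e p hp q hq
        _ ≤ _ := by
            rw [← Finset.mul_sum]
            refine mul_le_mul_of_nonneg_left ?_ (by positivity)
            refine sum_agree_le ?_ (by positivity) k p (length_of_mem_listsOf hp)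
            change 2 * ρ⁻¹ ≤ N
            rw [← div_eq_mul_inv, div_le_iff₀ hρ, hNβ]
            exact hβ
    refine (Finset.sum_le_sum hp1).trans_eq ?_
    rw [Finset.sum_const, nsmul_eq_mul, Finset.card_range]; ring
  have hJne : (Finset.range J).Nonempty := by
    rw [Finset.nonempty_range_iff]
    rintro rfl
    simp at hJ0
  obtain ⟨i, hi, T, h1, h2, h3⟩ := exists_parameter hJne hP
    (fun p hp => length_of_mem_listsOf hp) pos (ε := fun l => S * ρ ^ (l + k))
    (fun _ => by positivity) (K := 2 * C * ρ ^ k * N ^ k) (by positivity) hmain n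
  have hiJ : (i : ℝ) < J := by exact_mod_cast Finset.mem_range.1 hi
  refine ⟨1 + i / J, ?_, ?_, T, ?_, h2, ?_⟩
  · have : (0 : ℝ) ≤ i / J := by positivity
    linarith
  · have : (i : ℝ) / J ≤ 1 := (div_le_one hJ0).2 hiJ.le
    linarith
  · rw [hPc] at h1
    convert h1 using 2
    field_simp
    norm_num
  · intro s hs s' hs' hne
    obtain ⟨d, p, p', r, r', hp, hp', h4, h5, h6⟩ := h3 s hs s' hs' hne
    exact ⟨d, p, p', r, r', length_of_mem_listsOf hp, length_of_mem_listsOf hp', h4, h5,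
      by simpa using h6⟩

end Micro

lemma one_le_letters {w : List ℕ} (hw : ∀ a ∈ w, a = 1 ∨ a = 2) : ∀ a ∈ w, 1 ≤ a := fun a ha => by
  rcases hw a ha with h | h <;> omega

lemma third_le_app {w : List ℕ} {y : ℝ} (hw : ∀ a ∈ w, a = 1 ∨ a = 2) (h1 : 1 / 3 ≤ y)
    (h2 : y ≤ 1) : 1 / 3 ≤ app w y ∧ app w y ≤ 1 := by
  refine ⟨?_, (app_mem (one_le_letters hw) (by linarith) h2).2⟩
  cases w with
  | nil => exact h1
  | cons a w =>
    have h3 := app_mem (one_le_letters fun b hb => hw b (List.mem_cons_of_mem _ hb))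
      (by linarith : (0 : ℝ) ≤ y) h2
    rw [app_cons]
    rcases hw a (by simp) with rfl | rfl <;> push_cast <;>
      rw [div_le_div_iff₀ (by norm_num) (by linarith)] <;> linarith

lemma app_sub_ge {v w : List ℕ} (hv : ∀ a ∈ v, a = 1 ∨ a = 2) (hw : ∀ a ∈ w, a = 1 ∨ a = 2)
    (hl : v.length = w.length) (hne : v ≠ w) {y y' : ℝ} (hy : 1 / 3 ≤ y) (hy1 : y ≤ 1)
    (hy' : 1 / 3 ≤ y') (hy1' : y' ≤ 1) :
    1 / (56 * den 0 v ^ 2) ≤ |app v y - app w y'| := by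
  have gap : ∀ t t' : ℝ, 1 / 3 ≤ t → t ≤ 1 → 1 / 3 ≤ t' → t' ≤ 1 →
      1 / 14 ≤ 1 / (1 + t) - 1 / (2 + t') := by
    intro t t' h1 h2 h3 h4
    rw [div_sub_div _ _ (by linarith) (by linarith), div_le_div_iff₀ (by norm_num) (by nlinarith)]
    nlinarith
  rcases agree_cases (1 : ℝ) v w hl with ⟨h, _⟩ | ⟨d, a, b, r, s, hab, rfl, rfl, _⟩
  · exact absurd h hne
  have hd : ∀ a ∈ d, 1 ≤ a := one_le_letters fun a ha => hv a (by simp [ha])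
  have har := third_le_app (w := r) (fun a ha => hv a (by simp [ha])) hy hy1
  have hbs := third_le_app (w := s) (fun a ha => hw a (by simp [ha])) hy' hy1'
  have ha : a = 1 ∨ a = 2 := hv a (by simp)
  have hb : b = 1 ∨ b = 2 := hw b (by simp)
  have hA := third_le_app (w := a :: r) (fun a ha => hv a (by simp at ha ⊢; tauto)) hy hy1
  have hB := third_le_app (w := b :: s) (fun a ha => hw a (by simp at ha ⊢; tauto)) hy' hy1'
  have hgap : 1 / 14 ≤ |app (a :: r) y - app (b :: s) y'| := by
    rw [app_cons, app_cons]
    rcases ha with rfl | rfl <;> rcases hb with rfl | rfl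
    · exact absurd rfl hab
    · have := gap _ _ har.1 har.2 hbs.1 hbs.2
      push_cast; exact this.trans (le_abs_self _)
    · have := gap _ _ hbs.1 hbs.2 har.1 har.2
      push_cast; rw [abs_sub_comm]; exact this.trans (le_abs_self _)
    · exact absurd rfl hab
  rw [app_append, app_append]
  refine le_trans ?_ (abs_app_sub hd (by linarith) hA.2 (by linarith) hB.2).1
  have hd1 := one_le_den hd (le_refl (0 : ℝ))
  have hdv : den 0 d ≤ den 0 (d ++ a :: r) := by
    have h1 : ∀ x ∈ a :: r, 1 ≤ x := one_le_letters fun x hx => hv x (by simp at hx ⊢; tauto)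
    exact (le_mul_of_one_le_right (by linarith) (one_le_den h1 le_rfl)).trans
      (den_append_bounds hd h1).1
  have hv1 : 0 < den 0 (d ++ a :: r) := by linarith
  rw [div_le_div_iff₀ (by positivity) (by positivity)]
  have h2 : den 0 d ^ 2 ≤ den 0 (d ++ a :: r) ^ 2 := by gcongr
  nlinarith

/-- Appends `1, 1, 1, 1, 1, 1` when the denominator of `w` is less than `T ^ i`. -/
noncomputable def adjust (T : ℝ) (i : ℕ) (w : List ℕ) : List ℕ :=
  open Classical in if den 0 w < T ^ i then w ++ [1, 1, 1, 1, 1, 1] else w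

/-- The word obtained from `w` by appending the blocks of a list, adjusting after each one. -/
noncomputable def extend (T : ℝ) : ℕ → List ℕ → List (List ℕ) → List ℕ
  | _, w, [] => w
  | i, w, b :: p => extend T (i + 1) (adjust T (i + 1) (w ++ b)) p

lemma extend_append (T : ℝ) (i : ℕ) (w : List ℕ) (p q : List (List ℕ)) :
    extend T i w (p ++ q) = extend T (i + p.length) (extend T i w p) q := by
  induction p generalizing i w with
  | nil => rfl
  | cons b p ih =>
    simp only [List.cons_append, extend, ih, List.length_cons]
    congr 1; omega

lemma good_six_ones : Good [1, 1, 1, 1, 1, 1] :=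
  (good_one_one.append good_one_one).append good_one_one

lemma adjust_eq (T : ℝ) (i : ℕ) (w : List ℕ) : ∃ u, Good u ∧ adjust T i w = w ++ u := by
  unfold adjust
  split_ifs
  · exact ⟨_, good_six_ones, rfl⟩
  · exact ⟨[], good_nil, by simp⟩

lemma extend_eq (T : ℝ) {p : List (List ℕ)} (hp : ∀ b ∈ p, Good b) (i : ℕ) (w : List ℕ) :
    ∃ u, Good u ∧ extend T i w p = w ++ u := by
  induction p generalizing i w with
  | nil => exact ⟨[], good_nil, by simp [extend]⟩
  | cons b p ih =>
    obtain ⟨u, hu, h⟩ := adjust_eq T (i + 1) (w ++ b)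
    obtain ⟨u', hu', h'⟩ := ih (fun x hx => hp x (by simp [hx])) (i + 1)
      (adjust T (i + 1) (w ++ b))
    refine ⟨b ++ u ++ u', ((hp b (by simp)).append hu).append hu', ?_⟩
    rw [extend, h', h]; simp

section Blocks

variable {R : ℝ} {B : Finset (List ℕ)} {L : ℕ}

lemma adjust_bounds (hR : 1 ≤ R) {w b : List ℕ} {i : ℕ} (hw : Good w) (hb : Good b)
    (hb1 : R ≤ den 0 b) (hb2 : den 0 b ≤ 4 * R) (h1 : (8 * R) ^ i ≤ den 0 w)
    (h2 : den 0 w ≤ 26 * (8 * R) ^ i) :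
    (8 * R) ^ (i + 1) ≤ den 0 (adjust (8 * R) (i + 1) (w ++ b)) ∧
      den 0 (adjust (8 * R) (i + 1) (w ++ b)) ≤ 26 * (8 * R) ^ (i + 1) := by
  obtain ⟨e1, e2⟩ := den_append_bounds hw.one_le hb.one_le
  have hT : 0 < (8 * R) ^ i := by positivity
  have hd : den 0 [1, 1, 1, 1, 1, 1] = 13 := by norm_num [den]
  have hlow : (8 * R) ^ i * R ≤ den 0 (w ++ b) :=
    (mul_le_mul h1 hb1 (by linarith) (by linarith)).trans e1
  have hup : den 0 (w ++ b) ≤ 26 * (8 * R) ^ (i + 1) := by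
    refine e2.trans ?_
    have := mul_le_mul h2 hb2 (by linarith) (by positivity)
    rw [pow_succ]; linarith
  unfold adjust
  split_ifs with h
  · obtain ⟨f1, f2⟩ := den_append_bounds (hw.append hb).one_le good_six_ones.one_le
    rw [hd] at f1 f2
    rw [pow_succ] at *
    constructor <;> nlinarith
  · exact ⟨not_lt.1 h, hup⟩

lemma extend_bounds (hR : 1 ≤ R) {p : List (List ℕ)}
    (hp : ∀ b ∈ p, Good b ∧ R ≤ den 0 b ∧ den 0 b ≤ 4 * R) (i : ℕ) (w : List ℕ) (hw : Good w)
    (h1 : (8 * R) ^ i ≤ den 0 w) (h2 : den 0 w ≤ 26 * (8 * R) ^ i) :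
    (8 * R) ^ (i + p.length) ≤ den 0 (extend (8 * R) i w p) ∧
      den 0 (extend (8 * R) i w p) ≤ 26 * (8 * R) ^ (i + p.length) := by
  induction p generalizing i w with
  | nil => exact ⟨h1, h2⟩
  | cons b p ih =>
    obtain ⟨g, g1, g2⟩ := hp b (by simp)
    obtain ⟨e1, e2⟩ := adjust_bounds hR hw g g1 g2 h1 h2
    obtain ⟨u, hu, h⟩ := adjust_eq (8 * R) (i + 1) (w ++ b)
    have := ih (fun x hx => hp x (by simp [hx])) (i + 1) (adjust (8 * R) (i + 1) (w ++ b))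
      (h ▸ (hw.append g).append hu) e1 e2
    rw [extend, List.length_cons, show i + (p.length + 1) = i + 1 + p.length by omega]
    exact this

lemma extend_sep (hR : 1 ≤ R) {d r s : List (List ℕ)} {x y : List ℕ}
    (hx : ∀ b ∈ d ++ x :: r, Good b ∧ b.length = L ∧ R ≤ den 0 b ∧ den 0 b ≤ 4 * R)
    (hy : ∀ b ∈ d ++ y :: s, Good b ∧ b.length = L ∧ R ≤ den 0 b ∧ den 0 b ≤ 4 * R)
    (hxy : x ≠ y) :
    1 / (56 * (26 * (8 * R)) ^ 2) * (((8 * R) ^ 2)⁻¹) ^ d.length ≤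
      |app (extend (8 * R) 0 [] (d ++ x :: r)) 1 - app (extend (8 * R) 0 [] (d ++ y :: s)) 1| := by
  have hd : ∀ b ∈ d, Good b ∧ R ≤ den 0 b ∧ den 0 b ≤ 4 * R := fun b hb => by
    obtain ⟨h1, _, h2⟩ := hx b (by simp [hb]); exact ⟨h1, h2⟩
  obtain ⟨w0, hw0, hw⟩ := extend_eq (8 * R) (fun b hb => (hd b hb).1) 0 []
  obtain ⟨e1, e2⟩ := extend_bounds hR hd 0 [] good_nil (by simp [den]) (by norm_num [den])
  rw [List.nil_append] at hw
  rw [hw, zero_add] at e1 e2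
  have tail : ∀ {z : List ℕ} {q : List (List ℕ)}, (∀ b ∈ z :: q, Good b) →
      ∃ u, Good u ∧ extend (8 * R) 0 [] (d ++ z :: q) = w0 ++ z ++ u := by
    intro z q hq
    obtain ⟨u, hu, h⟩ := adjust_eq (8 * R) (0 + d.length + 1) (w0 ++ z)
    obtain ⟨u', hu', h'⟩ := extend_eq (8 * R) (p := q) (fun b hb => hq b (by simp [hb]))
      (0 + d.length + 1) (adjust (8 * R) (0 + d.length + 1) (w0 ++ z))
    refine ⟨u ++ u', hu.append hu', ?_⟩
    rw [extend_append, hw, extend, h', h]; simp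
  obtain ⟨u, hu, hxu⟩ := tail (z := x) (q := r) fun b hb => (hx b (by simp at hb ⊢; tauto)).1
  obtain ⟨u', hu', hyu⟩ := tail (z := y) (q := s) fun b hb => (hy b (by simp at hb ⊢; tauto)).1
  obtain ⟨gx, lx, x1, x2⟩ := hx x (by simp)
  obtain ⟨gy, ly, y1, y2⟩ := hy y (by simp)
  rw [hxu, hyu, app_append, app_append (w0 ++ y)]
  refine le_trans ?_ (app_sub_ge (hw0.append gx).1 (hw0.append gy).1 (by simp [lx, ly])
    (fun h => hxy (List.append_cancel_left h)) (third_le_app hu.1 (by norm_num) le_rfl).1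
    (third_le_app hu.1 (by norm_num) le_rfl).2
    (third_le_app hu'.1 (by norm_num) le_rfl).1
    (third_le_app hu'.1 (by norm_num) le_rfl).2)
  have hden : den 0 (w0 ++ x) ≤ 26 * (8 * R) * (8 * R) ^ d.length := by
    refine (den_append_bounds hw0.one_le gx.one_le).2.trans ?_
    have := mul_le_mul e2 x2 (by linarith) (by positivity)
    linarith
  have hpos := one_le_den (hw0.append gx).one_le (le_refl (0 : ℝ))
  rw [inv_pow, ← pow_mul, mul_comm 2, pow_mul, one_div, ← mul_inv, ← one_div, mul_assoc,
    ← mul_pow]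
  refine one_div_le_one_div_of_le (by positivity) ?_
  gcongr

lemma extend_near (hR : 1 ≤ R) {d r s : List (List ℕ)}
    (hd : ∀ b ∈ d, Good b ∧ R ≤ den 0 b ∧ den 0 b ≤ 4 * R) (hr : ∀ b ∈ r, Good b)
    (hs : ∀ b ∈ s, Good b) {y y' : ℝ} (h0 : 0 ≤ y) (h1 : y ≤ 1) (h0' : 0 ≤ y') (h1' : y' ≤ 1) :
    |app (extend (8 * R) 0 [] (d ++ r)) y - app (extend (8 * R) 0 [] (d ++ s)) y'| ≤
      (((8 * R) ^ 2)⁻¹) ^ d.length := by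
  obtain ⟨w0, hw0, hw⟩ := extend_eq (8 * R) (fun b hb => (hd b hb).1) 0 []
  obtain ⟨e1, _⟩ := extend_bounds hR hd 0 [] good_nil (by simp [den]) (by norm_num [den])
  rw [List.nil_append] at hw
  rw [hw, zero_add] at e1
  obtain ⟨u, hu, h⟩ := extend_eq (8 * R) hr (0 + d.length) w0
  obtain ⟨u', hu', h'⟩ := extend_eq (8 * R) hs (0 + d.length) w0
  rw [extend_append, extend_append, hw, h, h', app_append, app_append]
  have a1 := app_mem hu.one_le h0 h1
  have a2 := app_mem hu'.one_le h0' h1'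
  refine (abs_app_sub hw0.one_le a1.1 a1.2 a2.1 a2.2).2.trans ?_
  have hdiff : |app u y - app u' y'| ≤ 1 := by rw [abs_le]; constructor <;> linarith
  rw [inv_pow, ← pow_mul, mul_comm 2, pow_mul, ← one_div]
  have hpos := one_le_den hw0.one_le (le_refl (0 : ℝ))
  exact div_le_div₀ zero_le_one hdiff (by positivity) (by gcongr)

end Blocks

/-- The Möbius map `x ↦ x / (1 + θ x)`. -/
noncomputable def mob (θ x : ℝ) : ℝ := x / (1 + θ * x)

lemma mob_sub {θ x x' : ℝ} (hθ : 0 ≤ θ) (hx : 0 ≤ x) (hx' : 0 ≤ x') :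
    mob θ x - mob θ x' = (x - x') / ((1 + θ * x) * (1 + θ * x')) := by
  have h1 : 0 < 1 + θ * x := by positivity
  have h2 : 0 < 1 + θ * x' := by positivity
  rw [mob, mob, div_sub_div _ _ h1.ne' h2.ne']
  congr 1; ring

lemma abs_mob_sub {θ x x' : ℝ} (hθ : 0 ≤ θ) (hθ1 : θ ≤ 1) (hx : 0 ≤ x) (hx1 : x ≤ 1)
    (hx' : 0 ≤ x') (hx1' : x' ≤ 1) :
    |x - x'| / 4 ≤ |mob θ x - mob θ x'| ∧ |mob θ x - mob θ x'| ≤ |x - x'| := by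
  have h1 : 1 ≤ 1 + θ * x := by nlinarith
  have h2 : 1 ≤ 1 + θ * x' := by nlinarith
  have h3 : 1 + θ * x ≤ 2 := by nlinarith
  have h4 : 1 + θ * x' ≤ 2 := by nlinarith
  have h5 : 0 < (1 + θ * x) * (1 + θ * x') := by positivity
  rw [mob_sub hθ hx hx', abs_div, abs_of_pos h5]
  constructor
  · exact div_le_div_of_nonneg_left (abs_nonneg _) h5 (by nlinarith)
  · exact div_le_self (abs_nonneg _) (by nlinarith)

lemma map_val_mem {B : Finset (List ℕ)} (p : List {w // w ∈ B}) :
    ∀ b ∈ p.map Subtype.val, b ∈ B := by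
  simp only [List.mem_map, forall_exists_index, and_imp]
  rintro _ x _ rfl
  exact x.2

/-- Large families of pairs of words whose cylinders have well separated weighted sums. -/
lemma exists_family {θ θ' : ℝ} (hθ : 0 ≤ θ) (hθ1 : θ ≤ 1) (hθ' : 0 ≤ θ') (hθ1' : θ' ≤ 1) :
    ∃ ρ C : ℝ, 0 < ρ ∧ ρ < 1 ∧ 0 < C ∧ ∀ k n : ℕ, ∃ t : ℝ, 1 ≤ t ∧ t ≤ 2 ∧
    ∃ (b : ℕ) (m m' : Fin b → List ℕ), (1 / (C * ρ ^ k)) ^ n ≤ (b : ℝ) ∧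
    (∀ i, Good (m i) ∧ 1 / ρ ^ (n * k) ≤ den 0 (m i) ^ 2 ∧
      den 0 (m i) ^ 2 ≤ 676 / ρ ^ (n * k)) ∧
    (∀ i, Good (m' i) ∧ 1 / ρ ^ (n * k) ≤ den 0 (m' i) ^ 2 ∧
      den 0 (m' i) ^ 2 ≤ 676 / ρ ^ (n * k)) ∧
    ∀ i i', i ≠ i' → ∃ j, j + k ≤ n * k ∧ ∀ y z y' z' : ℝ, 0 ≤ y → y ≤ 1 → 0 ≤ z → z ≤ 1 →
      0 ≤ y' → y' ≤ 1 → 0 ≤ z' → z' ≤ 1 →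
      |app (m i) y - app (m i') z| ≤ ρ ^ j ∧ |app (m' i) y' - app (m' i') z'| ≤ ρ ^ j ∧
      2 * ρ ^ (j + k) ≤ |mob θ (app (m i) y) - mob θ (app (m i') z) +
        t * (mob θ' (app (m' i) y') - mob θ' (app (m' i') z'))| := by
  obtain ⟨R, hR, B, L, hB, hcard⟩ := exists_rich 12
  set ρ : ℝ := ((8 * R) ^ 2)⁻¹ with hρ
  have hρ0 : 0 < ρ := by positivity
  have hρ1 : ρ < 1 := inv_lt_one_of_one_lt₀ (by nlinarith)
  set W : List {w // w ∈ B} → List ℕ := fun p => extend (8 * R) 0 [] (p.map Subtype.val) with hW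
  set c : ℝ := 1 / (56 * (26 * (8 * R)) ^ 2) / 4 with hc
  have hc0 : 0 < c := by positivity
  have hBp : ∀ p : List {w // w ∈ B}, ∀ b ∈ p.map Subtype.val,
      Good b ∧ R ≤ den 0 b ∧ den 0 b ≤ 4 * R := fun p b hb => by
    obtain ⟨h1, _, h2⟩ := hB b (map_val_mem p b hb); exact ⟨h1, h2⟩
  have hWg : ∀ p, Good (W p) := fun p => by
    obtain ⟨u, hu, h⟩ := extend_eq (8 * R) (fun b hb => (hBp p b hb).1) 0 []
    simp only [hW, h]; simpa using hu
  have hWm : ∀ p, ∀ y : ℝ, 0 ≤ y → y ≤ 1 → 0 ≤ app (W p) y ∧ app (W p) y ≤ 1 := fun p y h0 h1 =>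
    app_mem (hWg p).one_le h0 h1
  have hWd : ∀ p, 1 / ρ ^ p.length ≤ den 0 (W p) ^ 2 ∧ den 0 (W p) ^ 2 ≤ 676 / ρ ^ p.length := by
    intro p
    obtain ⟨h1, h2⟩ := extend_bounds hR (hBp p) 0 [] good_nil (by simp [den]) (by norm_num [den])
    rw [zero_add, List.length_map] at h1 h2
    have h3 : 1 / ρ ^ p.length = ((8 * R) ^ p.length) ^ 2 := by
      rw [hρ, inv_pow, one_div, inv_inv, ← pow_mul, ← pow_mul, mul_comm 2]
    have h4 : 676 / ρ ^ p.length = (26 * (8 * R) ^ p.length) ^ 2 := by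
      rw [mul_pow, ← h3]; ring
    rw [h3, h4]
    have h5 := one_le_den (hWg p).one_le (le_refl (0 : ℝ))
    exact ⟨by gcongr, by gcongr⟩
  have hsep : ∀ {θ : ℝ}, 0 ≤ θ → θ ≤ 1 → ∀ (d : List {w // w ∈ B}) (x y : {w // w ∈ B})
      (r s : List {w // w ∈ B}), x ≠ y → c * ρ ^ d.length ≤
        |mob θ (app (W (d ++ x :: r)) 1) - mob θ (app (W (d ++ y :: s)) 1)| := by
    intro θ h0 h1 d x y r s hxy
    have a1 := hWm (d ++ x :: r) 1 zero_le_one le_rfl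
    have a2 := hWm (d ++ y :: s) 1 zero_le_one le_rfl
    refine le_trans ?_ (abs_mob_sub h0 h1 a1.1 a1.2 a2.1 a2.2).1
    have h := extend_sep (L := L) hR (d := d.map Subtype.val) (r := r.map Subtype.val)
      (s := s.map Subtype.val) (x := x) (y := y)
      (fun b hb => hB b (map_val_mem (d ++ x :: r) b (by simpa using hb)))
      (fun b hb => hB b (map_val_mem (d ++ y :: s) b (by simpa using hb)))
      (fun h => hxy (Subtype.ext h))
    simp only [hW, List.map_append, List.map_cons, hc]
    rw [List.length_map] at h
    linarith
  have hnear : ∀ (d r s : List {w // w ∈ B}) (y y' : ℝ), 0 ≤ y → y ≤ 1 → 0 ≤ y' → y' ≤ 1 →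
      |app (W (d ++ r)) y - app (W (d ++ s)) y'| ≤ ρ ^ d.length := by
    intro d r s y y' h0 h1 h0' h1'
    have h := extend_near hR (hBp d) (fun b hb => (hBp r b hb).1) (fun b hb => (hBp s b hb).1)
      h0 h1 h0' h1'
    rw [List.length_map] at h
    simpa only [hW, List.map_append] using h
  have hβ : 2 ≤ (Fintype.card {w // w ∈ B} : ℝ) ^ 2 * ρ := by
    rw [Fintype.card_coe, hρ, ← div_eq_mul_inv, le_div_iff₀ (by positivity)]
    nlinarith
  refine ⟨ρ, 4 * (8 * 8 / c + 1), hρ0, hρ1, by positivity, fun k n => ?_⟩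
  obtain ⟨t, ht1, ht2, T, hT, hlen, hTsep⟩ := exists_projection (S := 8)
    (a := fun p => mob θ (app (W p) 1)) (b := fun p => mob θ' (app (W p) 1))
    hρ0 hρ1 hc0 (by norm_num) hβ (hsep hθ hθ1) (hsep hθ' hθ1') k n
  let e := T.equivFin.symm
  refine ⟨t, ht1, ht2, T.card, fun i => W ((e i).1.map Prod.fst),
    fun i => W ((e i).1.map Prod.snd), hT, fun i => ?_, fun i => ?_, fun i i' hii => ?_⟩
  · have := hWd ((e i).1.map Prod.fst)
    rw [List.length_map, hlen _ (e i).2] at this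
    exact ⟨hWg _, this⟩
  · have := hWd ((e i).1.map Prod.snd)
    rw [List.length_map, hlen _ (e i).2] at this
    exact ⟨hWg _, this⟩
  · obtain ⟨d, p, p', r, r', hp, hp', hs, hs', h⟩ := hTsep _ (e i).2 _ (e i').2
      fun h => hii (e.injective (Subtype.ext h))
    have hl := hlen _ (e i).2
    refine ⟨d.length, ?_, ?_⟩
    · rw [hs] at hl; simp only [List.length_append] at hl; omega
    intro y z y' z' hy hy1 hz hz1 hy' hy1' hz' hz1'
    simp only [hs, hs', position, List.map_append] at h ⊢
    have n1 := hnear (d.map Prod.fst) ((p ++ r).map Prod.fst) ((p' ++ r').map Prod.fst) y z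
      hy hy1 hz hz1
    have n2 := hnear (d.map Prod.snd) ((p ++ r).map Prod.snd) ((p' ++ r').map Prod.snd) y' z'
      hy' hy1' hz' hz1'
    have key : ∀ {θ : ℝ} (g : {w // w ∈ B} × {w // w ∈ B} → {w // w ∈ B})
        (q s : List ({w // w ∈ B} × {w // w ∈ B})) (y : ℝ),
        0 ≤ θ → θ ≤ 1 → 0 ≤ y → y ≤ 1 → q.length = k →
        |mob θ (app (W (d.map g ++ q.map g ++ s.map g)) y) -
          mob θ (app (W (d.map g ++ q.map g)) 1)| ≤ ρ ^ (d.length + k) := by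
      intro θ g q s y h0 h1 hy hy1 hq
      have a1 := hWm (d.map g ++ q.map g ++ s.map g) y hy hy1
      have a2 := hWm (d.map g ++ q.map g) 1 zero_le_one le_rfl
      refine (abs_mob_sub h0 h1 a1.1 a1.2 a2.1 a2.2).2.trans ?_
      have := hnear (d.map g ++ q.map g) (s.map g) [] y 1 hy hy1 zero_le_one le_rfl
      simpa [hq] using this
    have k1 := abs_le.1 (key Prod.fst p r y hθ hθ1 hy hy1 hp)
    have k2 := abs_le.1 (key Prod.fst p' r' z hθ hθ1 hz hz1 hp')
    have k3 := abs_le.1 (key Prod.snd p r y' hθ' hθ1' hy' hy1' hp)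
    have k4 := abs_le.1 (key Prod.snd p' r' z' hθ' hθ1' hz' hz1' hp')
    rw [List.length_map, List.map_append, List.map_append, ← List.append_assoc,
      ← List.append_assoc] at n1 n2
    refine ⟨n1, n2, ?_⟩
    generalize mob θ (app (W (d.map Prod.fst ++ p.map Prod.fst ++ r.map Prod.fst)) y) = A1 at *
    generalize mob θ (app (W (d.map Prod.fst ++ p'.map Prod.fst ++ r'.map Prod.fst)) z) = A2 at *
    generalize mob θ' (app (W (d.map Prod.snd ++ p.map Prod.snd ++ r.map Prod.snd)) y') = A3 at *
    generalize mob θ' (app (W (d.map Prod.snd ++ p'.map Prod.snd ++ r'.map Prod.snd)) z') = A4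
      at *
    generalize mob θ (app (W (d.map Prod.fst ++ p.map Prod.fst)) 1) = B1 at *
    generalize mob θ (app (W (d.map Prod.fst ++ p'.map Prod.fst)) 1) = B2 at *
    generalize mob θ' (app (W (d.map Prod.snd ++ p.map Prod.snd)) 1) = B3 at *
    generalize mob θ' (app (W (d.map Prod.snd ++ p'.map Prod.snd)) 1) = B4 at *
    set E := ρ ^ (d.length + k)
    have hE : 0 < E := by positivity
    rcases le_abs'.1 h with h | h
    · rw [le_abs']; left; nlinarith
    · rw [le_abs']; right; nlinarith

lemma exists_bounded_combination_of_pos {G H ε C : ℝ} (hH : 0 < H) (m : ℕ) {x y : ℕ}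
    (h0 : 0 < x * G - y * H) (h1 : x * G - y * H < ε) :
    ∃ M : ℕ, ∀ τ : ℝ, |τ| ≤ C →
      ∃ a b : ℕ, m ≤ a ∧ a ≤ M ∧ m ≤ b ∧ b ≤ M ∧ |a * G - b * H - τ| < ε := by
  set s := x * G - y * H with hs
  obtain ⟨b₀, hb₀⟩ := exists_nat_gt ((m * G + C) / H)
  rw [div_lt_iff₀ hH] at hb₀
  set b₁ := b₀ + m
  have hb : m * G - b₁ * H < -C := by
    have : (0 : ℝ) ≤ m * H := by positivity
    push_cast [b₁]
    nlinarith
  obtain ⟨N, hN⟩ := exists_nat_gt ((C - (m * G - b₁ * H)) / s)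
  rw [div_lt_iff₀ h0] at hN
  refine ⟨m + b₁ + N * (x + y), fun τ hτ => ?_⟩
  have hτ' := abs_le.1 hτ
  set j := ⌊(τ - (m * G - b₁ * H)) / s⌋₊ with hj
  have hj1 : j * s ≤ τ - (m * G - b₁ * H) := by
    rw [← le_div_iff₀ h0]
    exact Nat.floor_le (div_nonneg (by linarith) h0.le)
  have hj2 : τ - (m * G - b₁ * H) < (j + 1) * s := by
    rw [← div_lt_iff₀ h0]
    exact Nat.lt_floor_add_one _
  have hjN : j ≤ N := by
    have : (j : ℝ) * s ≤ N * s := by linarith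
    exact_mod_cast le_of_mul_le_mul_right this h0
  have hx : j * x ≤ N * (x + y) := Nat.mul_le_mul hjN (by omega)
  have hy : j * y ≤ N * (x + y) := Nat.mul_le_mul hjN (by omega)
  refine ⟨m + j * x, b₁ + j * y, by omega, by omega, by omega, by omega, ?_⟩
  have e : ((m + j * x : ℕ) : ℝ) * G - ((b₁ + j * y : ℕ) : ℝ) * H - τ =
      j * s - (τ - (m * G - b₁ * H)) := by
    rw [hs]; push_cast; ring
  rw [e, abs_lt]
  constructor <;> linarith

/-- Uniformly bounded solutions of an inhomogeneous approximation problem. -/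
lemma exists_bounded_combination {G H ε : ℝ} (C : ℝ) (hG : 0 < G) (hH : 0 < H)
    (hGH : Irrational (G / H)) (hε : 0 < ε) (m : ℕ) :
    ∃ M : ℕ, ∀ τ : ℝ, |τ| ≤ C →
      ∃ a b : ℕ, m ≤ a ∧ a ≤ M ∧ m ≤ b ∧ b ≤ M ∧ |a * G - b * H - τ| < ε := by
  have hpos : 0 < min ε (min G H) := by positivity
  obtain ⟨z, hz, hz0, hz1⟩ := (dense_addSubgroupClosure_pair_iff.2 hGH).exists_between hpos
  obtain ⟨x, y, rfl⟩ := AddSubgroup.mem_closure_pair.1 hz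
  simp only [zsmul_eq_mul, lt_min_iff] at hz0 hz1
  obtain ⟨h1, h2, h3⟩ := hz1
  rcases lt_trichotomy x 0 with hx | hx | hx
  · obtain ⟨k, hk⟩ := Int.eq_ofNat_of_zero_le (show 0 ≤ -x by omega)
    have hxk : (x : ℝ) = -k := by
      rw [show x = -(k : ℤ) by omega]; push_cast; ring
    have hy : 0 ≤ y := by
      by_contra hy
      have : (y : ℝ) ≤ 0 := by exact_mod_cast (not_le.1 hy).le
      have : (x : ℝ) ≤ 0 := by exact_mod_cast hx.le
      nlinarith
    lift y to ℕ using hy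
    rw [hxk] at hz0 h1
    push_cast at hz0 h1
    obtain ⟨M, hM⟩ := exists_bounded_combination_of_pos (C := C) hG m (x := y) (y := k)
      (by linarith) (show y * H - k * G < ε by linarith)
    refine ⟨M, fun τ hτ => ?_⟩
    obtain ⟨a, b, ha, ha', hb, hb', h⟩ := hM (-τ) (by rwa [abs_neg])
    refine ⟨b, a, hb, hb', ha, ha', ?_⟩
    rw [abs_sub_comm] at h
    rwa [show b * G - a * H - τ = -τ - (a * H - b * G) by ring]
  · exfalso
    subst hx
    simp only [Int.cast_zero, zero_mul, zero_add] at hz0 h3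
    have hy : 0 < y := by
      by_contra hy
      have : (y : ℝ) ≤ 0 := by exact_mod_cast not_lt.1 hy
      nlinarith
    have : (1 : ℝ) ≤ y := by exact_mod_cast hy
    nlinarith
  · have hx1 : (1 : ℝ) ≤ x := by exact_mod_cast hx
    have hy : y ≤ 0 := by
      by_contra hy
      have : (0 : ℝ) < y := by exact_mod_cast not_le.1 hy
      nlinarith [mul_pos this hH]
    obtain ⟨k, hk⟩ := Int.eq_ofNat_of_zero_le (show 0 ≤ -y by omega)
    have hyk : (y : ℝ) = -k := by
      rw [show y = -(k : ℤ) by omega]; push_cast; ring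
    lift x to ℕ using hx.le
    rw [hyk] at hz0 h1
    push_cast at hz0 h1
    exact exists_bounded_combination_of_pos hH m (x := x) (y := k) (by linarith) (by linarith)

lemma pow_add_sqrt (c : ℕ) {x y : ℕ} (hx : 1 ≤ x) (hy : 1 ≤ y) (n : ℕ) :
    ∃ p q : ℕ, 1 ≤ p ∧ 1 ≤ q ∧ ((x : ℝ) + y * √c) ^ (n + 1) = p + q * √c := by
  induction n with
  | zero => exact ⟨x, y, hx, hy, by simp⟩
  | succ n ih =>
    obtain ⟨p, q, hp, hq, h⟩ := ih
    refine ⟨p * x + q * y * c, p * y + q * x, ?_, ?_, ?_⟩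
    · nlinarith [Nat.zero_le (q * y * c), Nat.mul_le_mul hp hx]
    · nlinarith [Nat.zero_le (q * x), Nat.mul_le_mul hp hy]
    · have := Real.mul_self_sqrt (Nat.cast_nonneg (α := ℝ) c)
      rw [pow_succ, h]
      push_cast
      linear_combination (q : ℝ) * y * this

lemma irrational_log_ratio :
    Irrational (Real.log ((3 + √5) / 2) / Real.log (13 + 2 * √42)) := by
  rintro ⟨r, hr⟩
  have s5 : 0 ≤ √(5 : ℝ) := Real.sqrt_nonneg _
  have s42 : 0 ≤ √(42 : ℝ) := Real.sqrt_nonneg _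
  have hG : 0 < Real.log ((3 + √5) / 2) := Real.log_pos (by linarith)
  have hH : 0 < Real.log (13 + 2 * √42) := Real.log_pos (by linarith)
  have hr0 : 0 < r := by
    have : (0 : ℝ) < r := by rw [hr]; positivity
    exact_mod_cast this
  obtain ⟨n, hn⟩ := Nat.exists_eq_succ_of_ne_zero r.den_nz
  have hnum : 0 < r.num := Rat.num_pos.2 hr0
  obtain ⟨k, hk⟩ := Int.eq_ofNat_of_zero_le (show 0 ≤ r.num - 1 by omega)
  have hk' : r.num = ((k + 1 : ℕ) : ℤ) := by push_cast; omega
  have e : ((n + 1 : ℕ) : ℝ) * Real.log ((3 + √5) / 2) =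
      ((k + 1 : ℕ) : ℝ) * Real.log (13 + 2 * √42) := by
    rw [Rat.cast_def, hk', hn, Int.cast_natCast] at hr
    rw [Nat.succ_eq_add_one] at hr
    rw [eq_div_iff hH.ne'] at hr
    rw [← hr]
    field_simp
  rw [← Real.log_pow, ← Real.log_pow] at e
  replace e := Real.log_injOn_pos (Set.mem_Ioi.2 (by positivity)) (Set.mem_Ioi.2 (by positivity)) e
  obtain ⟨p, q, hp, hq, h1⟩ := pow_add_sqrt 5 (x := 3) (y := 1) (by norm_num) le_rfl n
  obtain ⟨p', q', hp', hq', h2⟩ := pow_add_sqrt 42 (x := 13) (y := 2) (by norm_num) (by norm_num) k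
  push_cast at h1 h2
  rw [one_mul] at h1
  rw [div_pow, h1, h2, div_eq_iff (by positivity)] at e
  have hi : Irrational √((210 : ℕ) : ℝ) := by
    rw [irrational_sqrt_natCast_iff]
    rintro ⟨m, hm⟩
    have : m < 15 := by nlinarith
    interval_cases m <;> omega
  have h210 : √((210 : ℕ) : ℝ) = √42 * √5 := by
    rw [← Real.sqrt_mul (by norm_num)]; norm_num
  have q5 := Real.mul_self_sqrt (show (0 : ℝ) ≤ 5 by norm_num)
  have q42 := Real.mul_self_sqrt (show (0 : ℝ) ≤ 42 by norm_num)
  set z : ℝ := 2 ^ (n + 1) with hz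
  have hzn : z = ((2 ^ (n + 1) : ℕ) : ℝ) := by push_cast; rfl
  apply hi
  refine ⟨(42 * (q' * 2 ^ (n + 1)) ^ 2 + 5 * q ^ 2 - (p - p' * 2 ^ (n + 1)) ^ 2) /
    (2 * (q' * 2 ^ (n + 1)) * q), ?_⟩
  rw [h210]
  push_cast
  rw [← hz, div_eq_iff (by positivity)]
  have hd : (p : ℝ) - p' * z = q' * z * √42 - q * √5 := by linarith
  rw [hd]
  linear_combination (-(q' * z) ^ 2) * q42 - (q : ℝ) ^ 2 * q5

/-- The `n`-fold repetition of a word. -/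
def rep (g : List ℕ) (n : ℕ) : List ℕ := (List.replicate n g).flatten

lemma rep_succ (g : List ℕ) (n : ℕ) : rep g (n + 1) = g ++ rep g n := by
  simp [rep, List.replicate_succ]

lemma good_rep {g : List ℕ} (hg : Good g) (n : ℕ) : Good (rep g n) := by
  induction n with
  | zero => exact good_nil
  | succ n ih => rw [rep_succ]; exact hg.append ih

lemma den_rep {g : List ℕ} (hg : Good g) {y : ℝ} (hy : 0 ≤ y) (hy1 : y ≤ 1)
    (hfix : app g y = y) (n : ℕ) {t : ℝ} (ht : 0 ≤ t) (ht1 : t ≤ 1) :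
    den t (rep g n) * (1 + rat t (rep g n) * y) =
      (1 + t * y) * (den 0 g * (1 + rat 0 g * y)) ^ n := by
  induction n generalizing t with
  | zero => simp [rep, den, rat]
  | succ n ih =>
    have h := rat_mem hg.one_le ht ht1
    have h1 := den_mul_eq hg.one_le ht hy hy1
    rw [hfix] at h1
    rw [rep_succ, den_append, rat_append, mul_assoc, ih h.1 h.2, ← mul_assoc, h1]
    ring

lemma rat_near_of_even {w : List ℕ} (hw : ∀ a ∈ w, 1 ≤ a) (he : Even w.length) {t t' : ℝ}
    (ht : 0 ≤ t) (ht' : 0 ≤ t') :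
    |rat t w - rat t' w| ≤ (1 / 2) ^ w.length * |t - t'| := by
  match w with
  | [] => simp [rat]
  | [a] => simp at he
  | a :: b :: w =>
    have ha : 1 ≤ a := hw a (by simp)
    have hb : 1 ≤ b := hw b (by simp)
    have h1 := rat_contract ht ht' ha hb
    have e : ∀ s : ℝ, rat s (a :: b :: w) = rat (rat s [a, b]) w := fun s => rfl
    have p : ∀ s : ℝ, 0 ≤ s → 0 ≤ rat s [a, b] := fun s hs => by
      simp only [rat]; positivity
    have h2 := rat_near_of_even (w := w) (fun c hc => hw c (by simp [hc]))
      (by simpa [Nat.even_add_one] using he) (p t ht) (p t' ht')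
    rw [e, e]
    refine h2.trans ?_
    calc (1 / 2 : ℝ) ^ w.length * |rat t [a, b] - rat t' [a, b]|
        ≤ (1 / 2) ^ w.length * ((1 / 4) * |t - t'|) := by gcongr
      _ = _ := by simp only [List.length_cons]; ring

lemma rat_rep_near {g : List ℕ} (hg : Good g) (hne : g ≠ []) {θ : ℝ} (hθ : 0 ≤ θ) (hθ1 : θ ≤ 1)
    (hfix : rat θ g = θ) (n : ℕ) {t : ℝ} (ht : 0 ≤ t) (ht1 : t ≤ 1) :
    |rat t (rep g n) - θ| ≤ (1 / 2) ^ n := by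
  have hθn : ∀ n, rat θ (rep g n) = θ := fun n => by
    induction n with
    | zero => rfl
    | succ n ih => rw [rep_succ, rat_append, hfix, ih]
  have hl : n ≤ (rep g n).length := by
    have := List.length_pos_iff.2 hne
    simp only [rep, List.length_flatten, List.map_replicate, List.sum_replicate, smul_eq_mul]
    nlinarith
  have h := rat_near_of_even (good_rep hg n).one_le (good_rep hg n).2.1 ht hθ
  rw [hθn] at h
  refine h.trans ?_
  calc (1 / 2 : ℝ) ^ (rep g n).length * |t - θ| ≤ (1 / 2) ^ n * 1 := by
        gcongr ?_ * ?_
        · exact pow_le_pow_of_le_one (by norm_num) (by norm_num) hl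
        · rw [abs_le]; constructor <;> linarith
    _ = _ := mul_one _

lemma abs_mul_sq_sub_le {t ε E P Q : ℝ} (ht : |t| ≤ 2) (hε : ε ≤ 1)
    (hE : |E - 1| ≤ ε) (hP : |P - 1| ≤ ε) (hQ : |Q - 1| ≤ ε) :
    |t * (E * P * Q) ^ 2 - t| ≤ 126 * ε := by
  have hε0 : 0 ≤ ε := (abs_nonneg _).trans hE
  have step : ∀ {X Y δ : ℝ}, |X - 1| ≤ δ → |Y - 1| ≤ ε → |X * Y - 1| ≤ 2 * δ + ε := by
    intro X Y δ hX hY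
    have e : X * Y - 1 = (X - 1) * Y + (Y - 1) := by ring
    have hY2 : |Y| ≤ 2 := by
      rw [abs_le] at hY ⊢; constructor <;> linarith
    have hδ := (abs_nonneg (X - 1)).trans hX
    calc |X * Y - 1| ≤ |X - 1| * |Y| + |Y - 1| := by
          rw [e, ← abs_mul]; exact abs_add_le _ _
      _ ≤ δ * 2 + ε := by gcongr
      _ = _ := by ring
  have h6 := step (step (step (step (step hE hP) hQ) hE) hP) hQ
  have e : t * (E * P * Q) ^ 2 - t = t * (E * P * Q * E * P * Q - 1) := by ring
  rw [e, abs_mul]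
  calc |t| * |E * P * Q * E * P * Q - 1|
      ≤ 2 * (2 * (2 * (2 * (2 * (2 * ε + ε) + ε) + ε) + ε) + ε) :=
        by gcongr
    _ = _ := by ring

lemma abs_div_sub_one_le {y r θ ε : ℝ} (hy : 0 ≤ y) (hy1 : y ≤ 1) (hr : 0 ≤ r)
    (h : |r - θ| ≤ ε) : |(1 + θ * y) / (1 + r * y) - 1| ≤ ε := by
  have hpos : 1 ≤ 1 + r * y := by nlinarith [mul_nonneg hr hy]
  have e : (1 + θ * y) / (1 + r * y) - 1 = -((r - θ) * y) / (1 + r * y) := by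
    have : 1 + r * y ≠ 0 := by positivity
    field_simp; ring
  rw [e, abs_div, abs_neg, abs_mul, abs_of_nonneg hy, abs_of_pos (a := 1 + r * y) (by linarith),
    div_le_iff₀ (by linarith)]
  have := abs_nonneg (r - θ)
  nlinarith

lemma one_add_mul_mem {t y : ℝ} (ht : 0 ≤ t) (ht1 : t ≤ 1) (hy : 0 ≤ y) (hy1 : y ≤ 1) :
    1 ≤ 1 + t * y ∧ 1 + t * y ≤ 2 :=
  ⟨by nlinarith [mul_nonneg ht hy], by nlinarith [mul_le_one₀ ht1 hy hy1]⟩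

/-- Two words with incommensurable growth rates allow to prescribe the ratio of two
denominators, by appending words of bounded size. -/
lemma exists_steering_of {g h : List ℕ} (hg : Good g) (hh : Good h) (hg0 : g ≠ []) (hh0 : h ≠ [])
    {θ₁ θ₂ y₁ y₂ : ℝ} (hθ₁ : 0 ≤ θ₁ ∧ θ₁ ≤ 1) (hθ₂ : 0 ≤ θ₂ ∧ θ₂ ≤ 1) (hy₁ : 0 ≤ y₁ ∧ y₁ ≤ 1)
    (hy₂ : 0 ≤ y₂ ∧ y₂ ≤ 1) (fθ₁ : rat θ₁ g = θ₁) (fθ₂ : rat θ₂ h = θ₂) (fy₁ : app g y₁ = y₁)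
    (fy₂ : app h y₂ = y₂) {J K : ℝ} (hJ : den 0 g * (1 + rat 0 g * y₁) = J)
    (hK : den 0 h * (1 + rat 0 h * y₂) = K) (hJ1 : 1 < J) (hK1 : 1 < K)
    (hirr : Irrational (Real.log J / Real.log K)) {D δ : ℝ} (hD : 0 < D) (hδ : 0 < δ) :
    ∃ U : ℝ, 1 ≤ U ∧ ∀ t : ℝ, 1 ≤ t → t ≤ 2 → ∀ w w' : List ℕ,
      (∀ a ∈ w, 1 ≤ a) → (∀ a ∈ w', 1 ≤ a) →
      den 0 w ≤ D * den 0 w' → den 0 w' ≤ D * den 0 w → ∃ u u' : List ℕ, Good u ∧ Good u' ∧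
      den 0 u ≤ U ∧ den 0 u' ≤ U ∧ |(den 0 (w ++ u) / den 0 (w' ++ u')) ^ 2 - t| ≤ δ ∧
      |rat 0 (w ++ u) - θ₁| ≤ δ ∧ |rat 0 (w' ++ u') - θ₂| ≤ δ := by
  obtain ⟨ε, hε0, hε1, hεδ⟩ : ∃ ε : ℝ, 0 < ε ∧ ε ≤ 1 ∧ 126 * ε ≤ δ :=
    ⟨min 1 (δ / 126), by positivity, min_le_left _ _, by
      linarith [min_le_right 1 (δ / 126)]⟩
  obtain ⟨m, hm⟩ := exists_pow_lt_of_lt_one hε0 (show (1 / 2 : ℝ) < 1 by norm_num)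
  obtain ⟨M, hM⟩ := exists_bounded_combination (Real.log (8 * D)) (Real.log_pos hJ1)
    (Real.log_pos hK1) hirr (half_pos hε0) m
  have hden : ∀ {g : List ℕ} {y J : ℝ}, Good g → 0 ≤ y ∧ y ≤ 1 → app g y = y →
      den 0 g * (1 + rat 0 g * y) = J → 1 < J → ∀ n ≤ M, den 0 (rep g n) ≤ J ^ M := by
    intro g y J hg hy hf hJ hJ1 n hn
    have h := den_rep hg hy.1 hy.2 hf n le_rfl zero_le_one
    rw [hJ, zero_mul, add_zero, one_mul] at h
    have h1 := rat_mem (good_rep hg n).one_le le_rfl zero_le_one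
    have h2 := one_add_mul_mem h1.1 h1.2 hy.1 hy.2
    have h3 := one_le_den (good_rep hg n).one_le le_rfl
    have h4 : J ^ n ≤ J ^ M := pow_le_pow_right₀ hJ1.le hn
    nlinarith
  refine ⟨max (J ^ M) (K ^ M), le_max_of_le_left (one_le_pow₀ hJ1.le),
    fun t ht1 ht2 w w' hw hw' hD1 hD2 => ?_⟩
  have ps := rat_mem hw le_rfl zero_le_one
  have ps' := rat_mem hw' le_rfl zero_le_one
  have pd := one_le_den hw le_rfl
  have pd' := one_le_den hw' le_rfl
  set s := rat 0 w
  set s' := rat 0 w'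
  set d := den 0 w
  set d' := den 0 w'
  have b1 := one_add_mul_mem ps.1 ps.2 hy₁.1 hy₁.2
  have b2 := one_add_mul_mem hθ₁.1 hθ₁.2 hy₁.1 hy₁.2
  have b3 := one_add_mul_mem ps'.1 ps'.2 hy₂.1 hy₂.2
  have b4 := one_add_mul_mem hθ₂.1 hθ₂.2 hy₂.1 hy₂.2
  set B₁ := 1 + s * y₁
  set B₂ := 1 + θ₁ * y₁
  set B₃ := 1 + s' * y₂
  set B₄ := 1 + θ₂ * y₂
  have q1 : 1 ≤ √t := Real.one_le_sqrt.2 ht1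
  have q2 : √t ≤ 2 := by
    rw [Real.sqrt_le_left (by norm_num)]; linarith
  have qs : √t ^ 2 = t := Real.sq_sqrt (by linarith)
  obtain ⟨p1, p2, p3, p4⟩ : 0 < B₁ ∧ 0 < B₂ ∧ 0 < B₃ ∧ 0 < B₄ :=
    ⟨by linarith, by linarith, by linarith, by linarith⟩
  obtain ⟨p5, p6, p7⟩ : 0 < d ∧ 0 < d' ∧ 0 < √t := ⟨by linarith, by linarith, by linarith⟩
  set Z := √t * (d' * B₃ * B₂) / (d * B₁ * B₄) with hZ
  have hZpos : 0 < Z := by positivity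
  have hZ1 : Z ≤ 8 * D := by
    rw [hZ, div_le_iff₀ (by positivity)]
    calc √t * (d' * B₃ * B₂) ≤ 2 * ((D * d) * 2 * 2) := by
          gcongr
          exacts [b3.2, b2.2]
      _ = 8 * D * (d * 1 * 1) := by ring
      _ ≤ 8 * D * (d * B₁ * B₄) := by
          gcongr
          exacts [b1.1, b4.1]
  have hZ2 : 1 ≤ 8 * D * Z := by
    rw [hZ, mul_div_assoc', one_le_div (by positivity)]
    calc d * B₁ * B₄ ≤ (D * d') * 2 * 2 := by
          gcongr
          exacts [b1.2, b4.2]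
      _ ≤ 8 * D * (1 * (d' * 1 * 1)) := by nlinarith [mul_pos hD p6]
      _ ≤ 8 * D * (√t * (d' * B₃ * B₂)) := by
          gcongr
          exacts [b3.1, b2.1]
  have hlog : |Real.log Z| ≤ Real.log (8 * D) := by
    rw [abs_le]
    constructor
    · rw [neg_le_iff_add_nonneg, add_comm, ← Real.log_mul (by positivity) (by positivity)]
      exact Real.log_nonneg hZ2
    · exact Real.log_le_log hZpos hZ1
  obtain ⟨a, b, ha, haM, hb, hbM, hab⟩ := hM _ hlog
  have r1 := rat_rep_near hg hg0 hθ₁.1 hθ₁.2 fθ₁ a ps.1 ps.2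
  have r2 := rat_rep_near hh hh0 hθ₂.1 hθ₂.2 fθ₂ b ps'.1 ps'.2
  have hpow : ∀ n, m ≤ n → (1 / 2 : ℝ) ^ n ≤ ε := fun n hn =>
    (pow_le_pow_of_le_one (by norm_num) (by norm_num) hn).trans hm.le
  replace r1 := r1.trans (hpow a ha)
  replace r2 := r2.trans (hpow b hb)
  have c1 := rat_mem (good_rep hg a).one_le ps.1 ps.2
  have c2 := rat_mem (good_rep hh b).one_le ps'.1 ps'.2
  have e1 := den_rep hg hy₁.1 hy₁.2 fy₁ a ps.1 ps.2
  have e2 := den_rep hh hy₂.1 hy₂.2 fy₂ b ps'.1 ps'.2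
  rw [hJ] at e1
  rw [hK] at e2
  have k1 := one_add_mul_mem c1.1 c1.2 hy₁.1 hy₁.2
  have k2 := one_add_mul_mem c2.1 c2.2 hy₂.1 hy₂.2
  have hP : |B₂ / (1 + rat s (rep g a) * y₁) - 1| ≤ ε := abs_div_sub_one_le hy₁.1 hy₁.2 c1.1 r1
  have hQ : |(1 + rat s' (rep h b) * y₂) / B₄ - 1| ≤ ε := by
    refine abs_div_sub_one_le hy₂.1 hy₂.2 hθ₂.1 ?_
    rwa [abs_sub_comm]
  have hE : |J ^ a / (K ^ b * Z) - 1| ≤ ε := by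
    have ex : J ^ a / (K ^ b * Z) = Real.exp (a * Real.log J - b * Real.log K - Real.log Z) := by
      rw [Real.exp_sub, Real.exp_sub, Real.exp_log hZpos, mul_comm (a : ℝ), mul_comm (b : ℝ),
        Real.exp_mul, Real.exp_mul, Real.exp_log (by linarith), Real.exp_log (by linarith),
        Real.rpow_natCast, Real.rpow_natCast, div_div]
    rw [ex]
    have := Real.abs_exp_sub_one_le
      (x := a * Real.log J - b * Real.log K - Real.log Z) (by linarith)
    linarith
  have key := abs_mul_sq_sub_le (t := t) (by rw [abs_of_pos] <;> linarith) hε1 hE hP hQ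
  refine ⟨rep g a, rep h b, good_rep hg a, good_rep hh b,
    (hden hg hy₁ fy₁ hJ hJ1 a haM).trans (le_max_left _ _),
    (hden hh hy₂ fy₂ hK hK1 b hbM).trans (le_max_right _ _), ?_, ?_, ?_⟩
  · refine le_trans (le_of_eq ?_) (key.trans hεδ)
    congr 2
    rw [← qs, ← mul_pow]
    congr 1
    rw [den_append, den_append]
    have f1 : den s (rep g a) = B₁ * J ^ a / (1 + rat s (rep g a) * y₁) := by
      rw [eq_div_iff (by linarith), e1]
    have f2 : den s' (rep h b) = B₃ * K ^ b / (1 + rat s' (rep h b) * y₂) := by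
      rw [eq_div_iff (by linarith), e2]
    have : 0 < K := by linarith
    have : 0 < 1 + rat s (rep g a) * y₁ := by linarith
    have : 0 < 1 + rat s' (rep h b) * y₂ := by linarith
    change d * den s (rep g a) / (d' * den s' (rep h b)) = _
    rw [f1, f2, hZ]
    field_simp
  · rw [rat_append]
    linarith
  · rw [rat_append]
    linarith

lemma exists_steering : ∃ θ₁ θ₂ : ℝ, (0 ≤ θ₁ ∧ θ₁ ≤ 1) ∧ (0 ≤ θ₂ ∧ θ₂ ≤ 1) ∧
    ∀ D δ : ℝ, 0 < D → 0 < δ →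
    ∃ U : ℝ, 1 ≤ U ∧ ∀ t : ℝ, 1 ≤ t → t ≤ 2 → ∀ w w' : List ℕ,
      (∀ a ∈ w, 1 ≤ a) → (∀ a ∈ w', 1 ≤ a) →
      den 0 w ≤ D * den 0 w' → den 0 w' ≤ D * den 0 w → ∃ u u' : List ℕ, Good u ∧ Good u' ∧
      den 0 u ≤ U ∧ den 0 u' ≤ U ∧ |(den 0 (w ++ u) / den 0 (w' ++ u')) ^ 2 - t| ≤ δ ∧
      |rat 0 (w ++ u) - θ₁| ≤ δ ∧ |rat 0 (w' ++ u') - θ₂| ≤ δ := by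
  have q5 := Real.mul_self_sqrt (show (0 : ℝ) ≤ 5 by norm_num)
  have q42 := Real.mul_self_sqrt (show (0 : ℝ) ≤ 42 by norm_num)
  have a5 : 2 < √(5 : ℝ) := by rw [Real.lt_sqrt] <;> norm_num
  have b5 : √(5 : ℝ) < 3 := by rw [Real.sqrt_lt'] <;> norm_num
  have a42 : 6 < √(42 : ℝ) := by rw [Real.lt_sqrt] <;> norm_num
  have b42 : √(42 : ℝ) < 7 := by rw [Real.sqrt_lt'] <;> norm_num
  refine ⟨(√5 - 1) / 2, (√42 - 4) / 4, ⟨by linarith, by linarith⟩, ⟨by linarith, by linarith⟩,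
    fun D δ hD hδ => exists_steering_of (g := [1, 1]) (h := [2, 1, 1, 1, 1, 1])
      (y₁ := (√5 - 1) / 2) (y₂ := (2 * √42 - 8) / 13) (J := (3 + √5) / 2) (K := 13 + 2 * √42)
      good_one_one good_two_ones (by simp) (by simp) ⟨by linarith, by linarith⟩
      ⟨by linarith, by linarith⟩ ⟨by linarith, by linarith⟩ ⟨by linarith, by linarith⟩
      ?_ ?_ ?_ ?_ ?_ ?_ (by linarith) (by linarith) irrational_log_ratio hD hδ⟩
  · have : (√5 - 1) / 2 = 1 / (1 + (√5 - 1) / 2) := by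
      rw [eq_div_iff (ne_of_gt (by linarith))]; linear_combination q5 / 4
    simp only [rat, Nat.cast_one]
    rw [← this, ← this]
  · have : 2 + (√42 - 4) / 4 = (√42 + 4) / 4 := by ring
    simp only [rat, Nat.cast_one, Nat.cast_ofNat, this]
    field_simp
    linear_combination -8 * q42
  · have : (√5 - 1) / 2 = 1 / (1 + (√5 - 1) / 2) := by
      rw [eq_div_iff (ne_of_gt (by linarith))]; linear_combination q5 / 4
    simp only [app_cons, app_nil, Nat.cast_one]
    rw [← this, ← this]
  · have : 1 + (2 * √42 - 8) / 13 = (2 * √42 + 5) / 13 := by ring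
    simp only [app_cons, app_nil, Nat.cast_one, Nat.cast_ofNat, this]
    field_simp
    linear_combination -52 * q42
  · simp only [rat, den]; norm_num; ring
  · simp only [rat, den]; norm_num; ring

open scoped NNReal ENNReal

lemma good_core : Good coreRight ∧ Good coreLeft :=
  ⟨⟨core_letters.1, by decide, core_run.1⟩, ⟨core_letters.2, by decide, core_run.2⟩⟩

lemma abs_mob_sub_sub_le {r θ x x' δ : ℝ} (hr : 0 ≤ r ∧ r ≤ 1) (hθ : 0 ≤ θ ∧ θ ≤ 1)
    (h : |r - θ| ≤ δ) (hx : 0 ≤ x ∧ x ≤ 1) (hx' : 0 ≤ x' ∧ x' ≤ 1) :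
    |(mob r x - mob r x') - (mob θ x - mob θ x')| ≤ 4 * δ * |x - x'| := by
  have p1 := one_add_mul_mem hr.1 hr.2 hx.1 hx.2
  have p2 := one_add_mul_mem hr.1 hr.2 hx'.1 hx'.2
  have p3 := one_add_mul_mem hθ.1 hθ.2 hx.1 hx.2
  have p4 := one_add_mul_mem hθ.1 hθ.2 hx'.1 hx'.2
  have hP : 1 ≤ (1 + r * x) * (1 + r * x') * ((1 + θ * x) * (1 + θ * x')) :=
    one_le_mul_of_one_le_of_one_le (one_le_mul_of_one_le_of_one_le p1.1 p2.1)
      (one_le_mul_of_one_le_of_one_le p3.1 p4.1)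
  have hxx := mul_le_one₀ hx.2 hx'.1 hx'.2
  have hxx0 := mul_nonneg hx.1 hx'.1
  have hS : 0 ≤ x + x' + (θ + r) * (x * x') ∧ x + x' + (θ + r) * (x * x') ≤ 4 := by
    constructor
    · have := mul_nonneg (add_nonneg hθ.1 hr.1) hxx0
      linarith [hx.1, hx'.1]
    · nlinarith [hx.2, hx'.2, hθ.2, hr.2, hθ.1, hr.1]
  have e : (mob r x - mob r x') - (mob θ x - mob θ x') =
      (x - x') * (-(r - θ) * (x + x' + (θ + r) * (x * x'))) /
        ((1 + r * x) * (1 + r * x') * ((1 + θ * x) * (1 + θ * x'))) := by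
    rw [mob_sub hr.1 hx.1 hx'.1, mob_sub hθ.1 hx.1 hx'.1]
    rw [div_sub_div _ _ (by nlinarith) (by nlinarith)]
    congr 1
    ring
  rw [e, abs_div, abs_of_pos (lt_of_lt_of_le one_pos hP), abs_mul, abs_mul, abs_neg,
    abs_of_nonneg hS.1]
  have hδ := (abs_nonneg (r - θ)).trans h
  calc _ ≤ |x - x'| * (|r - θ| * (x + x' + (θ + r) * (x * x'))) := div_le_self
        (mul_nonneg (abs_nonneg _) (mul_nonneg (abs_nonneg _) hS.1)) hP
    _ ≤ |x - x'| * (δ * 4) := by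
        gcongr
        exacts [hS.1, hS.2]
    _ = _ := by ring

/-- The sums of two branches inherit the separation of the model family. -/
lemma branch_separation {V V' : List ℕ} (hV : Good V) (hV' : Good V') {θ₁ θ₂ t δ τ E : ℝ}
    (hθ₁ : 0 ≤ θ₁ ∧ θ₁ ≤ 1) (hθ₂ : 0 ≤ θ₂ ∧ θ₂ ≤ 1) (ht1 : 1 ≤ t) (ht2 : t ≤ 2)
    (hδ : 13 * δ ≤ τ) (hR : |(den 0 V / den 0 V') ^ 2 - t| ≤ δ)
    (hr : |rat 0 V - θ₁| ≤ δ) (hr' : |rat 0 V' - θ₂| ≤ δ) {x z x' z' : ℝ} (hx : 0 ≤ x ∧ x ≤ 1)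
    (hz : 0 ≤ z ∧ z ≤ 1) (hx' : 0 ≤ x' ∧ x' ≤ 1) (hz' : 0 ≤ z' ∧ z' ≤ 1) (h1 : |x - z| ≤ E)
    (h2 : |x' - z'| ≤ E)
    (h : 2 * (E * τ) ≤ |mob θ₁ x - mob θ₁ z + t * (mob θ₂ x' - mob θ₂ z')|) :
    E * τ / den 0 V ^ 2 ≤ |app V x + app V' x' - (app V z + app V' z')| := by
  have hE : 0 ≤ E := (abs_nonneg _).trans h1
  have hδ0 : 0 ≤ δ := (abs_nonneg _).trans hr
  have d1 := one_le_den hV.one_le le_rfl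
  have d2 := one_le_den hV'.one_le le_rfl
  have q1 := rat_mem hV.one_le le_rfl zero_le_one
  have q2 := rat_mem hV'.one_le le_rfl zero_le_one
  have key : ∀ {W : List ℕ}, Good W → ∀ {y y' : ℝ}, 0 ≤ y ∧ y ≤ 1 → 0 ≤ y' ∧ y' ≤ 1 →
      app W y - app W y' = (mob (rat 0 W) y - mob (rat 0 W) y') / den 0 W ^ 2 := by
    intro W hW y y' hy hy'
    have q := rat_mem hW.one_le le_rfl zero_le_one
    rw [app_sub hW.one_le hy.1 hy.2 hy'.1 hy'.2, hW.2.1.neg_one_pow, one_mul,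
      mob_sub q.1 hy.1 hy'.1, div_div, mul_comm (den 0 W ^ 2)]
  have e : app V x + app V' x' - (app V z + app V' z') =
      (mob (rat 0 V) x - mob (rat 0 V) z + (den 0 V / den 0 V') ^ 2 *
        (mob (rat 0 V') x' - mob (rat 0 V') z')) / den 0 V ^ 2 := by
    rw [show app V x + app V' x' - (app V z + app V' z') =
      (app V x - app V z) + (app V' x' - app V' z') by ring, key hV hx hz, key hV' hx' hz']
    have : den 0 V ≠ 0 := by positivity
    have : den 0 V' ≠ 0 := by positivity
    field_simp
  rw [e, abs_div, abs_of_pos (a := den 0 V ^ 2) (by positivity)]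
  gcongr
  have a1 := abs_mob_sub_sub_le q1 hθ₁ hr hx hz
  have a2 := abs_mob_sub_sub_le q2 hθ₂ hr' hx' hz'
  have a3 := (abs_mob_sub q2.1 q2.2 hx'.1 hx'.2 hz'.1 hz'.2).2
  set A := mob (rat 0 V) x - mob (rat 0 V) z
  set B := mob (rat 0 V') x' - mob (rat 0 V') z'
  set A' := mob θ₁ x - mob θ₁ z
  set B' := mob θ₂ x' - mob θ₂ z'
  set R := (den 0 V / den 0 V') ^ 2
  have b1 : |A - A'| ≤ 4 * δ * E := a1.trans (by gcongr)
  have b2 : |B - B'| ≤ 4 * δ * E := a2.trans (by gcongr)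
  have b3 : |B| ≤ E := a3.trans h2
  have b4 : |(R - t) * B| ≤ δ * E := by rw [abs_mul]; gcongr
  have b5 : |t * (B - B')| ≤ 2 * (4 * δ * E) := by
    rw [abs_mul, abs_of_pos (a := t) (by linarith)]; gcongr
  have b6 : |A' + t * B'| ≤ |A + R * B| + (|A - A'| + |(R - t) * B| + |t * (B - B')|) := by
    have : A' + t * B' = A + R * B - (A - A') - (R - t) * B - t * (B - B') := by ring
    rw [this]
    have c1 := abs_sub (A + R * B - (A - A') - (R - t) * B) (t * (B - B'))
    have c2 := abs_sub (A + R * B - (A - A')) ((R - t) * B)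
    have c3 := abs_sub (A + R * B) (A - A')
    linarith
  nlinarith

lemma exists_limit_word {p : ℕ → List ℕ} (hp : ∀ i, ∃ v, v ≠ [] ∧ p (i + 1) = p i ++ v) :
    ∃ x : ℕ → ℕ, (∀ i, pre x (p i).length = p i) ∧ ∀ i, i ≤ (p i).length := by
  have hlen : ∀ i, i ≤ (p i).length := fun i => by
    induction i with
    | zero => exact Nat.zero_le _
    | succ i ih =>
      obtain ⟨v, hv, h⟩ := hp i
      have := List.length_pos_iff.2 hv
      rw [h, List.length_append]; omega
  have hpre : ∀ i j, i ≤ j → p i <+: p j := fun i j hij => by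
    induction j, hij using Nat.le_induction with
    | base => exact List.prefix_rfl
    | succ j _ ih =>
      obtain ⟨v, _, h⟩ := hp j
      exact ih.trans ⟨v, h.symm⟩
  refine ⟨fun n => (p (n + 1)).getD n 0, fun i => ?_, hlen⟩
  refine List.ext_getElem (by simp) fun n hn hn' => ?_
  have hn1 : n < (p (n + 1)).length := hlen (n + 1)
  rw [getElem_pre, List.getD_eq_getElem _ _ hn1]
  rcases le_total i (n + 1) with h | h
  · exact ((hpre _ _ h).getElem hn').symm
  · exact (hpre _ _ h).getElem hn1

lemma den_append_le {v v' u u' : List ℕ} (hv : ∀ a ∈ v, 1 ≤ a) (hv' : ∀ a ∈ v', 1 ≤ a)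
    (hu : ∀ a ∈ u, 1 ≤ a) (hu' : ∀ a ∈ u', 1 ≤ a) {S : ℝ}
    (h : den 0 v ^ 2 ≤ 3 * den 0 v' ^ 2) (h1 : den 0 u ^ 2 ≤ 676 * S) (h2 : S ≤ den 0 u' ^ 2) :
    den 0 (v ++ u) ≤ 100 * den 0 (v' ++ u') := by
  have a1 := (den_append_bounds hv hu).2
  have a2 := (den_append_bounds hv' hu').1
  have p1 := one_le_den hv le_rfl
  have p2 := one_le_den hu le_rfl
  have p3 := one_le_den hv' le_rfl
  have p4 := one_le_den hu' le_rfl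
  refine a1.trans (le_trans ?_ (mul_le_mul_of_nonneg_left a2 (by norm_num)))
  refine le_of_sq_le_sq ?_ (by positivity)
  calc (2 * (den 0 v * den 0 u)) ^ 2 = 4 * (den 0 v ^ 2 * den 0 u ^ 2) := by ring
    _ ≤ 4 * ((3 * den 0 v' ^ 2) * (676 * den 0 u' ^ 2)) := by gcongr; linarith
    _ ≤ (100 * (den 0 v' * den 0 u')) ^ 2 := by
      have := sq_nonneg (den 0 v' * den 0 u')
      nlinarith

/-- The orbit of `s` under the maps `f · (ζ 0)`, `f · (ζ 1)`, …. -/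
def orbit {α β : Type*} (f : β → α → β) (s : β) (ζ : ℕ → α) : ℕ → β
  | 0 => s
  | i + 1 => f (orbit f s ζ i) (ζ i)

lemma orbit_congr {α β : Type*} (f : β → α → β) (s : β) {ζ ζ' : ℕ → α} {i : ℕ}
    (h : ∀ j < i, ζ j = ζ' j) : orbit f s ζ i = orbit f s ζ' i := by
  induction i with
  | zero => rfl
  | succ i ih => rw [orbit, orbit, ih fun j hj => h j (by omega), h i (by omega)]

lemma exists_coded_word {p : ℕ → List ℕ} (hp : ∀ i, Good (p i))
    (hstep : ∀ i, ∃ v, v ≠ [] ∧ p (i + 1) = p i ++ v) :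
    ∃ x : ℕ → ℕ, Alive innerTable.step innerTable.N 0 x ∧ ∀ i, ∃ z : ℝ, 0 ≤ z ∧ z ≤ 1 ∧
      cf01 x = app (p i) z := by
  obtain ⟨x, hx, hlen⟩ := exists_limit_word hstep
  have hx12 : ∀ n, x n = 1 ∨ x n = 2 := fun n => by
    have hn := hlen (n + 1)
    have := getElem_pre x (p (n + 1)).length n (by rw [length_pre]; omega)
    rw [← this]
    have hmem := List.getElem_mem (l := pre x (p (n + 1)).length) (n := n)
      (by rw [length_pre]; omega)
    have hsub : ∀ a ∈ pre x (p (n + 1)).length, a ∈ p (n + 1) := by rw [hx]; exact fun _ h => h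
    exact (hp (n + 1)).1 _ (hsub _ hmem)
  have hx1 : ∀ n, 1 ≤ x n := fun n => by rcases hx12 n with h | h <;> omega
  refine ⟨x, alive_of_frequently hx12 fun n => ⟨(p n).length, hlen n, ?_⟩, fun i => ?_⟩
  · rw [hx, (hp n).2.2]; decide +kernel
  · have h := cf01_mem (a := fun j => x (j + (p i).length)) fun j => hx1 _
    exact ⟨_, h.1.le, h.2, by rw [cf01_eq_app hx1 (p i).length, hx]⟩

lemma exists_coding {b : ℕ} {m m' : Fin b → List ℕ} {S U D δ t θ₁ θ₂ : ℝ} (hS : 1 < S)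
    (hU : 1 ≤ U) (hD : D = 100 * (den 0 coreRight * den 0 coreLeft)) (ht1 : 1 ≤ t) (ht2 : t ≤ 2)
    (hδ : δ ≤ 1 / 2) (hm : ∀ i, Good (m i) ∧ S ≤ den 0 (m i) ^ 2 ∧ den 0 (m i) ^ 2 ≤ 676 * S)
    (hm' : ∀ i, Good (m' i) ∧ S ≤ den 0 (m' i) ^ 2 ∧ den 0 (m' i) ^ 2 ≤ 676 * S)
    (hsteer : ∀ w w' : List ℕ, (∀ a ∈ w, 1 ≤ a) → (∀ a ∈ w', 1 ≤ a) →
      den 0 w ≤ D * den 0 w' → den 0 w' ≤ D * den 0 w → ∃ u u' : List ℕ, Good u ∧ Good u' ∧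
      den 0 u ≤ U ∧ den 0 u' ≤ U ∧ |(den 0 (w ++ u) / den 0 (w' ++ u')) ^ 2 - t| ≤ δ ∧
      |rat 0 (w ++ u) - θ₁| ≤ δ ∧ |rat 0 (w' ++ u') - θ₂| ≤ δ) :
    ∃ (x y : (ℕ → Fin b) → ℕ → ℕ) (V V' : (ℕ → Fin b) → ℕ → List ℕ),
      (∀ ζ, Alive innerTable.step innerTable.N 0 (x ζ) ∧
        Alive innerTable.step innerTable.N 0 (y ζ)) ∧
      (∀ ζ ζ' i, (∀ j < i, ζ j = ζ' j) → V ζ i = V ζ' i ∧ V' ζ i = V' ζ' i) ∧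
      ∀ ζ i, Good (V ζ i) ∧ Good (V' ζ i) ∧ |(den 0 (V ζ i) / den 0 (V' ζ i)) ^ 2 - t| ≤ δ ∧
        |rat 0 (V ζ i) - θ₁| ≤ δ ∧ |rat 0 (V' ζ i) - θ₂| ≤ δ ∧
        den 0 (V ζ i) ^ 2 ≤ 4 * U ^ 2 * den 0 coreRight ^ 2 * ((104 * U) ^ 2 * S) ^ i ∧
        (∃ z : ℝ, 0 ≤ z ∧ z ≤ 1 ∧
          app coreRight (cf01 (x ζ)) = app (V ζ i) (app (m (ζ i)) z)) ∧
        ∃ z : ℝ, 0 ≤ z ∧ z ≤ 1 ∧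
          app coreLeft (cf01 (y ζ)) = app (V' ζ i) (app (m' (ζ i)) z) := by
  have hex : ∀ w w' : List ℕ, ∃ u u' : List ℕ, (∀ a ∈ w, 1 ≤ a) → (∀ a ∈ w', 1 ≤ a) →
      den 0 w ≤ D * den 0 w' → den 0 w' ≤ D * den 0 w → Good u ∧ Good u' ∧
      den 0 u ≤ U ∧ den 0 u' ≤ U ∧ |(den 0 (w ++ u) / den 0 (w' ++ u')) ^ 2 - t| ≤ δ ∧
      |rat 0 (w ++ u) - θ₁| ≤ δ ∧ |rat 0 (w' ++ u') - θ₂| ≤ δ := by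
    intro w w'
    by_cases h : ((∀ a ∈ w, 1 ≤ a) ∧ ∀ a ∈ w', 1 ≤ a) ∧ den 0 w ≤ D * den 0 w' ∧
        den 0 w' ≤ D * den 0 w
    · obtain ⟨u, u', h'⟩ := hsteer w w' h.1.1 h.1.2 h.2.1 h.2.2
      exact ⟨u, u', fun _ _ _ _ => h'⟩
    · exact ⟨[], [], fun h1 h2 h3 h4 => absurd ⟨⟨h1, h2⟩, h3, h4⟩ h⟩
  choose u u' hu using hex
  let st := orbit (fun (s : List ℕ × List ℕ) (i : Fin b) =>
    (s.1 ++ u (coreRight ++ s.1) (coreLeft ++ s.2) ++ m i,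
      s.2 ++ u' (coreRight ++ s.1) (coreLeft ++ s.2) ++ m' i)) ([], [])
  let V : (ℕ → Fin b) → ℕ → List ℕ := fun ζ i =>
    coreRight ++ (st ζ i).1 ++ u (coreRight ++ (st ζ i).1) (coreLeft ++ (st ζ i).2)
  let V' : (ℕ → Fin b) → ℕ → List ℕ := fun ζ i =>
    coreLeft ++ (st ζ i).2 ++ u' (coreRight ++ (st ζ i).1) (coreLeft ++ (st ζ i).2)
  have c1 := one_le_den good_core.1.one_le le_rfl
  have c2 := one_le_den good_core.2.one_le le_rfl
  have hD100 : 100 ≤ D := by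
    rw [hD]; nlinarith
  have hV : ∀ ζ i, coreRight ++ (st ζ (i + 1)).1 = V ζ i ++ m (ζ i) := fun ζ i => by
    simp only [st, V, orbit, List.append_assoc]
  have hV' : ∀ ζ i, coreLeft ++ (st ζ (i + 1)).2 = V' ζ i ++ m' (ζ i) := fun ζ i => by
    simp only [st, V', orbit, List.append_assoc]
  have inv : ∀ ζ i, Good (st ζ i).1 ∧ Good (st ζ i).2 ∧
      den 0 (coreRight ++ (st ζ i).1) ≤ D * den 0 (coreLeft ++ (st ζ i).2) ∧
      den 0 (coreLeft ++ (st ζ i).2) ≤ D * den 0 (coreRight ++ (st ζ i).1) ∧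
      den 0 (coreRight ++ (st ζ i).1) ^ 2 ≤
        den 0 coreRight ^ 2 * ((104 * U) ^ 2 * S) ^ i := by
    intro ζ i
    induction i with
    | zero =>
      simp only [st, orbit, List.append_nil, pow_zero, mul_one, le_refl, and_true]
      refine ⟨good_nil, good_nil, ?_, ?_⟩
      · rw [hD]
        nlinarith [mul_le_mul c2 c2 zero_le_one (by linarith)]
      · rw [hD]
        nlinarith [mul_le_mul c1 c1 zero_le_one (by linarith)]
    | succ i ih =>
      obtain ⟨g1, g2, r1, r2, r3⟩ := ih
      have gv := good_core.1.append g1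
      have gv' := good_core.2.append g2
      obtain ⟨h1, h2, h3, h4, h5, h6, h7⟩ := hu _ _ gv.one_le gv'.one_le r1 r2
      obtain ⟨m1, m2, m3⟩ := hm (ζ i)
      obtain ⟨n1, n2, n3⟩ := hm' (ζ i)
      have GV : Good (V ζ i) := gv.append h1
      have GV' : Good (V' ζ i) := gv'.append h2
      have d1 := one_le_den GV.one_le le_rfl
      have d2 := one_le_den GV'.one_le le_rfl
      change |(den 0 (V ζ i) / den 0 (V' ζ i)) ^ 2 - t| ≤ δ at h5
      rw [abs_le, div_pow] at h5
      have q1 : den 0 (V ζ i) ^ 2 ≤ 3 * den 0 (V' ζ i) ^ 2 := by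
        rw [← div_le_iff₀ (by positivity)]; linarith
      have q2 : den 0 (V' ζ i) ^ 2 ≤ 3 * den 0 (V ζ i) ^ 2 := by
        have : 1 / 2 * den 0 (V' ζ i) ^ 2 ≤ den 0 (V ζ i) ^ 2 := by
          rw [← le_div_iff₀ (by positivity)]; linarith
        linarith [sq_nonneg (den 0 (V ζ i))]
      rw [hV, hV']
      refine ⟨(g1.append h1).append m1, (g2.append h2).append n1, ?_, ?_, ?_⟩
      · refine (den_append_le GV.one_le GV'.one_le m1.one_le n1.one_le q1 m3 n2).trans ?_
        have := one_le_den (GV'.append n1).one_le le_rfl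
        gcongr
      · refine (den_append_le GV'.one_le GV.one_le n1.one_le m1.one_le q2 n3 m2).trans ?_
        have := one_le_den (GV.append m1).one_le le_rfl
        gcongr
      · have a1 := (den_append_bounds GV.one_le m1.one_le).2
        have a2 := (den_append_bounds gv.one_le h1.one_le).2
        have a3 := one_le_den gv.one_le le_rfl
        have a4 := one_le_den m1.one_le le_rfl
        have a5 := one_le_den (GV.append m1).one_le le_rfl
        have a6 : den 0 (V ζ i) ≤ 2 * (den 0 (coreRight ++ (st ζ i).1) * U) :=
          a2.trans (by gcongr)
        calc den 0 (V ζ i ++ m (ζ i)) ^ 2 ≤ (2 * ((2 * (den 0 (coreRight ++ (st ζ i).1) * U)) *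
              den 0 (m (ζ i)))) ^ 2 := by
              gcongr
              exact a1.trans (by gcongr)
          _ = 16 * U ^ 2 * (den 0 (coreRight ++ (st ζ i).1) ^ 2 * den 0 (m (ζ i)) ^ 2) := by ring
          _ ≤ 16 * U ^ 2 * ((den 0 coreRight ^ 2 * ((104 * U) ^ 2 * S) ^ i) * (676 * S)) := by
              gcongr
          _ = _ := by ring
  have hne : ∀ {w : List ℕ}, S ≤ den 0 w ^ 2 → w ≠ [] := by
    rintro w h rfl
    simp only [den, one_pow] at h
    linarith
  have hx : ∀ ζ, ∃ x : ℕ → ℕ, Alive innerTable.step innerTable.N 0 x ∧ ∀ i, ∃ z : ℝ, 0 ≤ z ∧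
      z ≤ 1 ∧ cf01 x = app (st ζ i).1 z := fun ζ =>
    exists_coded_word (fun i => (inv ζ i).1) fun i => ⟨_, List.append_ne_nil_of_right_ne_nil _
      (hne (hm (ζ i)).2.1), List.append_assoc _ _ _⟩
  have hy : ∀ ζ, ∃ x : ℕ → ℕ, Alive innerTable.step innerTable.N 0 x ∧ ∀ i, ∃ z : ℝ, 0 ≤ z ∧
      z ≤ 1 ∧ cf01 x = app (st ζ i).2 z := fun ζ =>
    exists_coded_word (fun i => (inv ζ i).2.1) fun i => ⟨_, List.append_ne_nil_of_right_ne_nil _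
      (hne (hm' (ζ i)).2.1), List.append_assoc _ _ _⟩
  choose x hxa hx using hx
  choose y hya hy using hy
  refine ⟨x, y, V, V', fun ζ => ⟨hxa ζ, hya ζ⟩, fun ζ ζ' i h => ?_, fun ζ i => ?_⟩
  · have : st ζ i = st ζ' i := orbit_congr _ _ h
    simp only [V, V', this, and_self]
  · obtain ⟨g1, g2, r1, r2, r3⟩ := inv ζ i
    have gv := good_core.1.append g1
    have gv' := good_core.2.append g2
    obtain ⟨h1, h2, h3, h4, h5, h6, h7⟩ := hu _ _ gv.one_le gv'.one_le r1 r2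
    refine ⟨gv.append h1, gv'.append h2, h5, h6, h7, ?_, ?_, ?_⟩
    · have a2 := (den_append_bounds gv.one_le h1.one_le).2
      have a3 := one_le_den gv.one_le le_rfl
      have a5 := one_le_den (gv.append h1).one_le le_rfl
      calc den 0 (V ζ i) ^ 2 ≤ (2 * (den 0 (coreRight ++ (st ζ i).1) * U)) ^ 2 := by
            gcongr
            exact a2.trans (by gcongr)
        _ = 4 * U ^ 2 * den 0 (coreRight ++ (st ζ i).1) ^ 2 := by ring
        _ ≤ 4 * U ^ 2 * (den 0 coreRight ^ 2 * ((104 * U) ^ 2 * S) ^ i) := by gcongr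
        _ = _ := by ring
    · obtain ⟨z, z0, z1, hz⟩ := hx ζ (i + 1)
      exact ⟨z, z0, z1, by rw [hz, ← app_append, ← app_append, hV]⟩
    · obtain ⟨z, z0, z1, hz⟩ := hy ζ (i + 1)
      exact ⟨z, z0, z1, by rw [hz, ← app_append, ← app_append, hV']⟩

lemma exists_exponent {ρ C d : ℝ} (h0 : 0 < ρ) (h1 : ρ < 1) (hC : 0 < C) (hd : d < 1) :
    ∃ k : ℕ, 1 ≤ k ∧ C * ρ ^ k ≤ 1 / 2 * (ρ ^ d) ^ k := by
  have hβ0 : 0 < ρ ^ (1 - d) := Real.rpow_pos_of_pos h0 _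
  have hβ : ρ ^ (1 - d) < 1 := Real.rpow_lt_one h0.le h1 (by linarith)
  have hd0 : 0 < ρ ^ d := Real.rpow_pos_of_pos h0 _
  obtain ⟨k, hk⟩ := exists_pow_lt_of_lt_one (show 0 < 1 / (2 * C) by positivity) hβ
  refine ⟨k + 1, by omega, ?_⟩
  have e : ρ = ρ ^ (1 - d) * ρ ^ d := by
    rw [← Real.rpow_add h0, sub_add_cancel, Real.rpow_one]
  have h2 : (ρ ^ (1 - d)) ^ (k + 1) ≤ 1 / (2 * C) := by
    rw [pow_succ]
    nlinarith [pow_pos hβ0 k]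
  calc C * ρ ^ (k + 1) = C * (ρ ^ (1 - d)) ^ (k + 1) * (ρ ^ d) ^ (k + 1) := by
        nth_rewrite 1 [e]; rw [mul_pow]; ring
    _ ≤ C * (1 / (2 * C)) * (ρ ^ d) ^ (k + 1) := by gcongr
    _ = _ := by field_simp

lemma le_dimH_inner {d : ℝ≥0} (hd0 : 0 < d) (hd1 : d < 1) :
    (d : ℝ≥0∞) ≤ dimH (Set.Iic 3.334402 ∩ MarkovSpectrum) := by
  obtain ⟨θ₁, θ₂, hθ₁, hθ₂, hsteer⟩ := exists_steering
  obtain ⟨ρ, C, hρ0, hρ1, hC, hfam⟩ := exists_family hθ₁.1 hθ₁.2 hθ₂.1 hθ₂.2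
  obtain ⟨k, hk1, hk⟩ := exists_exponent hρ0 hρ1 hC (show (d : ℝ) < 1 by exact_mod_cast hd1)
  have c1 := one_le_den good_core.1.one_le le_rfl
  have c2 := one_le_den good_core.2.one_le le_rfl
  set D := 100 * (den 0 coreRight * den 0 coreLeft) with hD
  set δ := ρ ^ k / 13 with hδ
  obtain ⟨U, hU, hsteer⟩ := hsteer D δ (by positivity) (by positivity)
  set A := (104 * U) ^ 2 with hA
  have hA1 : 1 < A := by nlinarith
  obtain ⟨n, hn⟩ := pow_unbounded_of_one_lt A (show (1 : ℝ) < 2 by norm_num)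
  have hn1 : 1 ≤ n := by
    by_contra h
    rw [show n = 0 by omega, pow_zero] at hn
    linarith
  obtain ⟨t, ht1, ht2, b, m, m', hb, hm, hm', hsep⟩ := hfam k n
  set S := 1 / ρ ^ (n * k) with hS
  have hnk : n * k ≠ 0 := by positivity
  have hS1 : 1 < S := one_lt_one_div (by positivity) (pow_lt_one₀ hρ0.le hρ1 hnk)
  simp only [show 676 / ρ ^ (n * k) = 676 * S by rw [hS]; ring] at hm hm'
  have hρk : ρ ^ k ≤ 1 := pow_le_one₀ hρ0.le hρ1.le
  obtain ⟨x, y, V, V', halive, hdep, hcode⟩ := exists_coding hS1 hU hD ht1 ht2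
    (show δ ≤ 1 / 2 by rw [hδ]; linarith) hm hm' (hsteer t ht1 ht2)
  have hρd : 0 < ρ ^ (d : ℝ) := Real.rpow_pos_of_pos hρ0 _
  have hCk : 0 < C * ρ ^ k := by positivity
  have hCk2 : C * ρ ^ k ≤ 1 / 2 := by
    have : (ρ ^ (d : ℝ)) ^ k ≤ 1 := pow_le_one₀ hρd.le (Real.rpow_le_one hρ0.le hρ1.le d.2)
    linarith
  have hb1 : 1 < b := by
    have h2 : (2 : ℝ) ≤ 1 / (C * ρ ^ k) := by
      rw [le_div_iff₀ hCk]; linarith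
    have : (1 : ℝ) < b := by
      calc (1 : ℝ) < A := hA1
        _ < 2 ^ n := hn
        _ ≤ (1 / (C * ρ ^ k)) ^ n := by gcongr
        _ ≤ b := hb
    exact_mod_cast this
  set r := (A * S)⁻¹ with hr
  have hr0 : 0 < r := by positivity
  have hrd : (b : ℝ)⁻¹ ≤ r ^ (d : ℝ) := by
    have e1 : r = A⁻¹ * (ρ ^ n) ^ k := by
      rw [hr, hS, mul_inv, one_div, inv_inv, pow_mul]
    have e2 : r ^ (d : ℝ) = (A⁻¹) ^ (d : ℝ) * ((ρ ^ (d : ℝ)) ^ k) ^ n := by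
      rw [e1, Real.mul_rpow (by positivity) (by positivity), ← pow_mul, ← pow_mul,
        ← Real.rpow_natCast, ← Real.rpow_natCast, ← Real.rpow_mul hρ0.le, ← Real.rpow_mul hρ0.le,
        mul_comm n k, mul_comm (d : ℝ)]
    have e3 : A⁻¹ ≤ (A⁻¹) ^ (d : ℝ) := by
      calc A⁻¹ = (A⁻¹) ^ (1 : ℝ) := (Real.rpow_one _).symm
        _ ≤ _ := Real.rpow_le_rpow_of_exponent_ge (by positivity) (inv_le_one_of_one_le₀ hA1.le)
            (by exact_mod_cast hd1.le)
    calc (b : ℝ)⁻¹ ≤ ((1 / (C * ρ ^ k)) ^ n)⁻¹ := by gcongr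
      _ = (C * ρ ^ k) ^ n := by rw [← inv_pow, one_div, inv_inv]
      _ ≤ (1 / 2 * (ρ ^ (d : ℝ)) ^ k) ^ n := by gcongr
      _ = (2 ^ n)⁻¹ * ((ρ ^ (d : ℝ)) ^ k) ^ n := by rw [mul_pow, one_div, inv_pow]
      _ ≤ A⁻¹ * ((ρ ^ (d : ℝ)) ^ k) ^ n := by gcongr
      _ ≤ _ := by rw [e2]; gcongr
  have hmain := le_dimH_range hb1
    (e := fun ζ => 2 + app coreRight (cf01 (x ζ)) + app coreLeft (cf01 (y ζ)))
    (c := ρ ^ (n * k) / (4 * U ^ 2 * den 0 coreRight ^ 2)) (by positivity) hr0 hd0 hrd ?_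
  · refine hmain.trans (dimH_mono ?_)
    rintro _ ⟨ζ, rfl⟩
    exact mem_markovSpectrum (halive ζ).1 (halive ζ).2
  · intro ζ ζ' i hag hne
    obtain ⟨g1, g2, r1, r2, r3, r4, ⟨z, z0, z1, hz⟩, ⟨w, w0, w1, hw⟩⟩ := hcode ζ i
    obtain ⟨-, -, -, -, -, -, ⟨z', z0', z1', hz'⟩, ⟨w', w0', w1', hw'⟩⟩ := hcode ζ' i
    obtain ⟨j, hj, hjs⟩ := hsep _ _ hne
    obtain ⟨s1, s2, s3⟩ := hjs z z' w w' z0 z1 z0' z1' w0 w1 w0' w1'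
    rw [pow_add] at s3
    have h := branch_separation g1 g2 hθ₁ hθ₂ ht1 ht2 (τ := ρ ^ k) (by rw [hδ]; linarith) r1 r2 r3
      (app_mem (hm (ζ i)).1.one_le z0 z1) (app_mem (hm (ζ' i)).1.one_le z0' z1')
      (app_mem (hm' (ζ i)).1.one_le w0 w1) (app_mem (hm' (ζ' i)).1.one_le w0' w1') s1 s2 s3
    have hVV := hdep ζ ζ' i hag
    rw [← hVV.1] at hz'
    rw [← hVV.2] at hw'
    have d1 := one_le_den g1.one_le le_rfl
    simp only [hz, hw, hz', hw']
    rw [show ∀ a b c d : ℝ, 2 + a + b - (2 + c + d) = a + b - (c + d) by intros; ring]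
    refine le_trans ?_ h
    calc ρ ^ (n * k) / (4 * U ^ 2 * den 0 coreRight ^ 2) * r ^ i
        = ρ ^ (n * k) / (4 * U ^ 2 * den 0 coreRight ^ 2 * (A * S) ^ i) := by
          rw [hr, inv_pow]; field_simp
      _ ≤ ρ ^ (j + k) / den 0 (V ζ i) ^ 2 := by
          gcongr ?_ / ?_
          exact pow_le_pow_of_le_one hρ0.le hρ1.le hj
      _ = _ := by rw [pow_add]

lemma dimH_inner : dimH (Set.Iic 3.334402 ∩ MarkovSpectrum) = 1 := by
  refine le_antisymm ((dimH_mono (Set.subset_univ _)).trans Real.dimH_univ.le) ?_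
  refine le_of_forall_lt fun c hc => ?_
  obtain ⟨d, hcd, hd1⟩ := ENNReal.lt_iff_exists_nnreal_btwn.1 hc
  refine hcd.trans_le (le_dimH_inner ?_ (by exact_mod_cast hd1))
  exact_mod_cast (show (0 : ℝ≥0∞) ≤ c from bot_le).trans_lt hcd

end Bumby

/-- Rigorous confirmation of Bumby's heuristic localization of the first phase transition
point of the classical spectra: `3.334369 ≤ t₁ ≤ 3.334402`, where
`t₁ = inf { t : dim_H ((-∞, t] ∩ M) = 1 }`. -/
theorem first_transition_point_Bumby_bounds :
    3.334369 ≤ sInf { t : ℝ | dimH (Set.Iic t ∩ MarkovSpectrum) = 1 } ∧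
    sInf { t : ℝ | dimH (Set.Iic t ∩ MarkovSpectrum) = 1 } ≤ 3.334402 := by
  have hlow : ∀ t ∈ { t : ℝ | dimH (Set.Iic t ∩ MarkovSpectrum) = 1 }, (3.334369 : ℝ) ≤ t := by
    intro t ht
    by_contra! h
    have hmono : dimH (Set.Iic t ∩ MarkovSpectrum) ≤ dimH (Set.Iic 3.334369 ∩ MarkovSpectrum) :=
      dimH_mono (Set.inter_subset_inter_left _ (Set.Iic_subset_Iic.2 h.le))
    rw [ht] at hmono
    exact hmono.not_gt Bumby.dimH_outer
  exact ⟨le_csInf ⟨_, Bumby.dimH_inner⟩ hlow, csInf_le ⟨_, hlow⟩ Bumby.dimH_inner⟩
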